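/- Let r ≥ 4 be an integer and let H be a finite graph with chromatic number exactly r whose chromatic threshold δ_χ(H) equals (r-3)/(r-2). Let δ be a real number with (r-3)/(r-1) ≤ δ ≤ (r-3)/(r-2), and set f₂(r,δ) = δ(1-δ) + (1-δ)²/4 + (r-4)δ²/(2(r-3)). Then for every ε > 0 there exist a constant C and an integer n₀ such that every H-free graph G on n ≥ n₀ vertices with minimum degree at least δn and with more than (f₂(r,δ)+ε)n² edges satisfies χ(G) ≤ C. -/

import Mathlib

open SimpleGraph

/-- `H` is contained in `G` as a (not necessarily induced) subgraph. -/
def ContainsCopy {α β : Type*} (H : SimpleGraph α) (G : SimpleGraph β) : Prop :=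
  ∃ f : α → β, Function.Injective f ∧ ∀ ⦃a b⦄, H.Adj a b → G.Adj (f a) (f b)

/-- The chromatic threshold of `H`: the infimum of all `d > 0` such that there is a constant
`C` for which every `H`-free graph `G` on `n` vertices with minimum degree at least `d·n`
satisfies `χ(G) ≤ C`. -/
noncomputable def chromThreshold {α : Type*} (H : SimpleGraph α) : ℝ :=
  sInf {d : ℝ | 0 < d ∧ ∃ C : ℕ, ∀ (n : ℕ) (G : SimpleGraph (Fin n)),
    ¬ ContainsCopy H G → (∀ v, d * n ≤ ((G.neighborSet v).ncard : ℝ)) →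
    G.chromaticNumber ≤ (C : ℕ∞) }


open SimpleGraph

section P0

open Classical in
/-- indicator of a proposition -/
noncomputable def ind (p : Prop) : ℝ := if p then 1 else 0

lemma ind_nonneg (p : Prop) : 0 ≤ ind p := by unfold ind; split_ifs <;> norm_num
lemma ind_le_one (p : Prop) : ind p ≤ 1 := by unfold ind; split_ifs <;> norm_num
lemma ind_of {p : Prop} (h : p) : ind p = 1 := by simp [ind, h]
lemma ind_of_not {p : Prop} (h : ¬ p) : ind p = 0 := by simp [ind, h]
lemma ind_and (p q : Prop) : ind (p ∧ q) = ind p * ind q := by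
  unfold ind; by_cases hp : p <;> by_cases hq : q <;> simp [hp, hq]
lemma ind_mono {p q : Prop} (h : p → q) : ind p ≤ ind q := by
  unfold ind; by_cases hp : p
  · simp [hp, h hp]
  · simp only [hp, if_false]; split_ifs <;> norm_num
lemma ind_or_le (p q : Prop) : ind (p ∨ q) ≤ ind p + ind q := by
  unfold ind; by_cases hp : p <;> by_cases hq : q <;> simp [hp, hq]
lemma ind_not (p : Prop) : ind (¬ p) = 1 - ind p := by
  unfold ind; by_cases hp : p <;> simp [hp]

/-- number of elements satisfying a predicate, as a real -/
noncomputable def cnt {X : Type*} [Fintype X] (p : X → Prop) : ℝ := ∑ x, ind (p x)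

variable {X Y : Type*} [Fintype X] [Fintype Y]

lemma cnt_nonneg (p : X → Prop) : 0 ≤ cnt p := Finset.sum_nonneg fun _ _ => ind_nonneg _

lemma cnt_eq_card (p : X → Prop) [DecidablePred p] : cnt p = ((Finset.univ.filter p).card : ℝ) := by
  classical
  simp only [cnt, ind]
  rw [Finset.card_filter]
  push_cast
  exact Finset.sum_congr rfl fun x _ => by congr

lemma cnt_mono {p q : X → Prop} (h : ∀ x, p x → q x) : cnt p ≤ cnt q :=
  Finset.sum_le_sum fun x _ => ind_mono (h x)

lemma cnt_congr {p q : X → Prop} (h : ∀ x, p x ↔ q x) : cnt p = cnt q := by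
  congr 1; funext x; exact propext (h x)

lemma cnt_le_card (p : X → Prop) : cnt p ≤ (Fintype.card X : ℝ) := by
  classical
  rw [cnt_eq_card]; exact_mod_cast Finset.card_le_univ _

lemma cnt_true : cnt (fun _ : X => True) = (Fintype.card X : ℝ) := by
  classical
  rw [cnt_eq_card]; simp

lemma cnt_or_le (p q : X → Prop) : cnt (fun x => p x ∨ q x) ≤ cnt p + cnt q := by
  unfold cnt; rw [← Finset.sum_add_distrib]
  exact Finset.sum_le_sum fun x _ => ind_or_le _ _

lemma cnt_exists_pos {p : X → Prop} (h : 0 < cnt p) : ∃ x, p x := by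
  by_contra hc
  push Not at hc
  have : cnt p = 0 := Finset.sum_eq_zero fun x _ => ind_of_not (hc x)
  linarith

lemma cnt_exists_le {ι : Type*} [Fintype ι] (p : ι → X → Prop) :
    cnt (fun x => ∃ i, p i x) ≤ ∑ i, cnt (p i) := by
  unfold cnt; rw [Finset.sum_comm]
  refine Finset.sum_le_sum fun x _ => ?_
  by_cases h : ∃ i, p i x
  · obtain ⟨i, hi⟩ := h
    rw [ind_of ⟨i, hi⟩, ← ind_of hi]
    exact Finset.single_le_sum (f := fun i => ind (p i x)) (fun i _ => ind_nonneg _)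
      (Finset.mem_univ i)
  · rw [ind_of_not h]; exact Finset.sum_nonneg fun _ _ => ind_nonneg _

lemma cnt_prod (p : X × Y → Prop) : cnt p = ∑ x, cnt fun y => p (x, y) := by
  unfold cnt; rw [Fintype.sum_prod_type]

lemma cnt_prod_right (p : X × Y → Prop) : cnt p = ∑ y, cnt fun x => p (x, y) := by
  unfold cnt; rw [Fintype.sum_prod_type_right]

lemma cnt_equiv (e : X ≃ Y) (p : Y → Prop) : cnt (fun x => p (e x)) = cnt p := by
  unfold cnt; exact Equiv.sum_comp e fun y => ind (p y)

lemma cnt_not (p : X → Prop) : cnt (fun x => ¬ p x) = (Fintype.card X : ℝ) - cnt p := by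
  unfold cnt; simp [ind_not]

lemma cnt_inj_le {p : X → Prop} {q : Y → Prop} (f : X → Y) (hf : ∀ x x', p x → p x' → f x = f x' → x = x')
    (h : ∀ x, p x → q (f x)) : cnt p ≤ cnt q := by
  classical
  rw [cnt_eq_card, cnt_eq_card]
  norm_cast
  apply Finset.card_le_card_of_injOn f
  · intro x hx; simp at hx ⊢; exact h x hx
  · intro x hx x' hx' e
    simp at hx hx'
    exact hf x x' hx hx' e

lemma cnt_and_ge (p q : X → Prop) : cnt p - cnt (fun x => ¬ q x) ≤ cnt fun x => p x ∧ q x := by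
  have : cnt p ≤ cnt (fun x => (p x ∧ q x) ∨ ¬ q x) := cnt_mono fun x hx => by tauto
  have := cnt_or_le (fun x => p x ∧ q x) (fun x => ¬ q x)
  linarith

lemma cnt_const_and (P : Prop) (p : X → Prop) : cnt (fun x => P ∧ p x) = ind P * cnt p := by
  unfold cnt; rw [Finset.mul_sum]; simp [ind_and]

/-- restricting to the coordinates given by an equivalence `κ ≃ ι ⊕ ρ`. -/
lemma cnt_comp_inl {ι ρ V : Type*} [DecidableEq ι] [DecidableEq ρ] [Fintype ι] [Fintype ρ] [Fintype V]
    (C : (ι → V) → Prop) :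
    cnt (fun φ : (ι ⊕ ρ → V) => C (fun i => φ (Sum.inl i))) =
      cnt C * (Fintype.card V : ℝ) ^ Fintype.card ρ := by
  have := cnt_equiv (Equiv.sumArrowEquivProdArrow ι ρ V) (fun z => C z.1)
  have h2 : cnt (fun φ : (ι ⊕ ρ → V) => C (fun i => φ (Sum.inl i))) =
    cnt (fun z : (ι → V) × (ρ → V) => C z.1) := by
    rw [← this]; rfl
  rw [h2, cnt_prod]
  unfold cnt
  simp only [Finset.sum_const, Finset.card_univ, Fintype.card_fun, nsmul_eq_mul]
  rw [Finset.sum_mul]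
  refine Finset.sum_congr rfl fun x _ => ?_
  push_cast; ring

lemma cnt_comp_inj {ι κ V : Type*} [DecidableEq ι] [DecidableEq κ] [Fintype ι] [Fintype κ] [Fintype V]
    (f : ι → κ) (hf : Function.Injective f) (C : (ι → V) → Prop) :
    cnt (fun φ : (κ → V) => C (φ ∘ f)) * (Fintype.card V : ℝ) ^ Fintype.card ι =
      cnt C * (Fintype.card V : ℝ) ^ Fintype.card κ := by
  classical
  let ρ := {k : κ // ¬ k ∈ Set.range f}
  let e : ι ⊕ ρ ≃ κ :=
    (Equiv.sumCongr (Equiv.ofInjective f hf) (Equiv.refl ρ)).trans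
      (Equiv.sumCompl (fun k => k ∈ Set.range f))
  have he : ∀ i, e (Sum.inl i) = f i := by
    intro i
    change (Equiv.sumCompl fun k => k ∈ Set.range f) (Sum.inl ⟨f i, ⟨i, rfl⟩⟩) = f i
    exact Equiv.sumCompl_apply_inl _
  have h1 := cnt_equiv (Equiv.arrowCongr e (Equiv.refl V)).symm
    (fun φ : ι ⊕ ρ → V => C (fun i => φ (Sum.inl i)))
  have h2 : cnt (fun φ : (κ → V) => C (φ ∘ f)) = cnt C * (Fintype.card V : ℝ) ^ Fintype.card ρ := by
    refine Eq.trans ?_ (Eq.trans h1 (cnt_comp_inl C))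
    apply cnt_congr
    intro φ
    have : (fun i => ((Equiv.arrowCongr e (Equiv.refl V)).symm φ) (Sum.inl i)) = φ ∘ f := by
      funext i
      simp [Equiv.arrowCongr, he]
    rw [this]
  have hc : Fintype.card κ = Fintype.card ι + Fintype.card ρ := by
    rw [← Fintype.card_sum]; exact (Fintype.card_congr e).symm
  rw [h2, hc, pow_add]; ring

/-- resampling a coordinate -/
lemma sum_update {α V : Type*} [DecidableEq α] [Fintype α] [Fintype V] (i : α) (F : (α → V) → ℝ) :
    ∑ v, ∑ ω : α → V, F (Function.update ω i v) = (Fintype.card V : ℝ) * ∑ ω, F ω := by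
  have key : ∀ Φ : (α → V) → ℝ, ∑ ω, Φ ω = ∑ w : V, ∑ ρ : ({j // j ≠ i} → V),
      Φ ((Equiv.funSplitAt i V).symm (w, ρ)) := by
    intro Φ
    rw [← Fintype.sum_prod_type' (f := fun w ρ => Φ ((Equiv.funSplitAt i V).symm (w, ρ)))]
    exact (Equiv.sum_comp (Equiv.funSplitAt i V).symm Φ).symm
  have h2 : ∀ v w ρ, Function.update ((Equiv.funSplitAt i V).symm (w, ρ)) i v
      = (Equiv.funSplitAt i V).symm (v, ρ) := by
    intro v w ρ
    funext j
    by_cases hj : j = i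
    · subst hj; simp
    · simp [hj]
  rw [key F]
  simp only [key (fun ω => F (Function.update ω i _)), h2]
  simp only [Finset.sum_const, Finset.card_univ, nsmul_eq_mul]
  rw [Finset.mul_sum]

end P0


section P1
universe u

lemma jensen_dup {X Y T : Type*} [Fintype X] [Fintype Y] [Fintype T] [DecidableEq T]
    (C : X → Y → Prop) (η : ℝ) (hη : 0 ≤ η)
    (h : η * ((Fintype.card X : ℝ) * Fintype.card Y) ≤ cnt (fun z : X × Y => C z.1 z.2)) :
    η ^ Fintype.card T * ((Fintype.card X : ℝ) ^ Fintype.card T * Fintype.card Y) ≤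
      cnt (fun z : (T → X) × Y => ∀ t, C (z.1 t) z.2) := by
  have e1 : cnt (fun z : (T → X) × Y => ∀ t, C (z.1 t) z.2) =
      ∑ y, (cnt fun x => C x y) ^ Fintype.card T := by
    rw [cnt_prod_right]
    refine Finset.sum_congr rfl fun y _ => ?_
    unfold cnt
    have : ∀ f : T → X, ind (∀ t, C (f t) y) = ∏ t, ind (C (f t) y) := by
      intro f
      by_cases hf : ∀ t, C (f t) y
      · rw [ind_of hf, Finset.prod_eq_one fun t _ => ind_of (hf t)]
      · rw [ind_of_not hf]
        push Not at hf
        obtain ⟨t, ht⟩ := hf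
        exact (Finset.prod_eq_zero (Finset.mem_univ t) (ind_of_not ht)).symm
    simp only [this]
    rw [← Finset.card_univ (α := T), ← Finset.prod_const, Finset.prod_univ_sum]
    simp
  rw [e1]
  rw [cnt_prod_right] at h
  rcases hT : Fintype.card T with _ | m
  · simp
  · have hp := pow_sum_div_card_le_sum_pow (s := (Finset.univ : Finset Y))
      (f := fun y => cnt fun x => C x y) (fun y _ => cnt_nonneg _) m
    refine le_trans ?_ hp
    simp only [Finset.card_univ]
    rcases Nat.eq_zero_or_pos (Fintype.card Y) with hY | hY
    · rw [hY]; simp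
      apply div_nonneg
      · exact pow_nonneg (Finset.sum_nonneg fun _ _ => cnt_nonneg _) _
      · positivity
    · have hY' : (0:ℝ) < Fintype.card Y := by exact_mod_cast hY
      rw [le_div_iff₀ (by positivity)]
      have := pow_le_pow_left₀ (by positivity) h (m+1)
      refine le_trans (le_of_eq ?_) this
      ring

lemma blowup_aux {T : Type*} {V : Type u} [Fintype T] [DecidableEq T] [Fintype V] (η : ℝ) (hη : 0 ≤ η) (q : ℕ) :
    ∀ {Z : Type u} [Fintype Z] (C : Z → (Fin q → V) → Prop),
    η * ((Fintype.card Z : ℝ) * (Fintype.card V : ℝ) ^ q) ≤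
      cnt (fun z : Z × (Fin q → V) => C z.1 z.2) →
    η ^ (Fintype.card T ^ q) * ((Fintype.card Z : ℝ) * ((Fintype.card V : ℝ) ^ (Fintype.card T)) ^ q) ≤
      cnt (fun z : Z × (Fin q → T → V) => ∀ f : Fin q → T, C z.1 (fun i => z.2 i (f i))) := by
  induction q with
  | zero =>
    intro Z _ C h
    simp only [pow_zero, pow_one, mul_one] at h ⊢
    refine le_trans h (le_of_eq ?_)
    rw [cnt_prod, cnt_prod]
    refine Finset.sum_congr rfl fun z _ => ?_
    unfold cnt
    rw [Fintype.sum_unique, Fintype.sum_unique]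
    congr 1
    apply propext
    constructor
    · intro hc f; convert hc
    · intro hc; convert hc (fun i => Fin.elim0 i)
  | succ q ih =>
    intro Z _ C h
    have h1 := ih (Z := V × Z) (fun z κ => C z.2 (Fin.cons z.1 κ)) (by
      let e : (V × Z) × (Fin q → V) ≃ Z × (Fin (q+1) → V) :=
        { toFun := fun z => (z.1.2, Fin.cons z.1.1 z.2)
          invFun := fun z => ((z.2 0, z.1), Fin.tail z.2)
          left_inv := fun z => by simp
          right_inv := fun z => by simp }
      have := cnt_equiv e (fun z => C z.1 z.2)
      refine le_trans (le_of_eq ?_) (le_trans h (le_of_eq this.symm))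
      rw [Fintype.card_prod]; push_cast; ring)
    let e2 : (V × Z) × (Fin q → T → V) ≃ V × (Z × (Fin q → T → V)) := Equiv.prodAssoc _ _ _
    have h2 := cnt_equiv e2.symm
      (fun z => ∀ f : Fin q → T, C z.1.2 (Fin.cons z.1.1 (fun i => z.2 i (f i)) : Fin (q+1) → V))
    rw [← h2] at h1
    have h3 := jensen_dup (T := T) (X := V) (Y := Z × (Fin q → T → V))
      (fun v y => ∀ f : Fin q → T, C y.1 (Fin.cons v (fun i => y.2 i (f i)) : Fin (q+1) → V))
      (η ^ (Fintype.card T ^ q)) (by positivity) (by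
        refine le_trans (le_of_eq ?_) h1
        simp only [Fintype.card_prod, Fintype.card_fun, Fintype.card_fin]; push_cast; ring)
    let e3 : (T → V) × (Z × (Fin q → T → V)) ≃ Z × (Fin (q+1) → T → V) :=
        { toFun := fun z => (z.2.1, Fin.cons z.1 z.2.2)
          invFun := fun z => (z.2 0, (z.1, Fin.tail z.2))
          left_inv := fun z => by simp
          right_inv := fun z => by simp }
    have h4 := cnt_equiv e3 (fun z => ∀ f : Fin (q+1) → T, C z.1 (fun i => z.2 i (f i)))
    rw [← h4]
    refine le_trans (le_of_eq ?_) (le_trans h3 (cnt_mono ?_))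
    · simp only [Fintype.card_prod, Fintype.card_fun, Fintype.card_fin]
      rw [← pow_mul η, ← pow_succ]
      push_cast; ring
    · rintro ⟨g, z, ω⟩ hc f
      have := hc (f 0) (Fin.tail f)
      have e : (fun i => (e3 (g, z, ω)).2 i (f i)) =
          (Fin.cons (g (f 0)) (fun i => ω i (Fin.tail f i)) : Fin (q+1) → V) := by
        funext i
        refine Fin.cases ?_ (fun j => ?_) i
        · simp [e3]
        · simp [e3, Fin.tail]
      change C z (fun i => (e3 (g, z, ω)).2 i (f i))
      rw [e]; exact this

/-- blow-up of a dense family of cliques along a colouring -/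
lemma blowup_col {α : Type*} {V : Type u} [Fintype α] [DecidableEq α] [Fintype V] (G : SimpleGraph V)
    (q : ℕ) [NeZero q] (col : α → Option (Fin q)) (X : Fin q → V → Prop) (η : ℝ) (hη : 0 ≤ η)
    (h : η * (Fintype.card V : ℝ) ^ q ≤ cnt (fun κ : Fin q → V =>
      (∀ i j, i ≠ j → G.Adj (κ i) (κ j)) ∧ ∀ i, X i (κ i))) :
    η ^ (Fintype.card α ^ q) * (Fintype.card V : ℝ) ^ Fintype.card α ≤
      cnt (fun ω : α → V =>
        (∀ a a' i j, col a = some i → col a' = some j → i ≠ j → G.Adj (ω a) (ω a')) ∧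
        ∀ a i, col a = some i → X i (ω a)) := by
  classical
  rcases Nat.eq_zero_or_pos (Fintype.card V) with hV | hV
  · rw [hV] at h ⊢
    rcases Nat.eq_zero_or_pos (Fintype.card α) with ha | ha
    · rw [ha, zero_pow (NeZero.ne q)]
      have : IsEmpty α := Fintype.card_eq_zero_iff.mp ha
      simp only [pow_zero, mul_one]
      have : cnt (fun ω : α → V =>
        (∀ a a' i j, col a = some i → col a' = some j → i ≠ j → G.Adj (ω a) (ω a')) ∧
        ∀ a i, col a = some i → X i (ω a)) = cnt (fun _ : α → V => True) :=
        cnt_congr fun ω => ⟨fun _ => trivial, fun _ => ⟨fun a => isEmptyElim a, fun a => isEmptyElim a⟩⟩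
      rw [this, cnt_true]; simp
    · have h0 : ((0:ℕ):ℝ) ^ Fintype.card α = 0 := by
        rw [Nat.cast_zero, zero_pow (by omega)]
      rw [h0, mul_zero]; exact cnt_nonneg _
  have hV' : (0:ℝ) < Fintype.card V := by exact_mod_cast hV
  have h1 := blowup_aux (T := α) (V := V) η hη q (Z := PUnit.{u+1}) (fun _ κ =>
      (∀ i j, i ≠ j → G.Adj (κ i) (κ j)) ∧ ∀ i, X i (κ i)) (by
    rw [cnt_prod]; simpa using h)
  rw [cnt_prod] at h1
  simp only [Finset.univ_unique, Finset.sum_singleton, Fintype.card_punit, Nat.cast_one, one_mul] at h1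
  have h2 := cnt_equiv (Equiv.curry (Fin q) α V) (fun z : Fin q → α → V =>
    ∀ f : Fin q → α, (∀ i j, i ≠ j → G.Adj (z i (f i)) (z j (f j))) ∧ ∀ i, X i (z i (f i)))
  rw [← h2] at h1
  let f : α → Fin q × α := fun a => ((col a).getD 0, a)
  have hf : Function.Injective f := fun a b hab => (Prod.ext_iff.mp hab).2
  have h3 := cnt_comp_inj f hf (V := V) (fun ω : α → V =>
        (∀ a a' i j, col a = some i → col a' = some j → i ≠ j → G.Adj (ω a) (ω a')) ∧
        ∀ a i, col a = some i → X i (ω a))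
  have h4 : η ^ (Fintype.card α ^ q) * ((Fintype.card V : ℝ) ^ (Fintype.card α)) ^ q ≤
    cnt (fun φ : Fin q × α → V => (fun ω : α → V =>
        (∀ a a' i j, col a = some i → col a' = some j → i ≠ j → G.Adj (ω a) (ω a')) ∧
        ∀ a i, col a = some i → X i (ω a)) (φ ∘ f)) := by
    refine le_trans h1 (cnt_mono ?_)
    intro φ hφ
    refine ⟨?_, ?_⟩
    · intro a a' i j hi hj hij
      have := (hφ (fun k => if k = i then a else a')).1 i j hij
      simpa [f, hi, hj, Equiv.curry, Function.curry, Ne.symm hij] using this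
    · intro a i hi
      have := (hφ (fun _ => a)).2 i
      simpa [f, hi, Equiv.curry, Function.curry] using this
  have h5 := mul_le_mul_of_nonneg_right h4 (pow_nonneg hV'.le (Fintype.card α))
  rw [h3] at h5
  simp only [Fintype.card_prod, Fintype.card_fin] at h5
  rw [← pow_mul, mul_comm (Fintype.card α) q, mul_assoc, mul_comm _ ((Fintype.card V : ℝ) ^ Fintype.card α),
    ← mul_assoc] at h5
  exact le_of_mul_le_mul_right h5 (by positivity)

end P1


section P2

/-- from a positive-density family of maps we can pick an injective one avoiding a small set -/
lemma inj_avoid {α V : Type*} [Fintype α] [DecidableEq α] [Fintype V] (p : (α → V) → Prop) (c : ℝ)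
    (S : Finset V)
    (hp : c * (Fintype.card V : ℝ) ^ Fintype.card α ≤ cnt p)
    (hn : (Fintype.card α : ℝ) ^ 2 + Fintype.card α * S.card < c * Fintype.card V) :
    ∃ ω, p ω ∧ Function.Injective ω ∧ ∀ a, ω a ∉ S := by
  classical
  set n : ℝ := (Fintype.card V : ℝ) with hn'
  set h : ℝ := (Fintype.card α : ℝ) with hh
  have hcard : ((Fintype.card (α → V) : ℕ) : ℝ) = n ^ Fintype.card α := by
    rw [Fintype.card_fun]; push_cast; rfl
  have hnn : 0 ≤ n := by positivity
  have hn0 : 0 < n := by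
    rcases hnn.eq_or_lt with h0 | h0
    · rw [← h0] at hn; have : (0:ℝ) ≤ h^2 + h * S.card := by positivity
      linarith
    · exact h0
  have h1 : ∀ a b : α, a ≠ b → n * cnt (fun ω : α → V => ω a = ω b) = n ^ Fintype.card α := by
    intro a b hab
    unfold cnt
    rw [← sum_update a, Finset.sum_comm]
    rw [← hcard, ← cnt_true]
    unfold cnt
    refine Finset.sum_congr rfl fun ω _ => ?_
    rw [Finset.sum_eq_single (ω b)]
    · simp [Function.update_of_ne (Ne.symm hab)]
    · intro v _ hv
      apply ind_of_not
      simpa [Function.update_of_ne (Ne.symm hab)] using hv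
    · simp
  have h2 : ∀ a : α, n * cnt (fun ω : α → V => ω a ∈ S) = S.card * n ^ Fintype.card α := by
    intro a
    unfold cnt
    rw [← sum_update a]
    simp only [Function.update_self, Finset.sum_const, Finset.card_univ, nsmul_eq_mul, hcard]
    rw [← Finset.mul_sum, mul_comm]
    congr 1
    have := cnt_eq_card (fun v => v ∈ S)
    unfold cnt at this
    rw [this]; simp
  by_contra hc
  push Not at hc
  have h3 : cnt p ≤ cnt (fun ω : α → V => (∃ ab : α × α, ab.1 ≠ ab.2 ∧ ω ab.1 = ω ab.2) ∨ ∃ a, ω a ∈ S) := by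
    apply cnt_mono
    intro ω hω
    by_cases hi : Function.Injective ω
    · exact Or.inr (hc ω hω hi)
    · left
      unfold Function.Injective at hi
      push Not at hi
      obtain ⟨a, b, h, h'⟩ := hi
      exact ⟨(a, b), h', h⟩
  have h4 := h3.trans ((cnt_or_le _ _).trans (add_le_add (cnt_exists_le _) (cnt_exists_le _)))
  have h5 : n * cnt p ≤ (h ^ 2 + h * S.card) * n ^ Fintype.card α := by
    refine (mul_le_mul_of_nonneg_left h4 hnn).trans ?_
    rw [mul_add, add_mul, Finset.mul_sum, Finset.mul_sum]
    apply add_le_add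
    · calc _ ≤ ∑ _ab : α × α, n ^ Fintype.card α := by
            refine Finset.sum_le_sum fun ab _ => ?_
            rw [cnt_const_and]
            by_cases hab : ab.1 ≠ ab.2
            · rw [ind_of hab, one_mul, h1 _ _ hab]
            · rw [ind_of_not hab]; simp; positivity
        _ = _ := by
          rw [Finset.sum_const, Finset.card_univ, Fintype.card_prod, nsmul_eq_mul, hh]; push_cast; ring
    · simp only [h2]; simp; rw [← mul_assoc]
  have h6 : n * (c * n ^ Fintype.card α) ≤ n * cnt p := mul_le_mul_of_nonneg_left hp hnn
  have h7 : (c * n) * n ^ Fintype.card α ≤ (h ^ 2 + h * S.card) * n ^ Fintype.card α := by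
    refine le_trans (le_of_eq ?_) (h6.trans h5); ring
  have := le_of_mul_le_mul_right h7 (by positivity)
  linarith

lemma frieze_kannan {V Λ : Type*} [Fintype V] [Fintype Λ] (K : V → Λ → ℝ)
    (hK0 : ∀ v ω, 0 ≤ K v ω) (hK1 : ∀ v ω, K v ω ≤ 1) (ε : ℝ) (hε : 0 < ε) (k : ℕ) :
    ∃ (A : Fin k → V → Prop) (γ : V → Λ → ℝ),
      (∀ v v', (∀ i, A i v ↔ A i v') → γ v = γ v') ∧ (∀ v ω, |γ v ω| ≤ k * ε) ∧
      ((∀ (a : V → Prop) (b : Λ → Prop), |∑ v, ∑ ω, (K v ω - γ v ω) * (ind (a v) * ind (b ω))| ≤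
          ε * (Fintype.card V * Fintype.card Λ)) ∨
        ∑ v, ∑ ω, (K v ω - γ v ω) ^ 2 ≤ (Fintype.card V * Fintype.card Λ : ℝ) * (1 - k * ε ^ 2)) := by
  classical
  induction k with
  | zero =>
    refine ⟨fun i => i.elim0, fun _ _ => 0, fun _ _ _ => rfl, by simp, Or.inr ?_⟩
    calc _ ≤ ∑ v : V, ∑ ω : Λ, (1:ℝ) := by
          refine Finset.sum_le_sum fun v _ => Finset.sum_le_sum fun ω _ => ?_
          have := hK0 v ω; have := hK1 v ω
          nlinarith
      _ = _ := by simp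
  | succ k ih =>
    obtain ⟨A, γ, h1, h2, h3⟩ := ih
    by_cases hreg : ∀ (a : V → Prop) (b : Λ → Prop),
        |∑ v, ∑ ω, (K v ω - γ v ω) * (ind (a v) * ind (b ω))| ≤
          ε * (Fintype.card V * Fintype.card Λ)
    · refine ⟨Fin.cons (fun _ => True) A, γ, ?_, ?_, Or.inl hreg⟩
      · intro v v' h
        exact h1 v v' fun i => by simpa using h i.succ
      · intro v ω; refine (h2 v ω).trans ?_; push_cast; nlinarith
    · have h3 := h3.resolve_left hreg
      push Not at hreg
      obtain ⟨a, b, hab⟩ := hreg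
      set s := ∑ v, ∑ ω, (K v ω - γ v ω) * (ind (a v) * ind (b ω)) with hs
      obtain ⟨σ, hσ, hσs⟩ : ∃ σ : ℝ, σ ^ 2 = 1 ∧ σ * s = |s| := by
        rcases le_total 0 s with h | h
        · exact ⟨1, by norm_num, by rw [abs_of_nonneg h]; ring⟩
        · exact ⟨-1, by norm_num, by rw [abs_of_nonpos h]; ring⟩
      have hσ1 : |σ| = 1 := by
        have : |σ| ^ 2 = 1 := by rw [sq_abs, hσ]
        have h0 := abs_nonneg σ
        nlinarith
      refine ⟨Fin.cons a A, fun v ω => γ v ω + σ * ε * (ind (a v) * ind (b ω)), ?_, ?_, Or.inr ?_⟩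
      · intro v v' h
        have e1 := h1 v v' fun i => by simpa using h i.succ
        have e2 : a v ↔ a v' := by simpa using h 0
        funext ω
        simp only [e1, propext e2]
      · intro v ω
        have e1 : |σ * ε * (ind (a v) * ind (b ω))| ≤ ε := by
          rw [abs_mul, abs_mul, hσ1, abs_of_pos hε, one_mul, ← ind_and, abs_of_nonneg (ind_nonneg _)]
          have := ind_le_one (a v ∧ b ω)
          nlinarith
        have := abs_add_le (γ v ω) (σ * ε * (ind (a v) * ind (b ω)))
        have := h2 v ω
        push_cast; linarith
      · have key : ∑ v, ∑ ω, (K v ω - (γ v ω + σ * ε * (ind (a v) * ind (b ω)))) ^ 2 ≤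
            ∑ v, ∑ ω, ((K v ω - γ v ω) ^ 2 - 2 * σ * ε * ((K v ω - γ v ω) * (ind (a v) * ind (b ω))) + ε ^ 2) := by
          refine Finset.sum_le_sum fun v _ => Finset.sum_le_sum fun ω _ => ?_
          have e0 := ind_nonneg (a v ∧ b ω)
          have e1 := ind_le_one (a v ∧ b ω)
          rw [ind_and] at e0 e1
          set x := ind (a v) * ind (b ω)
          have e2 : x ^ 2 ≤ 1 := by nlinarith
          have e3 : (K v ω - (γ v ω + σ * ε * x)) ^ 2 = (K v ω - γ v ω) ^ 2 -
            2 * σ * ε * ((K v ω - γ v ω) * x) + (σ ^ 2) * ε ^ 2 * x ^ 2 := by ring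
          rw [e3, hσ]
          nlinarith [sq_nonneg ε]
        refine key.trans ?_
        simp only [Finset.sum_add_distrib, Finset.sum_sub_distrib, ← Finset.mul_sum]
        rw [← hs]
        simp only [Finset.sum_const, Finset.card_univ, nsmul_eq_mul]
        have e4 : 2 * σ * ε * s = 2 * ε * |s| := by rw [← hσs]; ring
        rw [e4]
        push_cast
        have e5 := mul_lt_mul_of_pos_left hab hε
        nlinarith

lemma lemR (ε : ℝ) (hε : 0 < ε) : ∃ (k : ℕ) (β : ℝ), 0 < β ∧
    ∀ {α V : Type*} [Fintype α] [DecidableEq α] [Fintype V] (Ω : (α → V) → Prop) (i : α)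
      (X : V → Prop), (∀ ω, Ω ω → X (ω i)) →
      ∃ P : (Fin k → Bool) → V → Prop, (∀ j v, P j v → X v) ∧
        ∀ (a : V → Prop) (κ : ℝ), 0 ≤ κ → κ ≤ 1 →
          (∀ j, β * (Fintype.card V : ℝ) ≤ cnt (P j) → κ * cnt (P j) ≤ cnt (fun v => P j v ∧ a v)) →
          ∀ b : (α → V) → Prop, (∀ ω v, b (Function.update ω i v) ↔ b ω) →
            κ * cnt (fun ω => Ω ω ∧ b ω) - ε * (Fintype.card V : ℝ) ^ Fintype.card α ≤
              cnt (fun ω => Ω ω ∧ b ω ∧ a (ω i)) := by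
  classical
  set ε' := ε / 4 with hε'
  have hε'0 : 0 < ε' := by positivity
  obtain ⟨k, hk⟩ := exists_nat_gt (1 / ε' ^ 2)
  have hk' : 1 < k * ε' ^ 2 := by rwa [div_lt_iff₀ (by positivity)] at hk
  have hkpos : (0:ℝ) < k := lt_trans (by positivity) hk
  refine ⟨k, 1 / (2 ^ k * k), by positivity, ?_⟩
  intro α V _ _ _ Ω i X hX
  set n : ℝ := (Fintype.card V : ℝ) with hn
  set β : ℝ := 1 / (2 ^ k * k) with hβ
  rcases Nat.eq_zero_or_pos (Fintype.card V) with hV | hV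
  · have hVe : IsEmpty V := Fintype.card_eq_zero_iff.mp hV
    refine ⟨fun _ _ => False, by simp, ?_⟩
    intro a κ _ _ _ b _
    have : IsEmpty (α → V) := ⟨fun f => hVe.elim (f i)⟩
    have e : ∀ p : (α → V) → Prop, cnt p = 0 := fun p => by simp [cnt]
    rw [e, e]
    have : 0 ≤ ε * n ^ Fintype.card α := by positivity
    linarith
  have hn0 : 0 < n := by rw [hn]; exact_mod_cast hV
  set Kf : V → (α → V) → ℝ := fun v ω => ind (Ω (Function.update ω i v)) with hKf
  obtain ⟨A, γ, g1, g2, g3⟩ := frieze_kannan Kf (fun _ _ => ind_nonneg _)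
    (fun _ _ => ind_le_one _) ε' hε'0 k
  set N : ℝ := (Fintype.card (α → V) : ℝ) with hN
  have hNe : N = n ^ Fintype.card α := by
    rw [hN, Fintype.card_fun]; push_cast; rfl
  have hN0 : 0 < N := by rw [hNe]; positivity
  have g3 := g3.resolve_right (by
    have h0 : 0 ≤ ∑ v, ∑ ω, (Kf v ω - γ v ω) ^ 2 := by positivity
    have : n * N * (1 - k * ε' ^ 2) < 0 := mul_neg_of_pos_of_neg (by positivity) (by linarith)
    intro hh; linarith)
  refine ⟨fun j v => X v ∧ ∀ i, (A i v ↔ j i = true), fun j v h => h.1, ?_⟩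
  intro a κ hκ0 hκ1 hheavy b hb
  set P : (Fin k → Bool) → V → Prop := fun j v => X v ∧ ∀ i, (A i v ↔ j i = true) with hP
  set Γ : V → ℝ := fun v => ∑ ω, γ v ω * ind (b ω) with hΓ
  have hS : ∀ a' : V → Prop, ∑ v, ∑ ω, Kf v ω * (ind (a' v) * ind (b ω)) =
      n * cnt (fun ω => Ω ω ∧ b ω ∧ a' (ω i)) := by
    intro a'
    unfold cnt
    rw [← sum_update i]
    refine Finset.sum_congr rfl fun v _ => Finset.sum_congr rfl fun ω _ => ?_
    rw [ind_and, ind_and, Function.update_self, propext (hb ω v)]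
    ring
  have hdiff : ∀ a' : V → Prop, |n * cnt (fun ω => Ω ω ∧ b ω ∧ a' (ω i)) - ∑ v, ind (a' v) * Γ v| ≤
      ε' * (n * N) := by
    intro a'
    rw [← hS]
    convert g3 a' b using 2
    rw [← Finset.sum_sub_distrib]
    refine Finset.sum_congr rfl fun v _ => ?_
    rw [hΓ, Finset.mul_sum, ← Finset.sum_sub_distrib]
    refine Finset.sum_congr rfl fun ω _ => ?_
    ring
  have hΓb : ∀ v, |Γ v| ≤ k * ε' * N := by
    intro v
    refine (Finset.abs_sum_le_sum_abs _ _).trans ?_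
    calc _ ≤ ∑ _ω : α → V, k * ε' := by
          refine Finset.sum_le_sum fun ω _ => ?_
          rw [abs_mul, abs_of_nonneg (ind_nonneg _)]
          have := g2 v ω; have := ind_le_one (b ω); have := ind_nonneg (b ω)
          have := abs_nonneg (γ v ω)
          nlinarith
      _ = _ := by rw [Finset.sum_const, Finset.card_univ, nsmul_eq_mul, hN]; ring
  have hΓc : ∀ j v v', P j v → P j v' → Γ v = Γ v' := by
    intro j v v' hv hv'
    have := g1 v v' fun i => (hv.2 i).trans (hv'.2 i).symm
    simp only [hΓ, this]
  have hpart : ∀ F : V → ℝ, ∑ v, ind (X v) * F v = ∑ j, ∑ v, ind (P j v) * F v := by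
    intro F
    rw [Finset.sum_comm]
    refine Finset.sum_congr rfl fun v _ => ?_
    rw [← Finset.sum_mul]
    congr 1
    rw [Finset.sum_eq_single (fun i => decide (A i v))]
    · simp [hP]
    · intro j _ hj
      apply ind_of_not
      rintro ⟨_, h⟩
      apply hj
      funext i
      rw [Bool.eq_iff_iff]; simp [h i]
    · simp
  -- main inequality on each part
  have hmain : ∀ j, κ * ∑ v, ind (P j v) * max (Γ v) 0 + ∑ v, ind (P j v) * min (Γ v) 0
      - k * ε' * N * (β * n) ≤ ∑ v, ind (P j v) * (ind (a v) * Γ v) := by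
    intro j
    by_cases hj : ∃ v, P j v
    swap
    · push Not at hj
      have e : ∀ F : V → ℝ, ∑ v, ind (P j v) * F v = 0 := fun F =>
        Finset.sum_eq_zero fun v _ => by rw [ind_of_not (hj v), zero_mul]
      rw [e, e, e]
      have : 0 ≤ k * ε' * N * (β * n) := by positivity
      linarith
    obtain ⟨v0, hv0⟩ := hj
    have e : ∀ f : ℝ → ℝ, ∑ v, ind (P j v) * f (Γ v) = cnt (P j) * f (Γ v0) := by
      intro f
      unfold cnt
      rw [Finset.sum_mul]
      refine Finset.sum_congr rfl fun v _ => ?_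
      by_cases hv : P j v
      · rw [hΓc j v v0 hv hv0]
      · rw [ind_of_not hv]; simp
    have e' : ∑ v, ind (P j v) * (ind (a v) * Γ v) = cnt (fun v => P j v ∧ a v) * Γ v0 := by
      unfold cnt
      rw [Finset.sum_mul]
      refine Finset.sum_congr rfl fun v _ => ?_
      rw [ind_and (P j v) (a v)]
      by_cases hv : P j v
      · rw [hΓc j v v0 hv hv0]; ring
      · rw [ind_of_not hv]; simp
    rw [e (fun x => max x 0), e (fun x => min x 0), e']
    have hc0 : 0 ≤ cnt (P j) := cnt_nonneg _
    have hca0 : 0 ≤ cnt (fun v => P j v ∧ a v) := cnt_nonneg _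
    have hca1 : cnt (fun v => P j v ∧ a v) ≤ cnt (P j) := cnt_mono fun v h => h.1
    have hpos : 0 ≤ k * ε' * N * (β * n) := by positivity
    rcases le_total 0 (Γ v0) with hs | hs
    · rw [max_eq_left hs, min_eq_right hs]
      by_cases hbig : β * n ≤ cnt (P j)
      · have := mul_le_mul_of_nonneg_right (hheavy j hbig) hs
        linarith
      · push Not at hbig
        have h1 : Γ v0 ≤ k * ε' * N := (le_abs_self _).trans (hΓb v0)
        have h2 : cnt (P j) * Γ v0 ≤ (β * n) * (k * ε' * N) :=
          mul_le_mul hbig.le h1 hs (by positivity)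
        have h3 : 0 ≤ cnt (fun v => P j v ∧ a v) * Γ v0 := mul_nonneg hca0 hs
        have h4 : κ * (cnt (P j) * Γ v0) ≤ cnt (P j) * Γ v0 :=
          mul_le_of_le_one_left (mul_nonneg hc0 hs) hκ1
        linarith
    · rw [max_eq_right hs, min_eq_left hs]
      nlinarith
  have hsum := Finset.sum_le_sum fun j (_ : j ∈ (Finset.univ : Finset (Fin k → Bool))) => hmain j
  rw [← hpart (fun v => ind (a v) * Γ v), Finset.sum_sub_distrib, Finset.sum_add_distrib, ← Finset.mul_sum,
    ← hpart (fun v => max (Γ v) 0), ← hpart (fun v => min (Γ v) 0)] at hsum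
  simp only [Finset.sum_const, Finset.card_univ, Fintype.card_fun, Fintype.card_bool, Fintype.card_fin,
    nsmul_eq_mul] at hsum
  have hsm : ((2 ^ k : ℕ) : ℝ) * (k * ε' * N * (β * n)) = ε' * (n * N) := by
    rw [hβ]; push_cast; field_simp
  rw [hsm] at hsum
  -- negative part
  have hneg : -(ε' * (n * N)) ≤ ∑ v, ind (X v) * min (Γ v) 0 := by
    have h1 := hdiff (fun v => X v ∧ Γ v ≤ 0)
    have h2 : ∑ v, ind (X v ∧ Γ v ≤ 0) * Γ v = ∑ v, ind (X v) * min (Γ v) 0 := by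
      refine Finset.sum_congr rfl fun v _ => ?_
      rw [ind_and]
      rcases le_total (Γ v) 0 with hs | hs
      · rw [ind_of hs, min_eq_left hs]; ring
      · rw [min_eq_right hs]
        rcases hs.eq_or_lt with h | h
        · rw [← h]; ring
        · rw [ind_of_not (not_le.mpr h)]; ring
    rw [h2] at h1
    have h3 : 0 ≤ n * cnt (fun ω => Ω ω ∧ b ω ∧ (X (ω i) ∧ Γ (ω i) ≤ 0)) :=
      mul_nonneg hn0.le (cnt_nonneg _)
    have := (abs_le.mp h1).2
    linarith
  have hposi : n * cnt (fun ω => Ω ω ∧ b ω) - ε' * (n * N) ≤ ∑ v, ind (X v) * max (Γ v) 0 := by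
    have h1 := (abs_le.mp (hdiff X)).2
    have h2 : cnt (fun ω => Ω ω ∧ b ω ∧ X (ω i)) = cnt (fun ω => Ω ω ∧ b ω) :=
      cnt_congr fun ω => ⟨fun h => ⟨h.1, h.2.1⟩, fun h => ⟨h.1, h.2, hX ω h.1⟩⟩
    rw [h2] at h1
    have h3 : ∑ v, ind (X v) * Γ v ≤ ∑ v, ind (X v) * max (Γ v) 0 :=
      Finset.sum_le_sum fun v _ => mul_le_mul_of_nonneg_left (le_max_left _ _) (ind_nonneg _)
    linarith
  have hfin := (abs_le.mp (hdiff (fun v => X v ∧ a v))).1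
  have h2 : cnt (fun ω => Ω ω ∧ b ω ∧ (X (ω i) ∧ a (ω i))) = cnt (fun ω => Ω ω ∧ b ω ∧ a (ω i)) :=
      cnt_congr fun ω => ⟨fun h => ⟨h.1, h.2.1, h.2.2.2⟩, fun h => ⟨h.1, h.2.1, hX ω h.1, h.2.2⟩⟩
  rw [h2] at hfin
  have h3 : ∑ v, ind (X v ∧ a v) * Γ v = ∑ v, ind (X v) * (ind (a v) * Γ v) := by
    refine Finset.sum_congr rfl fun v _ => ?_
    rw [ind_and]; ring
  rw [h3] at hfin
  have h4 := mul_le_mul_of_nonneg_left hposi hκ0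
  have h5 : κ * (ε' * (n * N)) ≤ ε' * (n * N) := mul_le_of_le_one_left (by positivity) hκ1
  have h6 : n * (κ * cnt (fun ω => Ω ω ∧ b ω) - ε * N) ≤ n * cnt (fun ω => Ω ω ∧ b ω ∧ a (ω i)) := by
    have : ε = 4 * ε' := by rw [hε']; ring
    rw [this]
    nlinarith
  rw [← hNe]
  exact le_of_mul_le_mul_left h6 hn0

end P2


section P3

/-- subgraph of the edges satisfying a relation (in both directions) -/
def restr {V : Type*} (D : SimpleGraph V) (L : V → V → Prop) : SimpleGraph V where
  Adj x y := D.Adj x y ∧ L x y ∧ L y x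
  symm := ⟨fun _ _ h => ⟨h.1.symm, h.2.2, h.2.1⟩⟩
  loopless := ⟨fun x h => D.irrefl h.1⟩

lemma colorable_cover {V : Type*} (D D1 D2 : SimpleGraph V) (k1 k2 : ℕ)
    (h1 : D1.Colorable k1) (h2 : D2.Colorable k2)
    (h : ∀ x y, D.Adj x y → D1.Adj x y ∨ D2.Adj x y) : D.Colorable (k1 * k2) := by
  obtain ⟨c1⟩ := h1
  obtain ⟨c2⟩ := h2
  have : D.Coloring (Fin k1 × Fin k2) := SimpleGraph.Coloring.mk (fun v => (c1 v, c2 v)) (by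
    intro x y hxy he
    rcases h x y hxy with h' | h'
    · exact c1.valid h' (Prod.ext_iff.mp he).1
    · exact c2.valid h' (Prod.ext_iff.mp he).2)
  have := this.colorable
  simpa [Fintype.card_prod] using this

lemma colorable_cover_fin {V ι : Type*} [Fintype ι] (D D2 : SimpleGraph V) (Di : ι → SimpleGraph V)
    (k1 k2 : ℕ) (h1 : ∀ i, (Di i).Colorable k1) (h2 : D2.Colorable k2)
    (h : ∀ x y, D.Adj x y → D2.Adj x y ∨ ∃ i, (Di i).Adj x y) :
    D.Colorable (k1 ^ Fintype.card ι * k2) := by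
  classical
  have c1 := fun i => Classical.choice (h1 i)
  obtain ⟨c2⟩ := h2
  have : D.Coloring ((ι → Fin k1) × Fin k2) := SimpleGraph.Coloring.mk (fun v => (fun i => c1 i v, c2 v)) (by
    intro x y hxy he
    rcases h x y hxy with h' | ⟨i, h'⟩
    · exact c2.valid h' (Prod.ext_iff.mp he).2
    · exact (c1 i).valid h' (congrFun (Prod.ext_iff.mp he).1 i))
  have := this.colorable
  simpa [Fintype.card_prod] using this

lemma colorable_touch {V : Type*} (D : SimpleGraph V) (L : V → Prop) (k : ℕ)
    (h : (restr D (fun x _ => L x)).Colorable k) :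
    (restr D (fun x y => L x ∨ L y)).Colorable (k + 1) := by
  classical
  obtain ⟨c⟩ := h
  have : (restr D (fun x y => L x ∨ L y)).Coloring (Option (Fin k)) :=
    SimpleGraph.Coloring.mk (fun v => if L v then some (c v) else none) (by
      intro x y hxy he
      by_cases hx : L x <;> by_cases hy : L y
      · simp only [hx, hy, if_true, Option.some.injEq] at he
        exact c.valid (show (restr D (fun x _ => L x)).Adj x y from ⟨hxy.1, hx, hy⟩) he
      · simp [hx, hy] at he
      · simp [hx, hy] at he
      · have := hxy.2.1; tauto)
  have := this.colorable
  simpa using this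

lemma core_exists {V : Type*} [Fintype V] [DecidableEq V] (D : SimpleGraph V) [DecidableRel D.Adj] (k : ℕ)
    (h : ¬ D.Colorable k) : ∃ W : Finset V, W.Nonempty ∧ ∀ x ∈ W, k ≤ (W.filter (D.Adj x)).card := by
  by_contra hc
  push Not at hc
  rcases Nat.eq_zero_or_pos k with rfl | hk
  · by_cases hV : Nonempty V
    · obtain ⟨x, _, hx⟩ := hc Finset.univ Finset.univ_nonempty
      omega
    · exact h ⟨SimpleGraph.Coloring.mk (fun v => (hV ⟨v⟩).elim) (by intro v; exact (hV ⟨v⟩).elim)⟩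
  have key : ∀ m, ∀ W : Finset V, W.card = m → ∃ c : V → Fin k, ∀ x ∈ W, ∀ y ∈ W, D.Adj x y → c x ≠ c y := by
    intro m
    induction m with
    | zero =>
      intro W hW
      rw [Finset.card_eq_zero] at hW
      subst hW
      exact ⟨fun _ => ⟨0, hk⟩, by simp⟩
    | succ m ih =>
      intro W hW
      obtain ⟨x, hx, hd⟩ := hc W (Finset.card_pos.mp (by omega))
      obtain ⟨c, hcc⟩ := ih (W.erase x) (by rw [Finset.card_erase_of_mem hx]; omega)
      obtain ⟨col, hcol⟩ : ∃ col : Fin k, col ∉ (W.filter (D.Adj x)).image c := by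
        by_contra hn
        push Not at hn
        have : (Finset.univ : Finset (Fin k)) ⊆ (W.filter (D.Adj x)).image c := fun i _ => hn i
        have h1 := Finset.card_le_card this
        have h2 := Finset.card_image_le (s := W.filter (D.Adj x)) (f := c)
        simp at h1
        omega
      refine ⟨Function.update c x col, ?_⟩
      intro a ha b hb hab
      simp only [Finset.mem_image, Finset.mem_filter, not_exists, not_and] at hcol
      by_cases hax : a = x
      · subst hax
        have hba : b ≠ a := hab.ne'
        rw [Function.update_self, Function.update_of_ne hba]
        exact fun e => hcol b ⟨hb, hab⟩ e.symm
      · by_cases hbx : b = x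
        · subst hbx
          rw [Function.update_self, Function.update_of_ne hax]
          exact fun e => hcol a ⟨ha, hab.symm⟩ e
        · rw [Function.update_of_ne hax, Function.update_of_ne hbx]
          exact hcc a (Finset.mem_erase.mpr ⟨hax, ha⟩) b (Finset.mem_erase.mpr ⟨hbx, hb⟩) hab
  obtain ⟨c, hcc⟩ := key _ Finset.univ rfl
  exact h ⟨SimpleGraph.Coloring.mk c (fun {x y} hxy => hcc x (Finset.mem_univ _) y (Finset.mem_univ _) hxy)⟩

/-- the edge `xy` is light for `P` -/
def lightE {V : Type*} [Fintype V] (G : SimpleGraph V) (κ : ℝ) (P : V → Prop) (x y : V) : Prop :=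
  cnt (fun v => P v ∧ G.Adj x v ∧ G.Adj y v) < κ * cnt P

/-- the vertex `x` is light for `P` -/
def lightV {V : Type*} [Fintype V] (G : SimpleGraph V) (κ : ℝ) (P : V → Prop) (x : V) : Prop :=
  cnt (fun v => P v ∧ G.Adj x v) < κ * cnt P

structure Solid {V : Type*} [Fintype V] (G D : SimpleGraph V) (A B : V → Prop) (κ β : ℝ) (k : ℕ) : Prop where
  hA : ∀ P : V → Prop, (∀ v, P v → A v) → β * (Fintype.card V : ℝ) ≤ cnt P →
    (restr D (lightE G κ P)).Colorable k
  hB : ∀ P : V → Prop, (∀ v, P v → B v) → β * (Fintype.card V : ℝ) ≤ cnt P →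
    (restr D (fun x _ => lightV G κ P x)).Colorable k

lemma solid_aux (κ β : ℝ) (g : ℕ → ℕ) {V : Type*} [Fintype V] (G : SimpleGraph V)
    (m : ℕ) : ∀ (A B : V → Prop) (D : SimpleGraph V),
      (∀ x y, D.Adj x y → cnt (fun v => ¬ A v ∧ G.Adj x v ∧ G.Adj y v) ≤ κ * cnt (fun v => ¬ A v)) →
      (∀ x y, D.Adj x y → cnt (fun v => ¬ B v ∧ G.Adj x v) ≤ κ * cnt (fun v => ¬ B v)) →
      cnt A + cnt B < m * (β * (Fintype.card V : ℝ)) → ¬ D.Colorable (g^[m] 0) →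
      ∃ (A' B' : V → Prop) (D' : SimpleGraph V) (k' : ℕ), D' ≤ D ∧ ¬ D'.Colorable (g k') ∧
        Solid G D' A' B' κ β k' ∧
        (∀ x y, D'.Adj x y → cnt (fun v => ¬ A' v ∧ G.Adj x v ∧ G.Adj y v) ≤ κ * cnt (fun v => ¬ A' v)) ∧
        (∀ x y, D'.Adj x y → cnt (fun v => ¬ B' v ∧ G.Adj x v) ≤ κ * cnt (fun v => ¬ B' v)) := by
  induction m with
  | zero =>
    intro A B D _ _ h _
    have := cnt_nonneg A; have := cnt_nonneg B
    simp at h; linarith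
  | succ m ih =>
    intro A B D hA hB h hD
    by_cases hs : Solid G D A B κ β (g^[m] 0)
    · refine ⟨A, B, D, g^[m] 0, le_rfl, ?_, hs, hA, hB⟩
      rwa [Function.iterate_succ_apply'] at hD
    · have hsplit : ∀ (A P : V → Prop), (∀ v, P v → A v) → ∀ Q : V → Prop,
          cnt (fun v => ¬ (A v ∧ ¬ P v) ∧ Q v) = cnt (fun v => ¬ A v ∧ Q v) + cnt (fun v => P v ∧ Q v) := by
        intro A P hPA Q
        unfold cnt
        rw [← Finset.sum_add_distrib]
        refine Finset.sum_congr rfl fun v _ => ?_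
        unfold ind
        by_cases h1 : A v <;> by_cases h2 : P v <;> by_cases h3 : Q v <;> simp_all
      have hsplit0 : ∀ (A P : V → Prop), (∀ v, P v → A v) →
          cnt (fun v => ¬ (A v ∧ ¬ P v)) = cnt (fun v => ¬ A v) + cnt P := by
        intro A P hPA
        have := hsplit A P hPA (fun _ => True)
        simpa using this
      have hminus : ∀ (A P : V → Prop), (∀ v, P v → A v) → cnt (fun v => A v ∧ ¬ P v) = cnt A - cnt P := by
        intro A P hPA
        have := hsplit0 A P hPA
        rw [cnt_not, cnt_not] at this
        linarith
      by_cases hsA : ∀ P : V → Prop, (∀ v, P v → A v) → β * (Fintype.card V : ℝ) ≤ cnt P →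
        (restr D (lightE G κ P)).Colorable (g^[m] 0)
      · have hsB : ¬ ∀ P : V → Prop, (∀ v, P v → B v) → β * (Fintype.card V : ℝ) ≤ cnt P →
          (restr D (fun x _ => lightV G κ P x)).Colorable (g^[m] 0) := fun hb => hs ⟨hsA, hb⟩
        push Not at hsB
        obtain ⟨P, hPB, hPc, hPn⟩ := hsB
        obtain ⟨A', B', D', k', h1, h2⟩ := ih A (fun v => B v ∧ ¬ P v) (restr D (fun x _ => lightV G κ P x))
          (fun x y hxy => hA x y hxy.1) (fun x y hxy => by
            rw [hsplit B P hPB, hsplit0 B P hPB]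
            have e1 := hB x y hxy.1
            have e2 : cnt (fun v => P v ∧ G.Adj x v) < κ * cnt P := hxy.2.1
            linarith) (by
            rw [hminus B P hPB]; push_cast at h; linarith) hPn
        exact ⟨A', B', D', k', h1.trans (fun x y hxy => hxy.1), h2⟩
      · push Not at hsA
        obtain ⟨P, hPA, hPc, hPn⟩ := hsA
        obtain ⟨A', B', D', k', h1, h2⟩ := ih (fun v => A v ∧ ¬ P v) B (restr D (lightE G κ P))
          (fun x y hxy => by
            rw [hsplit A P hPA, hsplit0 A P hPA]
            have e1 := hA x y hxy.1
            have e2 : cnt (fun v => P v ∧ G.Adj x v ∧ G.Adj y v) < κ * cnt P := hxy.2.1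
            linarith) (fun x y hxy => hB x y hxy.1) (by
            rw [hminus A P hPA]; push_cast at h; linarith) hPn
        exact ⟨A', B', D', k', h1.trans (fun x y hxy => hxy.1), h2⟩

lemma solid_extract (κ β : ℝ) (hκ : 0 ≤ κ) (hβ : 0 < β) (g : ℕ → ℕ) : ∃ K : ℕ, ∀ {V : Type*} [Fintype V]
    (G D : SimpleGraph V), ¬ D.Colorable K →
      ∃ (A' B' : V → Prop) (D' : SimpleGraph V) (k' : ℕ), D' ≤ D ∧ ¬ D'.Colorable (g k') ∧
        Solid G D' A' B' κ β k' ∧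
        (∀ x y, D'.Adj x y → cnt (fun v => ¬ A' v ∧ G.Adj x v ∧ G.Adj y v) ≤ κ * Fintype.card V) ∧
        (∀ x y, D'.Adj x y → cnt (fun v => ¬ B' v ∧ G.Adj x v) ≤ κ * Fintype.card V) := by
  obtain ⟨m, hm⟩ := exists_nat_gt (2 / β)
  rw [div_lt_iff₀ hβ] at hm
  refine ⟨g^[m] 0, ?_⟩
  intro V _ G D hD
  have hV : 0 < Fintype.card V := by
    rcases Nat.eq_zero_or_pos (Fintype.card V) with h | h
    · have hVe : IsEmpty V := Fintype.card_eq_zero_iff.mp h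
      exact (hD ⟨SimpleGraph.Coloring.mk (fun v => isEmptyElim v) (by intro v; exact isEmptyElim v)⟩).elim
    · exact h
  have hV' : (0:ℝ) < Fintype.card V := by exact_mod_cast hV
  have hF : cnt (fun v : V => ¬ True) = 0 := by rw [cnt_not, cnt_true]; ring
  obtain ⟨A', B', D', k', h1, h2, h3, h4, h5⟩ := solid_aux κ β g G m (fun _ => True) (fun _ => True) D
    (by intro x y _; simp only [not_true_eq_false, false_and]; exact le_of_eq (by simp [cnt, ind]))
    (by intro x y _; simp only [not_true_eq_false, false_and]; exact le_of_eq (by simp [cnt, ind]))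
    (by rw [cnt_true]; nlinarith) hD
  refine ⟨A', B', D', k', h1, h2, h3, fun x y hxy => (h4 x y hxy).trans ?_, fun x y hxy => (h5 x y hxy).trans ?_⟩
  · exact mul_le_mul_of_nonneg_left (cnt_le_card _) hκ
  · exact mul_le_mul_of_nonneg_left (cnt_le_card _) hκ

end P3


section P4
universe u

variable {W : Type u} [Fintype W]

/-- real degree -/
noncomputable def rdeg (D : SimpleGraph W) (x : W) : ℝ := cnt (D.Adj x)

lemma rdeg_nonneg (D : SimpleGraph W) (x : W) : 0 ≤ rdeg D x := cnt_nonneg _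

structure Pruned (D : SimpleGraph W) (E : W → W → Prop) (m θ : ℝ) : Prop where
  sub : ∀ x y, E x y → D.Adj x y
  mass : m * ∑ x, rdeg D x ≤ ∑ x, cnt (E x)
  tail : ∀ x, (∃ y, E x y) → θ * rdeg D x ≤ cnt (E x)
  head : ∀ y, (∃ x, E x y) → θ * rdeg D y ≤ cnt (fun x => E x y)

lemma prune_half (f : (W → W → Prop) → ℝ) (D : SimpleGraph W) (θ : ℝ) (E : W → W → Prop)
    (hf : ∀ E', f E' = ∑ x, ∑ y, ind (E' x y) - θ * ∑ x, ind (∃ y, E' x y) * rdeg D x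
      - θ * ∑ y, ind (∃ x, E' x y) * rdeg D y) (hθ : 0 ≤ θ)
    (x0 : W) (hx0 : ∃ y, E x0 y) (hlt : cnt (E x0) < θ * rdeg D x0) :
    f E < f (fun x y => E x y ∧ x ≠ x0) := by
  classical
  rw [hf, hf]
  have e1 : ∑ x, ∑ y, ind (E x y) = ∑ x, ∑ y, ind (E x y ∧ x ≠ x0) + cnt (E x0) := by
    rw [← Finset.add_sum_erase Finset.univ _ (Finset.mem_univ x0),
      ← Finset.add_sum_erase Finset.univ (fun x => ∑ y, ind (E x y ∧ x ≠ x0)) (Finset.mem_univ x0)]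
    have h1 : ∑ y, ind (E x0 y ∧ x0 ≠ x0) = 0 := Finset.sum_eq_zero fun y _ => ind_of_not (by simp)
    have h2 : ∑ x ∈ Finset.univ.erase x0, ∑ y, ind (E x y ∧ x ≠ x0) =
        ∑ x ∈ Finset.univ.erase x0, ∑ y, ind (E x y) := by
      refine Finset.sum_congr rfl fun x hx => Finset.sum_congr rfl fun y _ => ?_
      have := Finset.ne_of_mem_erase hx
      simp [this]
    rw [h1, h2]; unfold cnt; ring
  have e2 : ∑ x, ind (∃ y, E x y) * rdeg D x =
      ∑ x, ind (∃ y, E x y ∧ x ≠ x0) * rdeg D x + rdeg D x0 := by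
    rw [← Finset.add_sum_erase Finset.univ _ (Finset.mem_univ x0),
      ← Finset.add_sum_erase Finset.univ (fun x => ind (∃ y, E x y ∧ x ≠ x0) * rdeg D x) (Finset.mem_univ x0)]
    have h1 : ind (∃ y, E x0 y ∧ x0 ≠ x0) = 0 := ind_of_not (by simp)
    have h2 : ∑ x ∈ Finset.univ.erase x0, ind (∃ y, E x y ∧ x ≠ x0) * rdeg D x =
        ∑ x ∈ Finset.univ.erase x0, ind (∃ y, E x y) * rdeg D x := by
      refine Finset.sum_congr rfl fun x hx => ?_
      have := Finset.ne_of_mem_erase hx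
      simp [this]
    rw [h1, h2, ind_of hx0]; ring
  have e3 : ∑ y, ind (∃ x, E x y ∧ x ≠ x0) * rdeg D y ≤ ∑ y, ind (∃ x, E x y) * rdeg D y := by
    refine Finset.sum_le_sum fun y _ => mul_le_mul_of_nonneg_right (ind_mono ?_) (rdeg_nonneg _ _)
    rintro ⟨x, h, _⟩; exact ⟨x, h⟩
  have e4 := mul_le_mul_of_nonneg_left e3 hθ
  rw [e1, e2]
  linarith

lemma prune (D : SimpleGraph W) (E : W → W → Prop) (c : ℝ) (hc : 0 ≤ c)
    (hE : ∀ x y, E x y → D.Adj x y) (hm : c * ∑ x, rdeg D x ≤ ∑ x, cnt (E x)) :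
    ∃ E' : W → W → Prop, (∀ x y, E' x y → E x y) ∧ Pruned D E' (c / 2) (c / 4) := by
  classical
  let f : (W → W → Prop) → ℝ := fun E' => ∑ x, ∑ y, ind (E' x y) -
    (c/4) * ∑ x, ind (∃ y, E' x y) * rdeg D x - (c/4) * ∑ y, ind (∃ x, E' x y) * rdeg D y
  have hf : ∀ E', f E' = ∑ x, ∑ y, ind (E' x y) -
    (c/4) * ∑ x, ind (∃ y, E' x y) * rdeg D x - (c/4) * ∑ y, ind (∃ x, E' x y) * rdeg D y := fun _ => rfl
  have : Nonempty {E' : W → W → Prop // ∀ x y, E' x y → E x y} := ⟨⟨E, fun _ _ h => h⟩⟩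
  obtain ⟨⟨E', hE'⟩, hmax⟩ := Finite.exists_max (fun z : {E' : W → W → Prop // ∀ x y, E' x y → E x y} => f z.1)
  have hd : ∀ p : W → Prop, (c/4) * ∑ x, ind (p x) * rdeg D x ≤ (c/4) * ∑ x, rdeg D x := by
    intro p
    refine mul_le_mul_of_nonneg_left (Finset.sum_le_sum fun x _ => ?_) (by positivity)
    exact mul_le_of_le_one_left (rdeg_nonneg _ _) (ind_le_one _)
  have hd0 : ∀ p : W → Prop, 0 ≤ (c/4) * ∑ x, ind (p x) * rdeg D x := by
    intro p
    exact mul_nonneg (by positivity) (Finset.sum_nonneg fun x _ => mul_nonneg (ind_nonneg _) (rdeg_nonneg _ _))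
  refine ⟨E', hE', fun x y h => hE x y (hE' x y h), ?_, ?_, ?_⟩
  · have h1 := hmax ⟨E, fun _ _ h => h⟩
    simp only [hf] at h1
    have h2 := hd (fun x => ∃ y, E x y)
    have h3 := hd (fun y => ∃ x, E x y)
    have h4 := hd0 (fun x => ∃ y, E' x y)
    have h5 := hd0 (fun y => ∃ x, E' x y)
    unfold cnt at hm ⊢
    linarith
  · intro x0 hx0
    by_contra hlt
    push Not at hlt
    have h1 := prune_half f D (c/4) E' hf (by positivity) x0 hx0 hlt
    have h2 := hmax ⟨fun x y => E' x y ∧ x ≠ x0, fun x y h => hE' x y h.1⟩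
    simp only at h2
    linarith
  · intro y0 hy0
    by_contra hlt
    push Not at hlt
    have h1 := prune_half (fun E => f (fun x y => E y x)) D (c/4) (fun x y => E' y x) (by
      intro E''
      simp only [hf]
      rw [Finset.sum_comm]
      ring) (by positivity) y0 hy0 hlt
    have h2 := hmax ⟨fun x y => E' x y ∧ y ≠ y0, fun x y h => hE' x y h.1⟩
    simp only at h2
    linarith

/-- a good embedding of (part of) a rooted tree into the dart set `E` -/
structure GoodT {α : Type*} (ρ : α) (par : α → α) (dep : α → ℕ) (Q : Finset α)
    (E : W → W → Prop) (ψ : α → W) : Prop where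
  inj : ∀ s ∈ Q, ∀ t ∈ Q, ψ s = ψ t → s = t
  even : ∀ t ∈ Q, Even (dep t) → ∃ y, E (ψ t) y
  odd : ∀ t ∈ Q, ¬ Even (dep t) → ∃ x, E x (ψ t)
  edgeE : ∀ t ∈ Q, t ≠ ρ → Even (dep t) → E (ψ t) (ψ (par t))
  edgeO : ∀ t ∈ Q, t ≠ ρ → ¬ Even (dep t) → E (ψ (par t)) (ψ t)

lemma tree_weights {α : Type*} [DecidableEq α] (ρ : α) (par : α → α) (dep : α → ℕ) (hρ : dep ρ = 0)
    (D : SimpleGraph W) (m θ : ℝ) (hm0 : 0 ≤ m) (hθ0 : 0 < θ) (hθ1 : θ ≤ 1) (h : ℕ)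
    (hM : 0 < ∑ x, rdeg D x)
    (hdeg : ∀ x, 2 * h ≤ θ * rdeg D x) (s : ℕ) :
    ∀ Q : Finset α, Q.card = s + 1 → Q.card ≤ h → ρ ∈ Q →
      (∀ t ∈ Q, t ≠ ρ → par t ∈ Q ∧ dep t = dep (par t) + 1) →
      ∃ (I : Type u) (_ : Fintype I) (w : I → ℝ) (ψ : I → α → W), (∀ i, 0 ≤ w i) ∧ ∑ i, w i ≤ 1 ∧
        ∀ E, Pruned D E m θ → m * (θ / 2) ^ s ≤ ∑ i, w i * ind (GoodT ρ par dep Q E (ψ i)) := by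
  classical
  induction s with
  | zero =>
    intro Q hQ _ hρQ _
    have hQe : Q = {ρ} := by
      obtain ⟨a, ha⟩ := Finset.card_eq_one.mp hQ
      subst ha
      simp at hρQ; rw [hρQ]
    subst hQe
    refine ⟨W, inferInstance, fun x => rdeg D x / ∑ x, rdeg D x, fun x _ => x, ?_, ?_, ?_⟩
    · intro i; exact div_nonneg (rdeg_nonneg _ _) hM.le
    · rw [← Finset.sum_div]; exact (div_self hM.ne').le
    · intro E hE
      have h1 : ∀ x, cnt (E x) ≤ rdeg D x * ind (GoodT ρ par dep {ρ} E (fun _ => x)) := by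
        intro x
        by_cases hx : ∃ y, E x y
        · rw [ind_of, mul_one]
          · exact cnt_mono (hE.sub x)
          · refine ⟨?_, ?_, ?_, ?_, ?_⟩
            · intro s hs t ht _; simp at hs ht; rw [hs, ht]
            · intro t _ _; exact hx
            · intro t ht ho; simp at ht; subst ht; rw [hρ] at ho; simp at ho
            · intro t ht hne; simp at ht; exact (hne ht).elim
            · intro t ht hne; simp at ht; exact (hne ht).elim
        · push Not at hx
          have : cnt (E x) = 0 := Finset.sum_eq_zero fun y _ => ind_of_not (hx y)
          rw [this]; exact mul_nonneg (rdeg_nonneg _ _) (ind_nonneg _)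
      have h2 := hE.mass.trans (Finset.sum_le_sum fun x _ => h1 x)
      simp only [pow_zero, mul_one]
      rw [← le_div_iff₀ hM] at h2
      refine h2.trans (le_of_eq ?_)
      rw [Finset.sum_div]
      refine Finset.sum_congr rfl fun x _ => ?_
      ring
  | succ s ih =>
    intro Q hQ hQh hρQ hpar
    obtain ⟨t, htQ, hmax⟩ := Finset.exists_max_image Q dep ⟨ρ, hρQ⟩
    have htρ : t ≠ ρ := by
      rintro rfl
      have : Q ⊆ {t} := by
        intro a ha
        by_contra hne
        simp at hne
        have := (hpar a ha hne).2
        have := hmax a ha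
        omega
      have := Finset.card_le_card this
      simp at this; omega
    have hQ' : (Q.erase t).card = s + 1 := by rw [Finset.card_erase_of_mem htQ]; omega
    obtain ⟨I, _, w, ψ, hw0, hw1, hmass⟩ := ih (Q.erase t) hQ' (by omega)
      (Finset.mem_erase.mpr ⟨htρ.symm, hρQ⟩) (by
        intro a ha hne
        have haQ := Finset.mem_of_mem_erase ha
        obtain ⟨h1, h2⟩ := hpar a haQ hne
        refine ⟨Finset.mem_erase.mpr ⟨?_, h1⟩, h2⟩
        intro e
        have := hmax a haQ
        rw [e] at h2; omega)
    obtain ⟨hpQ, hpd⟩ := hpar t htQ htρ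
    have hpt : par t ≠ t := by intro e; rw [e] at hpd; omega
    have hpQ' : par t ∈ Q.erase t := Finset.mem_erase.mpr ⟨hpt, hpQ⟩
    refine ⟨I × W, inferInstance,
      fun z => w z.1 * (ind (D.Adj (ψ z.1 (par t)) z.2) / rdeg D (ψ z.1 (par t))),
      fun z => Function.update (ψ z.1) t z.2, ?_, ?_, ?_⟩
    · rintro ⟨i, v⟩
      exact mul_nonneg (hw0 i) (div_nonneg (ind_nonneg _) (rdeg_nonneg _ _))
    · rw [Fintype.sum_prod_type]
      refine le_trans (Finset.sum_le_sum fun i _ => ?_) hw1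
      simp only
      rw [← Finset.mul_sum, ← Finset.sum_div]
      refine mul_le_of_le_one_right (hw0 i) ?_
      exact div_self_le_one (rdeg D (ψ i (par t)))
    · intro E hE
      have h1 := hmass E hE
      have h2 := mul_le_mul_of_nonneg_right h1 (show 0 ≤ θ / 2 by positivity)
      refine le_trans (le_of_eq (by ring)) (h2.trans ?_)
      rw [Fintype.sum_prod_type, Finset.sum_mul]
      refine Finset.sum_le_sum fun i _ => ?_
      simp only
      by_cases hg : GoodT ρ par dep (Q.erase t) E (ψ i)
      swap
      · rw [ind_of_not hg, mul_zero, zero_mul]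
        refine Finset.sum_nonneg fun v _ => ?_
        exact mul_nonneg (mul_nonneg (hw0 i) (div_nonneg (ind_nonneg _) (rdeg_nonneg _ _))) (ind_nonneg _)
      rw [ind_of hg, mul_one]
      set p := ψ i (par t) with hp
      -- possible choices
      set E1 : W → Prop := fun v => if Even (dep t) then E v p else E p v with hE1
      have hE1D : ∀ v, E1 v → D.Adj p v := by
        intro v hv
        simp only [hE1] at hv
        split_ifs at hv
        · exact (hE.sub _ _ hv).symm
        · exact hE.sub _ _ hv
      have hE1c : θ * rdeg D p ≤ cnt E1 := by
        by_cases he : Even (dep t)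
        · have ho : ¬ Even (dep (par t)) := by
            intro hh; rw [hpd] at he; exact (Nat.even_add_one.mp he) hh
          have : E1 = fun v => E v p := by funext v; simp [hE1, he]
          rw [this]
          exact hE.head p (hg.odd _ hpQ' ho)
        · have ho : Even (dep (par t)) := by
            by_contra hh; rw [hpd] at he; exact he (Nat.even_add_one.mpr hh)
          have : E1 = fun v => E p v := by funext v; simp [hE1, he]
          rw [this]
          exact hE.tail p (hg.even _ hpQ' ho)
      have hgood : ∀ v, E1 v → (¬ ∃ a ∈ Q.erase t, ψ i a = v) →
          GoodT ρ par dep Q E (Function.update (ψ i) t v) := by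
        intro v hv hnew
        push Not at hnew
        have hu : ∀ a ∈ Q, a ≠ t → a ∈ Q.erase t := fun a ha hne => Finset.mem_erase.mpr ⟨hne, ha⟩
        have hparne : ∀ a ∈ Q, a ≠ ρ → par a ≠ t := by
          intro a ha hne e
          have := (hpar a ha hne).2
          have := hmax a ha
          rw [e] at *; omega
        refine ⟨?_, ?_, ?_, ?_, ?_⟩
        · intro a ha b hb hab
          by_cases h1 : a = t <;> by_cases h2 : b = t
          · rw [h1, h2]
          · subst h1
            rw [Function.update_self, Function.update_of_ne h2] at hab
            exact (hnew b (hu b hb h2) hab.symm).elim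
          · subst h2
            rw [Function.update_self, Function.update_of_ne h1] at hab
            exact (hnew a (hu a ha h1) hab).elim
          · rw [Function.update_of_ne h1, Function.update_of_ne h2] at hab
            exact hg.inj a (hu a ha h1) b (hu b hb h2) hab
        · intro a ha hev
          by_cases h1 : a = t
          · subst h1
            rw [Function.update_self]
            simp only [hE1, hev, if_true] at hv
            exact ⟨_, hv⟩
          · rw [Function.update_of_ne h1]; exact hg.even a (hu a ha h1) hev
        · intro a ha hev
          by_cases h1 : a = t
          · subst h1
            rw [Function.update_self]
            simp only [hE1, hev, if_false] at hv
            exact ⟨_, hv⟩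
          · rw [Function.update_of_ne h1]; exact hg.odd a (hu a ha h1) hev
        · intro a ha hne hev
          rw [Function.update_of_ne (hparne a ha hne)]
          by_cases h1 : a = t
          · subst h1
            rw [Function.update_self]
            simpa only [hE1, hev, if_true] using hv
          · rw [Function.update_of_ne h1]; exact hg.edgeE a (hu a ha h1) hne hev
        · intro a ha hne hev
          rw [Function.update_of_ne (hparne a ha hne)]
          by_cases h1 : a = t
          · subst h1
            rw [Function.update_self]
            simpa only [hE1, hev, if_false] using hv
          · rw [Function.update_of_ne h1]; exact hg.edgeO a (hu a ha h1) hne hev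
      have hused : cnt (fun v => ∃ a ∈ Q.erase t, ψ i a = v) ≤ h := by
        rw [cnt_eq_card]
        have : Finset.univ.filter (fun v => ∃ a ∈ Q.erase t, ψ i a = v) ⊆ (Q.erase t).image (ψ i) := by
          intro v hv; simp at hv ⊢; exact hv
        have h1 := (Finset.card_le_card this).trans Finset.card_image_le
        have h2 : (Q.erase t).card ≤ h := by omega
        exact_mod_cast h1.trans h2
      have hcount : θ / 2 * rdeg D p ≤ cnt (fun v => E1 v ∧ ¬ ∃ a ∈ Q.erase t, ψ i a = v) := by
        have h1 := cnt_and_ge E1 (fun v => ¬ ∃ a ∈ Q.erase t, ψ i a = v)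
        simp only [not_not] at h1
        have := hdeg p
        linarith
      have hh : 0 < h := by
        have : 0 < Q.card := Finset.card_pos.mpr ⟨ρ, hρQ⟩
        omega
      have hdp : 0 < rdeg D p := by
        have := hdeg p
        have h2 : (0:ℝ) < h := by exact_mod_cast hh
        by_contra hneg
        push Not at hneg
        nlinarith
      have hfin : cnt (fun v => E1 v ∧ ¬ ∃ a ∈ Q.erase t, ψ i a = v) ≤
          ∑ v, ind (D.Adj p v) * ind (GoodT ρ par dep Q E (Function.update (ψ i) t v)) := by
        unfold cnt
        refine Finset.sum_le_sum fun v _ => ?_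
        rw [← ind_and]
        exact ind_mono fun hv => ⟨hE1D v hv.1, hgood v hv.1 hv.2⟩
      have h3 := hcount.trans hfin
      have h4 : ∑ v, w i * (ind (D.Adj p v) / rdeg D p) * ind (GoodT ρ par dep Q E (Function.update (ψ i) t v))
          = w i * ((∑ v, ind (D.Adj p v) * ind (GoodT ρ par dep Q E (Function.update (ψ i) t v))) / rdeg D p) := by
        rw [Finset.sum_div, Finset.mul_sum]
        refine Finset.sum_congr rfl fun v _ => ?_
        ring
      rw [h4]
      refine mul_le_mul_of_nonneg_left ?_ (hw0 i)
      rw [le_div_iff₀ hdp]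
      exact h3

/-- Lemma T -/
lemma treeT {α Λ : Type*} [DecidableEq α] [Fintype Λ] (ρ : α) (par : α → α) (dep : α → ℕ) (hρ : dep ρ = 0)
    (D : SimpleGraph W) [Nonempty W] (c : ℝ) (hc : 0 < c) (hc1 : c ≤ 1) (h : ℕ)
    (hdeg : ∀ x, 16 * h ≤ c * rdeg D x) (S : W → W → Λ → Prop)
    (hS : ∀ x y, D.Adj x y → c * Fintype.card Λ ≤ cnt (S x y))
    (Q : Finset α) (hQh : Q.card ≤ h) (hρQ : ρ ∈ Q)
    (hpar : ∀ t ∈ Q, t ≠ ρ → par t ∈ Q ∧ dep t = dep (par t) + 1) :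
    ∃ ψ : α → W, (c / 2) * ((c / 4) * (c / 16) ^ h) * Fintype.card Λ ≤
      cnt (fun ω => GoodT ρ par dep Q (fun x y => D.Adj x y ∧ S x y ω) ψ) := by
  classical
  have hQpos : 0 < Q.card := Finset.card_pos.mpr ⟨ρ, hρQ⟩
  have hh : (0:ℝ) < h := by exact_mod_cast lt_of_lt_of_le hQpos hQh
  have hdp : ∀ x, 0 < rdeg D x := by
    intro x
    have := hdeg x
    by_contra hneg
    push Not at hneg
    nlinarith
  have hM : 0 < ∑ x, rdeg D x := Finset.sum_pos (fun x _ => hdp x) Finset.univ_nonempty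
  set M := ∑ x, rdeg D x with hMdef
  obtain ⟨I, _, w, ψ, hw0, hw1, hmass⟩ := tree_weights ρ par dep hρ D (c/4) (c/8) (by positivity)
    (by positivity) (by linarith) h hM (by intro x; have := hdeg x; linarith) (Q.card - 1) Q (by omega) hQh hρQ hpar
  set E : Λ → W → W → Prop := fun ω x y => D.Adj x y ∧ S x y ω with hE
  have hsum : c * M * Fintype.card Λ ≤ ∑ ω, ∑ x, cnt (E ω x) := by
    unfold cnt
    rw [Finset.sum_comm]
    rw [hMdef, Finset.mul_sum, Finset.sum_mul]
    refine Finset.sum_le_sum fun x _ => ?_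
    rw [Finset.sum_comm]
    unfold rdeg cnt
    rw [Finset.mul_sum, Finset.sum_mul]
    refine Finset.sum_le_sum fun y _ => ?_
    by_cases hxy : D.Adj x y
    · have := hS x y hxy
      rw [ind_of hxy, mul_one]
      refine this.trans (cnt_mono fun ω hω => ⟨hxy, hω⟩)
    · rw [ind_of_not hxy]; simp; exact Finset.sum_nonneg fun _ _ => ind_nonneg _
  set Lg : Λ → Prop := fun ω => (c/2) * M ≤ ∑ x, cnt (E ω x) with hLg
  have hEM : ∀ ω, ∑ x, cnt (E ω x) ≤ M := fun ω =>
    Finset.sum_le_sum fun x _ => cnt_mono fun y hy => hy.1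
  have hLgc : (c/2) * Fintype.card Λ ≤ cnt Lg := by
    have h1 : ∑ ω, ∑ x, cnt (E ω x) ≤ ∑ ω, (ind (Lg ω) * M + (c/2) * M) := by
      refine Finset.sum_le_sum fun ω _ => ?_
      by_cases hl : Lg ω
      · rw [ind_of hl]; have := hEM ω; have : 0 ≤ c/2 * M := by positivity
        linarith
      · rw [ind_of_not hl]; simp only [hLg] at hl; push Not at hl; linarith
    rw [Finset.sum_add_distrib, ← Finset.sum_mul] at h1
    simp only [Finset.sum_const, Finset.card_univ, nsmul_eq_mul] at h1
    have h2 := hsum.trans h1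
    have h3 : (c/2) * Fintype.card Λ * M ≤ cnt Lg * M := by
      unfold cnt; linarith
    exact le_of_mul_le_mul_right h3 hM
  have hgoodω : ∀ ω, Lg ω → (c/4) * (c/16) ^ h ≤ ∑ i, w i * ind (GoodT ρ par dep Q (E ω) (ψ i)) := by
    intro ω hl
    obtain ⟨E', hE', hpr⟩ := prune D (E ω) (c/2) (by positivity) (fun x y h => h.1) hl
    have hpr' : Pruned D E' (c/4) (c/8) := by
      have e1 : c / 2 / 2 = c / 4 := by ring
      have e2 : c / 2 / 4 = c / 8 := by ring
      rwa [e1, e2] at hpr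
    have h1 := hmass E' hpr'
    have h2 : (c/16) ^ h ≤ (c/8/2) ^ (Q.card - 1) := by
      have e : c / 8 / 2 = c / 16 := by ring
      rw [e]
      exact pow_le_pow_of_le_one (by positivity) (by linarith) (by omega)
    refine (mul_le_mul_of_nonneg_left h2 (by positivity)).trans (h1.trans ?_)
    refine Finset.sum_le_sum fun i _ => mul_le_mul_of_nonneg_left (ind_mono ?_) (hw0 i)
    intro hg
    exact ⟨hg.inj, fun t ht he => (hg.even t ht he).imp fun y hy => hE' _ _ hy,
      fun t ht he => (hg.odd t ht he).imp fun y hy => hE' _ _ hy,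
      fun t ht hne he => hE' _ _ (hg.edgeE t ht hne he), fun t ht hne he => hE' _ _ (hg.edgeO t ht hne he)⟩
  set c'' := (c/4) * (c/16) ^ h with hc''
  have hc''0 : 0 < c'' := by positivity
  have htot : c'' * ((c/2) * Fintype.card Λ) ≤ ∑ i, w i * cnt (fun ω => GoodT ρ par dep Q (E ω) (ψ i)) := by
    have h1 : c'' * cnt Lg ≤ ∑ ω, ∑ i, w i * ind (GoodT ρ par dep Q (E ω) (ψ i)) := by
      unfold cnt
      rw [Finset.mul_sum]
      refine Finset.sum_le_sum fun ω _ => ?_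
      by_cases hl : Lg ω
      · rw [ind_of hl, mul_one]; exact hgoodω ω hl
      · rw [ind_of_not hl, mul_zero]
        exact Finset.sum_nonneg fun i _ => mul_nonneg (hw0 i) (ind_nonneg _)
    refine (mul_le_mul_of_nonneg_left hLgc hc''0.le).trans (h1.trans (le_of_eq ?_))
    rw [Finset.sum_comm]
    refine Finset.sum_congr rfl fun i _ => ?_
    unfold cnt; rw [Finset.mul_sum]
  by_contra hcon
  push Not at hcon
  rcases Nat.eq_zero_or_pos (Fintype.card Λ) with h0 | hpos
  · have := hcon (fun _ => Classical.arbitrary W)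
    rw [h0] at this
    have h2 := cnt_nonneg (fun ω : Λ => GoodT ρ par dep Q (fun x y => D.Adj x y ∧ S x y ω) (fun _ => Classical.arbitrary W))
    simp at this
    linarith
  · have hposR : (0:ℝ) < Fintype.card Λ := by exact_mod_cast hpos
    have hB : 0 < (c / 2) * c'' * Fintype.card Λ := by positivity
    -- strict inequality
    have hne : ∃ i, 0 < w i := by
      by_contra hn
      push Not at hn
      have : ∑ i, w i * cnt (fun ω => GoodT ρ par dep Q (E ω) (ψ i)) ≤ 0 := by
        refine Finset.sum_nonpos fun i _ => ?_
        exact mul_nonpos_of_nonpos_of_nonneg (hn i) (cnt_nonneg _)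
      nlinarith
    obtain ⟨i0, hi0⟩ := hne
    have h1 : ∑ i, w i * cnt (fun ω => GoodT ρ par dep Q (E ω) (ψ i)) <
        ∑ i, w i * ((c / 2) * c'' * Fintype.card Λ) := by
      refine Finset.sum_lt_sum (fun i _ => mul_le_mul_of_nonneg_left (hcon (ψ i)).le (hw0 i))
        ⟨i0, Finset.mem_univ _, mul_lt_mul_of_pos_left (hcon (ψ i0)) hi0⟩
    rw [← Finset.sum_mul] at h1
    have h2 : (∑ i, w i) * ((c / 2) * c'' * Fintype.card Λ) ≤ (c / 2) * c'' * Fintype.card Λ :=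
      mul_le_of_le_one_left hB.le hw1
    nlinarith

end P4


section P5
universe u v

lemma lemR_iter (ε : ℝ) (hε : 0 < ε) : ∃ (k : ℕ) (β : ℝ), 0 < β ∧
    ∀ {α : Type u} {V : Type v} [Fintype α] [DecidableEq α] [Fintype V] (Ω : (α → V) → Prop)
      (X : α → V → Prop), (∀ ω, Ω ω → ∀ a, X a (ω a)) →
      ∃ P : α → (Fin k → Bool) → V → Prop, (∀ a j v, P a j v → X a v) ∧
        ∀ (q : α → V → Prop) (κ : ℝ), 0 ≤ κ → κ ≤ 1 →
          (∀ a j, β * (Fintype.card V : ℝ) ≤ cnt (P a j) →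
            κ * cnt (P a j) ≤ cnt (fun v => P a j v ∧ q a v)) →
          ∀ s : Finset α, κ ^ s.card * cnt Ω - s.card * (ε * (Fintype.card V : ℝ) ^ Fintype.card α) ≤
              cnt (fun ω => Ω ω ∧ ∀ a ∈ s, q a (ω a)) := by
  obtain ⟨k, β, hβ, H⟩ := lemR.{u, v} ε hε
  refine ⟨k, β, hβ, ?_⟩
  intro α V _ _ _ Ω X hX
  choose P hP1 hP2 using fun a => H Ω a (X a) (fun ω hω => hX ω hω a)
  refine ⟨P, hP1, ?_⟩
  intro q κ hκ0 hκ1 hq s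
  induction s using Finset.induction_on with
  | empty => simp
  | insert i s hi ih =>
    have h1 := hP2 i (q i) κ hκ0 hκ1 (hq i) (fun ω => ∀ a ∈ s, q a (ω a)) (by
      intro ω v
      refine forall₂_congr fun a ha => ?_
      have : a ≠ i := fun h => hi (h ▸ ha)
      simp [Function.update_of_ne this])
    have h2 : cnt (fun ω => Ω ω ∧ ∀ a ∈ insert i s, q a (ω a)) =
        cnt (fun ω => Ω ω ∧ (∀ a ∈ s, q a (ω a)) ∧ q i (ω i)) :=
      cnt_congr fun ω => by rw [Finset.forall_mem_insert]; tauto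
    rw [h2, Finset.card_insert_of_notMem hi]
    refine le_trans ?_ h1
    set E := ε * (Fintype.card V : ℝ) ^ Fintype.card α with hE
    have hE0 : 0 ≤ E := by positivity
    have h3 := mul_le_mul_of_nonneg_left ih hκ0
    have h4 : κ * (s.card * E) ≤ s.card * E := by
      have : (0:ℝ) ≤ s.card * E := by positivity
      nlinarith
    push_cast
    rw [pow_succ]
    nlinarith

/-- constraint on coordinates: type `some true` lies in `A`, type `some false` in `B` -/
def InAB {α V : Type*} (ty : α → Option Bool) (A B : V → Prop) (ω : α → V) : Prop :=
  ∀ a, (ty a = some true → A (ω a)) ∧ (ty a = some false → B (ω a))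

lemma Solid.mono {V : Type*} [Fintype V] {G D : SimpleGraph V} {A B : V → Prop} {κ β β' : ℝ} {k : ℕ}
    (h : Solid G D A B κ β k) (hb : β ≤ β') : Solid G D A B κ β' k := by
  have hn : (0:ℝ) ≤ Fintype.card V := by positivity
  exact ⟨fun P hP hc => h.hA P hP (le_trans (mul_le_mul_of_nonneg_right hb hn) hc),
    fun P hP hc => h.hB P hP (le_trans (mul_le_mul_of_nonneg_right hb hn) hc)⟩

/-- properties of the tree embedding -/
structure Emb {α V : Type*} (G D : SimpleGraph V) (ty : α → Option Bool) (sd : α → Bool)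
    (ρ : α) (par : α → α) (dep : α → ℕ) (Q : Finset α) (U : Finset V) (ψ : α → V) (ω : α → V) : Prop where
  inj : ∀ s ∈ Q, ∀ t ∈ Q, ψ s = ψ t → s = t
  av : ∀ t ∈ Q, ψ t ∉ U
  edge : ∀ t ∈ Q, t ≠ ρ → D.Adj (ψ t) (ψ (par t))
  hA : ∀ t ∈ Q, ∀ a, ty a = some true → G.Adj (ψ t) (ω a)
  hB : ∀ t ∈ Q, ∀ a, ty a = some false → (sd a = true ↔ Even (dep t)) → G.Adj (ψ t) (ω a)

lemma colorable_no_edge {V : Type*} (D : SimpleGraph V) (k : ℕ) (h : ∀ x y, ¬ D.Adj x y) :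
    D.Colorable (k + 1) :=
  ⟨SimpleGraph.Coloring.mk (fun _ => 0) (fun {x y} hxy => (h x y hxy).elim)⟩

lemma one_stage (α : Type u) [Fintype α] [DecidableEq α] (κ c : ℝ) (hκ : 0 < κ) (hκ1 : κ ≤ 1)
    (hc : 0 < c) (hc1 : c ≤ 1) : ∃ (β c' : ℝ) (g : ℕ → ℕ), 0 < β ∧ 0 < c' ∧
    ∀ {V : Type v} [Fintype V] [DecidableEq V] (G D : SimpleGraph V) (A B : V → Prop) (k : ℕ),
      Solid G D A B κ β k → ¬ D.Colorable (g k) → ∀ (ty : α → Option Bool) (Ω : (α → V) → Prop),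
      (∀ ω, Ω ω → InAB ty A B ω) → c * (Fintype.card V : ℝ) ^ Fintype.card α ≤ cnt Ω →
      ∀ (sd : α → Bool) (ρ : α) (par : α → α) (dep : α → ℕ) (Q : Finset α) (U : Finset V),
        dep ρ = 0 → U.card ≤ Fintype.card α → ρ ∈ Q →
        (∀ t ∈ Q, t ≠ ρ → par t ∈ Q ∧ dep t = dep (par t) + 1) →
        ∃ ψ : α → V, c' * (Fintype.card V : ℝ) ^ Fintype.card α ≤
          cnt (fun ω => Ω ω ∧ Emb G D ty sd ρ par dep Q U ψ ω) := by
  classical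
  set h := Fintype.card α with hh
  set c1 := κ ^ h * c / 2 with hc1d
  have hc10 : 0 < c1 := by positivity
  have hκh : κ ^ h ≤ 1 := pow_le_one₀ hκ.le hκ1
  have hc11 : c1 ≤ 1 := by
    rw [hc1d]; nlinarith [pow_pos hκ h]
  obtain ⟨k0, β, hβ, HR⟩ := lemR_iter.{u, v} (c1 / (h + 1)) (by positivity)
  obtain ⟨K0, hK0⟩ := exists_nat_gt (16 * h / c1)
  rw [div_lt_iff₀ hc10] at hK0
  refine ⟨β, (c1 / 2) * ((c1 / 4) * (c1 / 16) ^ h),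
    fun k => (k + h + 2) ^ Fintype.card (Option (α × (Fin k0 → Bool))) * K0, hβ, by positivity, ?_⟩
  intro V _ _ G D A B k hsol hcol ty Ω hΩ hcnt sd ρ par dep Q U hρ hU hρQ hpar
  obtain ⟨P, hP1, hP2⟩ := HR Ω (fun a v => (ty a = some true → A v) ∧ (ty a = some false → B v)) hΩ
  set heavy : α → (Fin k0 → Bool) → Prop := fun a j => β * (Fintype.card V : ℝ) ≤ cnt (P a j) with hheavy
  set typ : V → V → Prop := fun x y => ∀ a j, heavy a j →
    (ty a = some true → ¬ lightE G κ (P a j) x y) ∧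
    (ty a = some false → ¬ lightV G κ (P a j) x ∧ ¬ lightV G κ (P a j) y) with htyp
  have lightE_symm : ∀ P x y, lightE G κ P x y → lightE G κ P y x := by
    intro P x y hl
    unfold lightE at hl ⊢
    rwa [cnt_congr (q := fun v => P v ∧ G.Adj x v ∧ G.Adj y v) (fun v => by tauto)]
  set T : SimpleGraph V := restr D (fun x y => typ x y ∧ x ∉ U) with hT
  have hTcol : ¬ T.Colorable K0 := by
    intro hTc
    apply hcol
    refine colorable_cover_fin D T (fun o : Option (α × (Fin k0 → Bool)) =>
      match o with
      | none => restr D (fun x y => x ∈ U ∨ y ∈ U)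
      | some (a, j) => restr D (fun x y => heavy a j ∧ ((ty a = some true ∧ lightE G κ (P a j) x y) ∨
          (ty a = some false ∧ (lightV G κ (P a j) x ∨ lightV G κ (P a j) y)))))
      _ K0 ?_ hTc ?_
    · rintro (_ | ⟨a, j⟩)
      · have : (restr D (fun x _ => x ∈ U)).Colorable (U.card + 1) := by
          have : (restr D (fun x _ => x ∈ U)).Coloring (Option U) :=
            SimpleGraph.Coloring.mk (fun v => if hv : v ∈ U then some ⟨v, hv⟩ else none) (by
              intro x y hxy he
              have hx : x ∈ U := hxy.2.1
              have hy : y ∈ U := hxy.2.2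
              simp only [hx, hy, dif_pos, Option.some.injEq, Subtype.mk.injEq] at he
              exact D.ne_of_adj hxy.1 he)
          have := this.colorable
          simpa using this
        exact (colorable_touch D (fun x => x ∈ U) _ this).mono (by omega)
      · by_cases hhv : heavy a j
        · cases hta : ty a with
          | none =>
            refine colorable_no_edge _ _ fun x y hxy => ?_
            simp [restr, hta] at hxy
          | some b =>
            cases b with
            | true =>
              have := hsol.hA (P a j) (fun v hv => (hP1 a j v hv).1 hta) hhv
              refine (this.mono_left ?_).mono (by omega)
              intro x y hxy
              simp [restr, hta, hhv] at hxy
              exact hxy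
            | false =>
              have := colorable_touch D _ k (hsol.hB (P a j) (fun v hv => (hP1 a j v hv).2 hta) hhv)
              refine (this.mono_left ?_).mono (by omega)
              intro x y hxy
              simp [restr, hta, hhv] at hxy
              exact hxy
        · refine colorable_no_edge _ _ fun x y hxy => ?_
          simp [restr, hhv] at hxy
    · intro x y hxy
      by_cases h1 : T.Adj x y
      · exact Or.inl h1
      · right
        by_cases h2 : x ∈ U ∨ y ∈ U
        · exact ⟨none, hxy, h2, h2.symm⟩
        · push Not at h2
          have h3 : ¬ typ x y := by
            intro h3
            refine h1 ⟨hxy, ⟨h3, h2.1⟩, ⟨?_, h2.2⟩⟩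
            intro a j ha
            exact ⟨fun h hl => (h3 a j ha).1 h (lightE_symm _ _ _ hl), fun h => ((h3 a j ha).2 h).symm⟩
          simp only [htyp] at h3
          push Not at h3
          obtain ⟨a, j, haj, h3⟩ := h3
          refine ⟨some (a, j), hxy, ⟨haj, ?_⟩, ⟨haj, ?_⟩⟩
          · by_cases h4 : ty a = some true ∧ lightE G κ (P a j) x y
            · exact Or.inl h4
            · right
              have := h3 (fun ht hl => h4 ⟨ht, hl⟩)
              refine ⟨this.1, ?_⟩
              by_cases h5 : lightV G κ (P a j) x
              · exact Or.inl h5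
              · exact Or.inr (this.2 h5)
          · by_cases h4 : ty a = some true ∧ lightE G κ (P a j) x y
            · exact Or.inl ⟨h4.1, lightE_symm _ _ _ h4.2⟩
            · right
              have := h3 (fun ht hl => h4 ⟨ht, hl⟩)
              refine ⟨this.1, ?_⟩
              by_cases h5 : lightV G κ (P a j) x
              · exact Or.inr h5
              · exact Or.inl (this.2 h5)
  obtain ⟨W, hWne, hW⟩ := core_exists T K0 hTcol
  set DW : SimpleGraph W := T.comap (Subtype.val) with hDW
  haveI : Nonempty W := hWne.to_subtype
  set S : W → W → (α → V) → Prop := fun x y ω => Ω ω ∧ ∀ a,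
    (ty a = some true → G.Adj x.1 (ω a) ∧ G.Adj y.1 (ω a)) ∧
    (ty a = some false → G.Adj (if sd a = true then x.1 else y.1) (ω a)) with hS
  have hrd : ∀ x : W, (K0 : ℝ) ≤ rdeg DW x := by
    intro x
    have := hW x.1 x.2
    refine le_trans (Nat.cast_le.mpr this) ?_
    rw [← Finset.card_attach (s := W.filter (T.Adj x.1))]
    unfold rdeg
    rw [cnt_eq_card]
    norm_cast
    refine Finset.card_le_card_of_injOn (fun y => ⟨y.1, (Finset.mem_filter.mp y.2).1⟩) ?_ ?_
    · intro y _
      simp only [Finset.coe_filter, Set.mem_setOf_eq, Finset.mem_univ, true_and]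
      exact (Finset.mem_filter.mp y.2).2
    · intro y _ z _ hyz
      apply Subtype.ext
      exact congrArg (fun w : W => w.1) hyz
  have hcardΛ : ((Fintype.card (α → V) : ℕ) : ℝ) = (Fintype.card V : ℝ) ^ h := by
    rw [Fintype.card_fun]; push_cast; rfl
  have hSc : ∀ x y : W, DW.Adj x y → c1 * Fintype.card (α → V) ≤ cnt (S x y) := by
    intro x y hxy
    have hty : typ x.1 y.1 := hxy.2.1.1
    have := hP2 (fun a v => (ty a = some true → G.Adj x.1 v ∧ G.Adj y.1 v) ∧
      (ty a = some false → G.Adj (if sd a = true then x.1 else y.1) v)) κ hκ.le hκ1 (by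
        intro a j haj
        have h1 := hty a j haj
        cases hta : ty a with
        | none =>
          simp only [reduceCtorEq, false_imp_iff, and_true]
          nlinarith [cnt_nonneg (P a j)]
        | some b =>
          cases b with
          | true =>
            have h2 := h1.1 hta
            unfold lightE at h2
            push Not at h2
            simpa using h2
          | false =>
            have h2 := h1.2 hta
            unfold lightV at h2
            push Not at h2
            simp only [Option.some.injEq, Bool.false_eq_true, false_imp_iff, true_and, true_imp_iff]
            split_ifs
            · exact h2.1
            · exact h2.2) Finset.univ
    rw [hcardΛ]
    have e : cnt (S x y) = cnt (fun ω => Ω ω ∧ ∀ a ∈ (Finset.univ : Finset α),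
      (ty a = some true → G.Adj x.1 (ω a) ∧ G.Adj y.1 (ω a)) ∧
      (ty a = some false → G.Adj (if sd a = true then x.1 else y.1) (ω a))) :=
      cnt_congr fun ω => by simp [hS]
    rw [e]
    refine le_trans ?_ this
    rw [Finset.card_univ, ← hh]
    set N := (Fintype.card V : ℝ) ^ h with hN
    have hN0 : 0 ≤ N := by positivity
    have h5 : κ ^ h * (c * N) ≤ κ ^ h * cnt Ω := mul_le_mul_of_nonneg_left hcnt (by positivity)
    have h6 : (h:ℝ) * (c1 / (h + 1) * N) ≤ c1 * N := by
      rw [← mul_assoc]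
      refine mul_le_mul_of_nonneg_right ?_ hN0
      rw [mul_div_assoc', div_le_iff₀ (by positivity)]
      nlinarith
    have h7 : κ ^ h * (c * N) = 2 * (c1 * N) := by rw [hc1d]; ring
    linarith
  obtain ⟨ψ, hψ⟩ := treeT (Λ := α → V) ρ par dep hρ DW c1 hc10 hc11 h (by
    intro x
    have := hrd x
    nlinarith) S hSc Q (by rw [hh]; exact Finset.card_le_univ _) hρQ hpar
  refine ⟨fun t => (ψ t).1, ?_⟩
  rw [← hcardΛ]
  refine le_trans hψ (cnt_mono ?_)
  intro ω hg
  have hex : ∀ t ∈ Q, ∃ y, (DW.Adj (ψ t) y) ∧ (S (ψ t) y ω ∧ Even (dep t) ∨ S y (ψ t) ω ∧ ¬ Even (dep t)) := by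
    intro t ht
    by_cases he : Even (dep t)
    · obtain ⟨y, hy⟩ := hg.even t ht he
      exact ⟨y, hy.1, Or.inl ⟨hy.2, he⟩⟩
    · obtain ⟨y, hy⟩ := hg.odd t ht he
      exact ⟨y, hy.1.symm, Or.inr ⟨hy.2, he⟩⟩
  refine ⟨?_, ?_, ?_, ?_, ?_, ?_⟩
  · obtain ⟨y, _, hy | hy⟩ := hex ρ hρQ
    · exact hy.1.1
    · exact hy.1.1
  · intro s hs t ht hst
    exact hg.inj s hs t ht (Subtype.ext hst)
  · intro t ht
    obtain ⟨y, hy, _⟩ := hex t ht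
    exact hy.2.1.2
  · intro t ht htρ
    by_cases he : Even (dep t)
    · exact (hg.edgeE t ht htρ he).1.1
    · exact (hg.edgeO t ht htρ he).1.1.symm
  · intro t ht a ha
    obtain ⟨y, _, hy | hy⟩ := hex t ht
    · exact ((hy.1.2 a).1 ha).1
    · exact ((hy.1.2 a).1 ha).2
  · intro t ht a ha hsd
    obtain ⟨y, _, hy | hy⟩ := hex t ht
    · have := (hy.1.2 a).2 ha
      rwa [if_pos (hsd.mpr hy.2)] at this
    · have := (hy.1.2 a).2 ha
      rwa [if_neg (fun hh => hy.2 (hsd.mp hh))] at this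

end P5


section P5b
universe u v

/-- rooted forest structure on the vertices satisfying `F` -/
structure ForestOn {α : Type*} (H : SimpleGraph α) (F : α → Prop) (par comp : α → α) (dep : α → ℕ) : Prop where
  root : ∀ t, F t → F (comp t) ∧ dep (comp t) = 0 ∧ comp (comp t) = comp t
  zero : ∀ t, F t → dep t = 0 → comp t = t
  step : ∀ t, F t → dep t ≠ 0 → F (par t) ∧ dep t = dep (par t) + 1 ∧ comp (par t) = comp t
  edge : ∀ t t', F t → F t' → H.Adj t t' → (dep t ≠ 0 ∧ par t = t') ∨ (dep t' ≠ 0 ∧ par t' = t)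

/-- properties of the forest embedding -/
structure EmbF {α V : Type*} (G D : SimpleGraph V) (F : α → Prop) (ty : α → Option Bool) (sd : α → α → Bool)
    (par comp : α → α) (dep : α → ℕ) (R : Finset α) (ψ : α → V) (ω : α → V) : Prop where
  inj : ∀ s t, F s → F t → comp s ∈ R → comp t ∈ R → ψ s = ψ t → s = t
  edge : ∀ t, F t → comp t ∈ R → dep t ≠ 0 → D.Adj (ψ t) (ψ (par t))
  hA : ∀ t, F t → comp t ∈ R → ∀ a, ty a = some true → G.Adj (ψ t) (ω a)
  hB : ∀ t, F t → comp t ∈ R → ∀ a, ty a = some false →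
    (sd (comp t) a = true ↔ Even (dep t)) → G.Adj (ψ t) (ω a)

lemma all_stages (α : Type u) [Fintype α] [DecidableEq α] (H : SimpleGraph α) (F : α → Prop)
    (par comp : α → α) (dep : α → ℕ) (hF : ForestOn H F par comp dep)
    (ty : α → Option Bool) (sd : α → α → Bool) (κ : ℝ) (hκ : 0 < κ) (hκ1 : κ ≤ 1)
    (c : ℝ) (hc : 0 < c) (hc1 : c ≤ 1) (R : Finset α) : ∃ (β c' : ℝ) (g : ℕ → ℕ), 0 < β ∧ 0 < c' ∧ c' ≤ 1 ∧
    ∀ {V : Type v} [Fintype V] [DecidableEq V] [Nonempty V] (G D : SimpleGraph V) (A B : V → Prop) (k : ℕ),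
      Solid G D A B κ β k → ¬ D.Colorable (g k) → ∀ (Ω : (α → V) → Prop),
      (∀ ω, Ω ω → InAB ty A B ω) → c * (Fintype.card V : ℝ) ^ Fintype.card α ≤ cnt Ω →
        ∃ ψ : α → V, c' * (Fintype.card V : ℝ) ^ Fintype.card α ≤
          cnt (fun ω => Ω ω ∧ EmbF G D F ty sd par comp dep R ψ ω) := by
  classical
  induction R using Finset.induction_on with
  | empty =>
    refine ⟨1, c, fun _ => 0, one_pos, hc, hc1, ?_⟩
    intro V _ _ _ G D A B k _ _ Ω _ hcnt
    refine ⟨fun _ => Classical.arbitrary V, le_trans hcnt (cnt_mono fun ω hω => ⟨hω, ?_⟩)⟩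
    constructor <;> simp
  | insert ρ R hρR ih =>
    obtain ⟨β1, c1, g1, hβ1, hc10, hc11, H1⟩ := ih
    by_cases hρ : F ρ ∧ dep ρ = 0
    · obtain ⟨β2, c2, g2, hβ2, hc20, H2⟩ := one_stage.{u, v} α κ c1 hκ hκ1 hc10 hc11
      refine ⟨min β1 β2, min c2 1, fun k => max (g1 k) (g2 k), lt_min hβ1 hβ2, lt_min hc20 one_pos,
        min_le_right _ _, ?_⟩
      intro V _ _ _ G D A B k hsol hcol Ω hΩ hcnt
      obtain ⟨ψ1, hψ1⟩ := H1 G D A B k (hsol.mono (min_le_left _ _))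
        (fun h => hcol (h.mono (le_max_left _ _))) Ω hΩ hcnt
      have hcρ := hF.zero ρ hρ.1 hρ.2
      obtain ⟨ψ2, hψ2⟩ := H2 G D A B k (hsol.mono (min_le_right _ _))
        (fun h => hcol (h.mono (le_max_right _ _))) ty _ (fun ω hω => hΩ ω hω.1) hψ1
        (sd ρ) ρ par dep (Finset.univ.filter fun t => F t ∧ comp t = ρ) (Finset.univ.image ψ1) hρ.2
        Finset.card_image_le (by simp [hρ.1, hcρ]) (by
          intro t ht htρ
          simp only [Finset.mem_filter, Finset.mem_univ, true_and] at ht ⊢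
          have hd : dep t ≠ 0 := fun h0 => htρ (by rw [← ht.2, hF.zero t ht.1 h0])
          obtain ⟨s1, s2, s3⟩ := hF.step t ht.1 hd
          exact ⟨⟨s1, by rw [s3, ht.2]⟩, s2⟩)
      refine ⟨fun t => if comp t = ρ then ψ2 t else ψ1 t, ?_⟩
      refine le_trans (mul_le_mul_of_nonneg_right (min_le_left _ _) (by positivity))
        (le_trans hψ2 (cnt_mono ?_))
      rintro ω ⟨⟨hω, h1⟩, h2⟩
      refine ⟨hω, ?_, ?_, ?_, ?_⟩
      · intro s t hs ht hsR htR hst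
        rw [Finset.mem_insert] at hsR htR
        by_cases hs' : comp s = ρ <;> by_cases ht' : comp t = ρ
        · simp only [hs', ht', if_true] at hst
          exact h2.inj s (by simp [hs, hs']) t (by simp [ht, ht']) hst
        · simp only [hs', ht', if_true, if_false] at hst
          exact (h2.av s (by simp [hs, hs']) (by rw [hst]; simp)).elim
        · simp only [hs', ht', if_true, if_false] at hst
          exact (h2.av t (by simp [ht, ht']) (by rw [← hst]; simp)).elim
        · simp only [hs', ht', if_false] at hst
          exact h1.inj s t hs ht (hsR.resolve_left hs') (htR.resolve_left ht') hst
      · intro t ht htR hd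
        rw [Finset.mem_insert] at htR
        have hp := (hF.step t ht hd).2.2
        by_cases ht' : comp t = ρ
        · simp only [hp, ht', if_true]
          exact h2.edge t (by simp [ht, ht']) (fun h => hd (h ▸ hρ.2))
        · simp only [hp, ht', if_false]
          exact h1.edge t ht (htR.resolve_left ht') hd
      · intro t ht htR a ha
        rw [Finset.mem_insert] at htR
        by_cases ht' : comp t = ρ
        · simp only [ht', if_true]
          exact h2.hA t (by simp [ht, ht']) a ha
        · simp only [ht', if_false]
          exact h1.hA t ht (htR.resolve_left ht') a ha
      · intro t ht htR a ha hsd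
        rw [Finset.mem_insert] at htR
        by_cases ht' : comp t = ρ
        · simp only [ht', if_true]
          rw [ht'] at hsd
          exact h2.hB t (by simp [ht, ht']) a ha hsd
        · simp only [ht', if_false]
          exact h1.hB t ht (htR.resolve_left ht') a ha hsd
    · refine ⟨β1, c1, g1, hβ1, hc10, hc11, ?_⟩
      intro V _ _ _ G D A B k hsol hcol Ω hΩ hcnt
      obtain ⟨ψ, hψ⟩ := H1 G D A B k hsol hcol Ω hΩ hcnt
      refine ⟨ψ, le_trans hψ (cnt_mono fun ω hω => ⟨hω.1, ?_⟩)⟩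
      have hR : ∀ t, F t → comp t ∈ insert ρ R → comp t ∈ R := by
        intro t ht htR
        rcases Finset.mem_insert.mp htR with h | h
        · have := hF.root t ht
          rw [h] at this
          exact (hρ ⟨this.1, this.2.1⟩).elim
        · exact h
      obtain ⟨-, h1⟩ := hω
      exact ⟨fun s t hs ht h h' => h1.inj s t hs ht (hR s hs h) (hR t ht h'),
        fun t ht h => h1.edge t ht (hR t ht h), fun t ht h => h1.hA t ht (hR t ht h),
        fun t ht h => h1.hB t ht (hR t ht h)⟩

/-- cliques spread over the neighbourhoods of an edge -/
def CliqTy {V : Type*} (G : SimpleGraph V) (q : ℕ) (τ : Fin q → Bool) (x y : V) (κ : Fin q → V) : Prop :=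
  (∀ i j, i ≠ j → G.Adj (κ i) (κ j)) ∧
    ∀ i, (τ i = true → G.Adj x (κ i) ∧ G.Adj y (κ i)) ∧ (G.Adj x (κ i) ∨ G.Adj y (κ i))

lemma cnt_coord {V : Type*} [Fintype V] (q : ℕ) (i : Fin q) (p : V → Prop) :
    cnt (fun κ : Fin q → V => p (κ i)) * (Fintype.card V : ℝ) = cnt p * (Fintype.card V : ℝ) ^ q := by
  have h1 := cnt_comp_inj (V := V) (fun _ : Unit => i) (fun _ _ _ => rfl) (fun f => p (f ()))
  have h2 := cnt_equiv (Equiv.funUnique Unit V) p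
  have h3 : cnt (fun f : Unit → V => p (f ())) = cnt p := h2
  simp only [Fintype.card_fin, Function.comp, Fintype.card_unit, pow_one] at h1
  rw [h1, h3]

theorem embed {α : Type u} [Fintype α] [DecidableEq α] (H : SimpleGraph α) (q : ℕ) [NeZero q]
    (col : α → Option (Fin q)) (τ : Fin q → Bool)
    (hprop : ∀ a a' i j, H.Adj a a' → col a = some i → col a' = some j → i ≠ j)
    (par comp : α → α) (dep : α → ℕ) (hF : ForestOn H (fun t => col t = none) par comp dep)
    (hpar : ∀ b t t' i, H.Adj b t → H.Adj b t' → col b = some i → τ i = false → col t = none →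
      col t' = none → comp t = comp t' → (Even (dep t) ↔ Even (dep t')))
    (η : ℝ) (hη : 0 < η) (hη1 : η ≤ 1) :
    ∃ (K n0 : ℕ), ∀ {V : Type v} [Fintype V] (G D : SimpleGraph V), n0 ≤ Fintype.card V → D ≤ G →
      (∀ x y, D.Adj x y → η * (Fintype.card V : ℝ) ^ q ≤ cnt (CliqTy G q τ x y)) → ¬ D.Colorable K →
      ∃ f : α → V, Function.Injective f ∧ ∀ a b, H.Adj a b → G.Adj (f a) (f b) := by
  classical
  have hq : (0:ℝ) < q := by exact_mod_cast Nat.pos_of_ne_zero (NeZero.ne q)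
  have hq1 : (1:ℝ) ≤ q := by exact_mod_cast Nat.pos_of_ne_zero (NeZero.ne q)
  set κ := η / (4 * q) with hκd
  have hκ : 0 < κ := by positivity
  have hκ1 : κ ≤ 1 := by rw [hκd, div_le_one (by positivity)]; linarith
  set h := Fintype.card α with hh
  set c0 := (η / 2) ^ (h ^ q) with hc0
  have hc00 : 0 < c0 := by positivity
  have hc01 : c0 ≤ 1 := pow_le_one₀ (by positivity) (by linarith)
  set ty : α → Option Bool := fun a => (col a).map τ with hty
  set sd : α → α → Bool := fun ρ a => decide (∃ t, col t = none ∧ comp t = ρ ∧ H.Adj a t ∧ Even (dep t)) with hsd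
  obtain ⟨β, c', g, hβ, hc', -, HS⟩ := all_stages.{u, v} α H _ par comp dep hF ty sd κ hκ hκ1 c0 hc00 hc01
    Finset.univ
  obtain ⟨K, hK⟩ := solid_extract.{v} κ β hκ.le hβ (fun k => max (g k) 1)
  obtain ⟨n0, hn0⟩ := exists_nat_gt (((h:ℝ) ^ 2 + h * h) / c')
  rw [div_lt_iff₀ hc'] at hn0
  refine ⟨K, n0, ?_⟩
  intro V _ G D hn hDG hD hcol
  obtain ⟨A, B, D', k, hD'D, hcol', hsol, hoA, hoB⟩ := hK G D hcol
  have hcolg : ¬ D'.Colorable (g k) := fun h => hcol' (h.mono (le_max_left _ _))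
  have hex : ∃ x y, D'.Adj x y := by
    by_contra hne
    push Not at hne
    exact hcol' ((colorable_no_edge D' 0 hne).mono (le_max_right _ _))
  obtain ⟨x, y, hxy⟩ := hex
  haveI : Nonempty V := ⟨x⟩
  have hVpos : (0:ℝ) < Fintype.card V := by exact_mod_cast Fintype.card_pos
  set n : ℝ := (Fintype.card V : ℝ) with hnd
  -- cliques inside A, B
  set X : Fin q → V → Prop := fun i v => if τ i = true then A v else B v with hX
  have hdens : (η / 2) * n ^ q ≤ cnt (fun κ : Fin q → V =>
      (∀ i j, i ≠ j → G.Adj (κ i) (κ j)) ∧ ∀ i, X i (κ i)) := by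
    have h1 := hD x y (hD'D hxy)
    set bad : Fin q → V → Prop := fun i v => if τ i = true then (¬ A v ∧ G.Adj x v ∧ G.Adj y v) else
      ((¬ B v ∧ G.Adj x v) ∨ (¬ B v ∧ G.Adj y v)) with hbad
    have hbc : ∀ i, cnt (bad i) ≤ 2 * κ * n := by
      intro i
      by_cases hi : τ i = true
      · have := hoA x y hxy
        simp only [hbad, hi, if_true]
        nlinarith [mul_pos hκ hVpos]
      · simp only [hbad, hi]
        have h2 := hoB x y hxy
        have h3 := hoB y x hxy.symm
        have := cnt_or_le (fun v => ¬ B v ∧ G.Adj x v) (fun v => ¬ B v ∧ G.Adj y v)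
        simp only [Bool.false_eq_true, if_false]
        linarith
    have h2 : cnt (CliqTy G q τ x y) ≤ cnt (fun κ : Fin q → V =>
      ((∀ i j, i ≠ j → G.Adj (κ i) (κ j)) ∧ ∀ i, X i (κ i)) ∨ ∃ i, bad i (κ i)) := by
      refine cnt_mono fun κ hκ => ?_
      by_cases hb : ∃ i, bad i (κ i)
      · exact Or.inr hb
      · left
        refine ⟨hκ.1, fun i => ?_⟩
        push Not at hb
        have hbi := hb i
        have hκi := hκ.2 i
        simp only [hbad] at hbi
        simp only [hX]
        split_ifs at hbi ⊢ with hi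
        · have := hκi.1 hi
          by_contra hA
          exact hbi ⟨hA, this⟩
        · by_contra hB
          rcases hκi.2 with h | h
          · exact hbi (Or.inl ⟨hB, h⟩)
          · exact hbi (Or.inr ⟨hB, h⟩)
    have h3 := cnt_or_le (fun κ : Fin q → V => (∀ i j, i ≠ j → G.Adj (κ i) (κ j)) ∧ ∀ i, X i (κ i))
      (fun κ => ∃ i, bad i (κ i))
    have h4 := cnt_exists_le (fun (i : Fin q) (κ : Fin q → V) => bad i (κ i))
    have h5 : ∑ i, cnt (fun κ : Fin q → V => bad i (κ i)) ≤ ∑ _i : Fin q, 2 * κ * n ^ q := by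
      refine Finset.sum_le_sum fun i _ => ?_
      have := cnt_coord (V := V) q i (bad i)
      rw [← hnd] at this
      have h6 : cnt (fun κ : Fin q → V => bad i (κ i)) * n ≤ (2 * κ * n ^ q) * n := by
        rw [this]
        have := mul_le_mul_of_nonneg_right (hbc i) (show 0 ≤ n ^ q by positivity)
        linarith
      exact le_of_mul_le_mul_right h6 hVpos
    rw [Finset.sum_const, Finset.card_univ, Fintype.card_fin, nsmul_eq_mul] at h5
    have h7 : (q:ℝ) * (2 * κ * n ^ q) = (η / 2) * n ^ q := by
      rw [hκd]; field_simp; ring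
    linarith
  have hΩ0 := blowup_col G q col X (η / 2) (by positivity) hdens
  obtain ⟨ψ, hψ⟩ := HS G D' A B k hsol hcolg _ (by
    intro ω hω a
    constructor
    · intro ha
      simp only [hty, Option.map_eq_some_iff] at ha
      obtain ⟨i, hi, hti⟩ := ha
      have := hω.2 a i hi
      simpa [hX, hti] using this
    · intro ha
      simp only [hty, Option.map_eq_some_iff] at ha
      obtain ⟨i, hi, hti⟩ := ha
      have := hω.2 a i hi
      simpa [hX, hti] using this) hΩ0
  obtain ⟨ω, ⟨⟨hω1, -⟩, hω3⟩, hinj, hav⟩ := inj_avoid _ c' (Finset.univ.image ψ) hψ (by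
    have h1 : ((Finset.univ.image ψ).card : ℝ) ≤ h := by
      rw [hh]; exact_mod_cast Finset.card_image_le
    have h2 : (n0 : ℝ) ≤ n := by rw [hnd]; exact_mod_cast hn
    have : (0:ℝ) ≤ h := by positivity
    calc (h:ℝ) ^ 2 + h * ((Finset.univ.image ψ).card : ℝ) ≤ (h:ℝ) ^ 2 + h * h := by gcongr
      _ < n0 * c' := hn0
      _ ≤ c' * n := by nlinarith)
  have hcross : ∀ t b i, col t = none → col b = some i → H.Adj b t → G.Adj (ψ t) (ω b) := by
    intro t b i ht hb hadj
    cases hti : τ i with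
    | true => exact hω3.hA t ht (Finset.mem_univ _) b (by simp [hty, hb, hti])
    | false =>
      refine hω3.hB t ht (Finset.mem_univ _) b (by simp [hty, hb, hti]) ?_
      simp only [hsd, decide_eq_true_eq]
      constructor
      · rintro ⟨t', ht', hc, hadj', he⟩
        exact (hpar b t t' i hadj hadj' hb hti ht ht' hc.symm).mpr he
      · intro he
        exact ⟨t, ht, rfl, hadj, he⟩
  refine ⟨fun a => if col a = none then ψ a else ω a, ?_, ?_⟩
  · intro a b hab
    simp only at hab
    split_ifs at hab with h1 h2 h2
    · exact hω3.inj a b h1 h2 (Finset.mem_univ _) (Finset.mem_univ _) hab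
    · exact (hav b (by rw [← hab]; simp)).elim
    · exact (hav a (by rw [hab]; simp)).elim
    · exact hinj hab
  · intro a b hab
    simp only
    cases ha : col a with
    | none =>
      cases hb : col b with
      | none =>
        simp only [if_true]
        rcases hF.edge a b ha hb hab with ⟨hd, hp⟩ | ⟨hd, hp⟩
        · have := hω3.edge a ha (Finset.mem_univ _) hd
          rw [hp] at this
          exact hDG (hD'D this)
        · have := hω3.edge b hb (Finset.mem_univ _) hd
          rw [hp] at this
          exact (hDG (hD'D this)).symm
      | some j => simpa using hcross a b j ha hb hab.symm
    | some i =>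
      cases hb : col b with
      | none => simpa using (hcross b a i hb ha hab).symm
      | some j => simpa using hω1 a b i j ha hb (hprop a b i j hab ha hb)

end P5b


section P6
universe u

noncomputable def LagF {ι : Type*} [Fintype ι] (R : ι → ι → Prop) (u : ι → ℝ) (p : ι → ℝ) : ℝ :=
  (1/2) * ∑ a, ∑ b, p a * p b * ind (R a b) + ∑ a, p a * u a

lemma lag_shift {ι : Type*} [Fintype ι] [DecidableEq ι] (R : ι → ι → Prop) (hs : ∀ a b, R a b → R b a)
    (hi : ∀ a, ¬ R a a) (u p : ι → ℝ) (i j : ι) (hij : ¬ R i j) (t : ℝ) :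
    LagF R u (fun a => p a + t * ((if a = i then 1 else 0) - (if a = j then 1 else 0))) =
      LagF R u p + t * ((∑ b, p b * ind (R i b) + u i) - (∑ b, p b * ind (R j b) + u j)) := by
  have hsy : ∀ a b, ind (R a b) = ind (R b a) := fun a b => by
    by_cases h : R a b
    · rw [ind_of h, ind_of (hs _ _ h)]
    · rw [ind_of_not h, ind_of_not (fun h' => h (hs _ _ h'))]
  have z1 : ind (R i j) = 0 := ind_of_not hij
  have z2 : ind (R j i) = 0 := by rw [hsy, z1]
  have z3 : ind (R i i) = 0 := ind_of_not (hi i)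
  have z4 : ind (R j j) = 0 := ind_of_not (hi j)
  set v : ι → ℝ := fun a => (if a = i then 1 else 0) - (if a = j then 1 else 0) with hv
  have lin : ∀ F : ι → ℝ, ∑ a, v a * F a = F i - F j := by
    intro F
    simp [hv, sub_mul, Finset.sum_sub_distrib]
  unfold LagF
  have e1 : ∑ a, ∑ b, (p a + t * v a) * (p b + t * v b) * ind (R a b) =
      ∑ a, ∑ b, p a * p b * ind (R a b) + t * (∑ a, v a * ∑ b, p b * ind (R a b)) +
      t * (∑ b, v b * ∑ a, p a * ind (R a b)) + t * t * ∑ a, v a * ∑ b, v b * ind (R a b) := by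
    have e2 : ∑ b, v b * ∑ a, p a * ind (R a b) = ∑ a, ∑ b, v b * (p a * ind (R a b)) := by
      rw [Finset.sum_comm]; simp [Finset.mul_sum]
    rw [e2]
    simp only [Finset.mul_sum, ← Finset.sum_add_distrib]
    refine Finset.sum_congr rfl fun a _ => Finset.sum_congr rfl fun b _ => ?_
    ring
  have e3 : ∑ a, (p a + t * v a) * u a = ∑ a, p a * u a + t * ∑ a, v a * u a := by
    rw [Finset.mul_sum, ← Finset.sum_add_distrib]
    exact Finset.sum_congr rfl fun a _ => by ring
  rw [e1, e3]
  simp only [lin]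
  rw [z1, z2, z3, z4]
  have e4 : ∀ k, ∑ a, p a * ind (R a k) = ∑ b, p b * ind (R k b) := fun k =>
    Finset.sum_congr rfl fun b _ => by rw [hsy]
  rw [e4, e4]
  ring

lemma motzkin {ι : Type*} [Fintype ι] [DecidableEq ι] (R : ι → ι → Prop) (hs : ∀ a b, R a b → R b a)
    (hi : ∀ a, ¬ R a a) (u : ι → ℝ) (N : ℕ) : ∀ p : ι → ℝ, (∀ a, 0 ≤ p a) → ∑ a, p a = 1 →
      (Finset.univ.filter fun a => p a ≠ 0).card ≤ N →
      ∃ p' : ι → ℝ, (∀ a, 0 ≤ p' a) ∧ ∑ a, p' a = 1 ∧ LagF R u p ≤ LagF R u p' ∧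
        ∀ a b, p' a ≠ 0 → p' b ≠ 0 → a ≠ b → R a b := by
  induction N with
  | zero =>
    intro p h0 h1 hN
    exfalso
    have : (Finset.univ.filter fun a => p a ≠ 0) = ∅ := Finset.card_eq_zero.mp (by omega)
    have : ∑ a, p a = 0 := Finset.sum_eq_zero fun a _ => by
      by_contra h
      have : a ∈ (Finset.univ.filter fun a => p a ≠ 0) := by simp [h]
      simp_all
    linarith
  | succ N ih =>
    intro p h0 h1 hN
    by_cases hcl : ∀ a b, p a ≠ 0 → p b ≠ 0 → a ≠ b → R a b
    · exact ⟨p, h0, h1, le_rfl, hcl⟩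
    push Not at hcl
    have key : ∀ i j, p i ≠ 0 → p j ≠ 0 → i ≠ j → ¬ R i j →
        0 ≤ (∑ b, p b * ind (R i b) + u i) - (∑ b, p b * ind (R j b) + u j) →
        ∃ p' : ι → ℝ, (∀ a, 0 ≤ p' a) ∧ ∑ a, p' a = 1 ∧ LagF R u p ≤ LagF R u p' ∧
          ∀ a b, p' a ≠ 0 → p' b ≠ 0 → a ≠ b → R a b := by
      intro i j hpi hpj hij hR hd
      set p1 : ι → ℝ := fun a => p a + p j * ((if a = i then 1 else 0) - (if a = j then 1 else 0)) with hp1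
      have hj : p1 j = 0 := by simp [hp1, hij.symm]
      have hii : p1 i = p i + p j := by simp [hp1, hij]
      have ho : ∀ a, a ≠ i → a ≠ j → p1 a = p a := by intro a h1 h2; simp [hp1, h1, h2]
      have hL := lag_shift R hs hi u p i j hR (p j)
      have hn : ∀ a, 0 ≤ p1 a := by
        intro a
        by_cases ha : a = i
        · rw [ha, hii]; linarith [h0 i, h0 j]
        · by_cases hb : a = j
          · rw [hb, hj]
          · rw [ho a ha hb]; exact h0 a
      have hsum : ∑ a, p1 a = 1 := by
        simp only [hp1]
        rw [Finset.sum_add_distrib, ← Finset.mul_sum, Finset.sum_sub_distrib, h1]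
        simp
      have hcard : (Finset.univ.filter fun a => p1 a ≠ 0).card ≤ N := by
        have : (Finset.univ.filter fun a => p1 a ≠ 0) ⊂ (Finset.univ.filter fun a => p a ≠ 0) := by
          rw [Finset.ssubset_iff_of_subset]
          · exact ⟨j, by simp [hpj], by simp [hj]⟩
          · intro a ha
            simp only [Finset.mem_filter, Finset.mem_univ, true_and] at ha ⊢
            by_cases hai : a = i
            · rw [hai]; exact hpi
            · by_cases hb : a = j
              · rw [hb]; exact hpj
              · rwa [ho a hai hb] at ha
        have := Finset.card_lt_card this
        omega
      obtain ⟨p', a1, a2, a3, a4⟩ := ih p1 hn hsum hcard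
      refine ⟨p', a1, a2, le_trans ?_ a3, a4⟩
      rw [hp1, hL]
      have := mul_nonneg (h0 j) hd
      linarith
    obtain ⟨i, j, hpi, hpj, hij, hR⟩ := hcl
    rcases le_total 0 ((∑ b, p b * ind (R i b) + u i) - (∑ b, p b * ind (R j b) + u j)) with h | h
    · exact key i j hpi hpj hij hR h
    · exact key j i hpj hpi hij.symm (fun h' => hR (hs _ _ h')) (by linarith)

lemma clique_lag {ι : Type*} [Fintype ι] [DecidableEq ι] (R : ι → ι → Prop)
    (hi : ∀ a, ¬ R a a) (w : ι → ℝ) (hw0 : ∀ a, 0 ≤ w a) (hw1 : ∀ a, w a ≤ 1) (μ s : ℝ) (hμ : 0 ≤ μ)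
    (hs : 0 ≤ s) (hμs : μ * s ≤ 1) (p : ι → ℝ) (h0 : ∀ a, 0 ≤ p a) (h1 : ∑ a, p a = 1)
    (hcl : ∀ a b, p a ≠ 0 → p b ≠ 0 → a ≠ b → R a b)
    (hc : ((Finset.univ.filter fun a => p a ≠ 0).card : ℝ) ≤ s + 2)
    (hW : ∑ a ∈ (Finset.univ.filter fun a => p a ≠ 0), w a ≤ s) :
    LagF R (fun a => μ * w a) p ≤ 1/2 - (1 - μ * s)^2 / (2 * (s + 2)) + μ^2 * s / 2 := by
  set Q := Finset.univ.filter fun a => p a ≠ 0 with hQ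
  have hz : ∀ a, a ∉ Q → p a = 0 := by intro a ha; simpa [hQ] using ha
  have e1 : ∑ a, ∑ b, p a * p b * ind (R a b) = 1 - ∑ a ∈ Q, p a ^ 2 := by
    have e2 : ∀ a, ∑ b, p a * p b * ind (R a b) = p a - p a ^ 2 := by
      intro a
      have : ∀ b, p a * p b * ind (R a b) = p a * p b - (if b = a then p a * p a else 0) := by
        intro b
        by_cases hab : b = a
        · subst hab; rw [ind_of_not (hi b)]; simp
        · simp only [hab, if_false, sub_zero]
          by_cases ha : p a = 0
          · simp [ha]
          · by_cases hb : p b = 0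
            · simp [hb]
            · rw [ind_of (hcl a b ha hb (Ne.symm hab)), mul_one]
      simp only [this]
      rw [Finset.sum_sub_distrib, ← Finset.mul_sum, h1]
      simp; ring
    simp only [e2]
    rw [Finset.sum_sub_distrib, h1]
    congr 1
    symm
    exact Finset.sum_subset (Finset.subset_univ _) fun a _ ha => by rw [hz a ha]; ring
  have e3 : ∑ a, p a * (μ * w a) = ∑ a ∈ Q, p a * (μ * w a) := by
    symm
    exact Finset.sum_subset (Finset.subset_univ _) fun a _ ha => by rw [hz a ha]; ring
  have e4 : ∑ a ∈ Q, p a = 1 := by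
    rw [← h1]; exact Finset.sum_subset (Finset.subset_univ _) fun a _ ha => hz a ha
  set W := ∑ a ∈ Q, w a with hWd
  have hW0 : 0 ≤ W := Finset.sum_nonneg fun a _ => hw0 a
  have cs := sq_sum_le_card_mul_sum_sq (s := Q) (f := fun a => p a - μ * w a)
  rw [Finset.sum_sub_distrib, ← Finset.mul_sum, e4, ← hWd] at cs
  set T := ∑ a ∈ Q, (p a - μ * w a)^2 with hT
  have hT0 : 0 ≤ T := Finset.sum_nonneg fun a _ => sq_nonneg _
  have hw2 : ∑ a ∈ Q, w a ^ 2 ≤ W := Finset.sum_le_sum fun a _ => by nlinarith [hw0 a, hw1 a]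
  have hTe : T = ∑ a ∈ Q, p a ^ 2 - 2 * ∑ a ∈ Q, p a * (μ * w a) + μ^2 * ∑ a ∈ Q, w a ^ 2 := by
    rw [hT, Finset.mul_sum, Finset.mul_sum, ← Finset.sum_sub_distrib, ← Finset.sum_add_distrib]
    exact Finset.sum_congr rfl fun a _ => by ring
  unfold LagF
  rw [e1, e3]
  have hT2 : (1 - μ * W)^2 / (s + 2) ≤ T := by
    rw [div_le_iff₀ (by linarith)]
    nlinarith
  have hmono : (1 - μ * s)^2 / (s+2) - μ^2 * s ≤ (1 - μ * W)^2 / (s+2) - μ^2 * W := by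
    have : (1 - μ * s)^2 / (s+2) ≤ (1 - μ * W)^2 / (s+2) := by
      apply div_le_div_of_nonneg_right _ (by linarith)
      have : μ * W ≤ μ * s := mul_le_mul_of_nonneg_left hW hμ
      nlinarith
    nlinarith [mul_nonneg (sq_nonneg μ) (sub_nonneg.mpr hW)]
  have hμ2 : μ^2 * ∑ a ∈ Q, w a ^ 2 ≤ μ^2 * W := mul_le_mul_of_nonneg_left hw2 (sq_nonneg μ)
  have e5 : (1 - μ * s)^2 / (2 * (s + 2)) = ((1 - μ * s)^2 / (s + 2)) / 2 := by
    rw [div_div]; ring_nf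
  rw [e5]
  linarith

lemma lag_clique {ι : Type*} [Fintype ι] [DecidableEq ι] (R : ι → ι → Prop) (hsy : ∀ a b, R a b → R b a)
    (hi : ∀ a, ¬ R a a) (w : ι → ℝ) (hw0 : ∀ a, 0 ≤ w a) (hw1 : ∀ a, w a ≤ 1) (μ s : ℝ) (hμ : 0 ≤ μ)
    (hs : 0 ≤ s) (hμs : μ * s ≤ 1) (p : ι → ℝ) (h0 : ∀ a, 0 ≤ p a) (h1 : ∑ a, p a = 1)
    (hL : 1/2 - (1 - μ * s)^2 / (2 * (s + 2)) + μ^2 * s / 2 < LagF R (fun a => μ * w a) p) :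
    ∃ Q : Finset ι, (∀ a ∈ Q, ∀ b ∈ Q, a ≠ b → R a b) ∧ (s + 2 < Q.card ∨ s < ∑ a ∈ Q, w a) := by
  obtain ⟨p', a1, a2, a3, a4⟩ := motzkin R hsy hi (fun a => μ * w a) _ p h0 h1 le_rfl
  refine ⟨Finset.univ.filter fun a => p' a ≠ 0, ?_, ?_⟩
  · intro a ha b hb
    simp only [Finset.mem_filter, Finset.mem_univ, true_and] at ha hb
    exact a4 a b ha hb
  · by_contra hc
    push Not at hc
    have := clique_lag R hi w hw0 hw1 μ s hμ hs hμs p' a1 a2 a4 hc.1 hc.2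
    linarith

end P6


section P6b
universe u

lemma emb_of_card {ι : Type*} (Q : Finset ι) (k : ℕ) (h : k ≤ Q.card) :
    ∃ e : Fin k → ι, Function.Injective e ∧ ∀ i, e i ∈ Q := by
  classical
  refine ⟨fun i => (Q.equivFin.symm (Fin.castLE h i)).1, ?_, fun i => (Q.equivFin.symm _).2⟩
  intro i j hij
  have := Q.equivFin.symm.injective (Subtype.ext hij)
  exact Fin.castLE_injective h this

/-- complete adjacency -/
def Cliq {V : Type*} (G : SimpleGraph V) (q : ℕ) (κ : Fin q → V) : Prop :=
  ∀ i j, i ≠ j → G.Adj (κ i) (κ j)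

lemma pick {V ι : Type*} [DecidableEq ι] (G : SimpleGraph V) (s : ℕ) (x y : V) (φ : ι → V)
    (Q : Finset ι) (hQ : ∀ a ∈ Q, ∀ b ∈ Q, a ≠ b → G.Adj (φ a) (φ b))
    (h : (s:ℝ) + 2 < Q.card ∨ (s:ℝ) < ∑ a ∈ Q, (ind (G.Adj x (φ a)) + ind (G.Adj y (φ a))) / 2) :
    (∃ e : Fin (s+3) → ι, Function.Injective e ∧ Cliq G (s+3) (φ ∘ e)) ∨
    (∃ e : Fin (s+2) → ι, Function.Injective e ∧ CliqTy G (s+2) (fun _ => false) x y (φ ∘ e)) ∨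
    (∃ e : Fin (s+1) → ι, Function.Injective e ∧
      CliqTy G (s+1) (fun i => decide (i.1 < s)) x y (φ ∘ e)) := by
  classical
  have hcl : ∀ k (e : Fin k → ι), Function.Injective e → (∀ i, e i ∈ Q) → Cliq G k (φ ∘ e) := by
    intro k e he heQ i j hij
    exact hQ _ (heQ i) _ (heQ j) (fun h => hij (he h))
  rcases h with h | h
  · left
    obtain ⟨e, he, heQ⟩ := emb_of_card Q (s+3) (by
      have : ((s + 2 : ℕ) : ℝ) < Q.card := by push_cast; exact h
      have := Nat.cast_lt.mp this
      omega)
    exact ⟨e, he, hcl _ e he heQ⟩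
  · right
    set A := Q.filter fun a => G.Adj x (φ a) ∧ G.Adj y (φ a) with hA
    set U := Q.filter fun a => G.Adj x (φ a) ∨ G.Adj y (φ a) with hU
    have hAU : A ⊆ U := by
      intro a ha
      rw [hA, Finset.mem_filter] at ha
      rw [hU, Finset.mem_filter]
      exact ⟨ha.1, Or.inl ha.2.1⟩
    have hsum : ∑ a ∈ Q, (ind (G.Adj x (φ a)) + ind (G.Adj y (φ a))) / 2 = ((A.card : ℝ) + U.card) / 2 := by
      rw [hA, hU, Finset.card_filter, Finset.card_filter]
      push_cast
      rw [← Finset.sum_add_distrib, Finset.sum_div]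
      refine Finset.sum_congr rfl fun a _ => ?_
      unfold ind
      by_cases h1 : G.Adj x (φ a) <;> by_cases h2 : G.Adj y (φ a) <;> simp [h1, h2]
    rw [hsum] at h
    have h' : 2 * s < A.card + U.card := by
      have : ((2 * s : ℕ) : ℝ) < ((A.card + U.card : ℕ) : ℝ) := by push_cast; linarith
      exact_mod_cast this
    have hc := Finset.card_le_card hAU
    have hUm : ∀ a ∈ U, a ∈ Q ∧ (G.Adj x (φ a) ∨ G.Adj y (φ a)) := by
      intro a ha; exact Finset.mem_filter.mp ha
    have hAm : ∀ a ∈ A, a ∈ Q ∧ (G.Adj x (φ a) ∧ G.Adj y (φ a)) := by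
      intro a ha; exact Finset.mem_filter.mp ha
    by_cases hU2 : s + 2 ≤ U.card
    · left
      obtain ⟨e, he, heU⟩ := emb_of_card U (s+2) hU2
      refine ⟨e, he, hcl _ e he (fun i => (hUm _ (heU i)).1), fun i => ⟨by simp, (hUm _ (heU i)).2⟩⟩
    · right
      obtain ⟨e1, he1, he1A⟩ := emb_of_card A s (by omega)
      obtain ⟨u, hu, hue⟩ : ∃ u ∈ U, u ∉ Finset.univ.image e1 := by
        by_contra hne
        push Not at hne
        have h1 : U ⊆ Finset.univ.image e1 := hne
        have h2 := Finset.card_le_card h1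
        have h3 : (Finset.univ.image e1).card ≤ s := by
          refine le_trans Finset.card_image_le ?_
          simp
        omega
      have hinj : Function.Injective (Fin.snoc e1 u : Fin (s+1) → ι) := by
        rw [Fin.snoc_injective_iff]
        refine ⟨he1, ?_⟩
        rintro ⟨i, hi⟩
        exact hue (by rw [← hi]; simp)
      have hmem : ∀ i, (Fin.snoc e1 u : Fin (s+1) → ι) i ∈ U := by
        intro i
        refine Fin.lastCases ?_ (fun j => ?_) i
        · simpa using hu
        · simpa using hAU (he1A j)
      refine ⟨Fin.snoc e1 u, hinj, hcl _ _ hinj (fun i => (hUm _ (hmem i)).1), fun i => ⟨?_, (hUm _ (hmem i)).2⟩⟩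
      refine Fin.lastCases ?_ (fun j => ?_) i
      · simp
      · intro _
        simpa using (hAm _ (he1A j)).2

lemma cnt_pair {V : Type*} [Fintype V] (m : ℕ) (i j : Fin m) (hij : i ≠ j) (p : V → V → Prop) :
    cnt (fun φ : Fin m → V => p (φ i) (φ j)) * (Fintype.card V : ℝ) ^ 2 =
      (∑ v, cnt (p v)) * (Fintype.card V : ℝ) ^ m := by
  have h1 := cnt_comp_inj (V := V) (![i, j]) (by
    intro a b hab
    fin_cases a <;> fin_cases b <;> simp_all) (fun f : Fin 2 → V => p (f 0) (f 1))
  have h2 := cnt_equiv (finTwoArrowEquiv V) (fun z => p z.1 z.2)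
  have h3 : cnt (fun f : Fin 2 → V => p (f 0) (f 1)) = ∑ v, cnt (p v) := by
    rw [cnt_prod] at h2
    exact h2
  rw [h3] at h1
  simpa [Fintype.card_fin] using h1

lemma cnt_all_emb {V : Type*} [Fintype V] [Nonempty V] (m q : ℕ) (C : (Fin q → V) → Prop) (η : ℝ)
    (hη : 0 ≤ η)
    (hC : cnt C ≤ η * (Fintype.card V : ℝ) ^ q) :
    cnt (fun φ : Fin m → V => ∃ e : Fin q → Fin m, Function.Injective e ∧ C (φ ∘ e)) ≤
      (m:ℝ) ^ q * η * (Fintype.card V : ℝ) ^ m := by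
  classical
  refine le_trans (cnt_exists_le _) ?_
  have hn : (0:ℝ) < Fintype.card V := by exact_mod_cast Fintype.card_pos
  have : ∀ e : Fin q → Fin m, cnt (fun φ : Fin m → V => Function.Injective e ∧ C (φ ∘ e)) ≤
      η * (Fintype.card V : ℝ) ^ m := by
    intro e
    rw [cnt_const_and]
    by_cases he : Function.Injective e
    · rw [ind_of he, one_mul]
      have h1 := cnt_comp_inj (V := V) e he C
      simp only [Fintype.card_fin] at h1
      have h2 : cnt (fun φ : Fin m → V => C (φ ∘ e)) * (Fintype.card V : ℝ) ^ q ≤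
          (η * (Fintype.card V : ℝ) ^ m) * (Fintype.card V : ℝ) ^ q := by
        rw [h1]
        have := mul_le_mul_of_nonneg_right hC (show (0:ℝ) ≤ (Fintype.card V : ℝ) ^ m by positivity)
        linarith
      exact le_of_mul_le_mul_right h2 (by positivity)
    · rw [ind_of_not he, zero_mul]; positivity
  refine le_trans (Finset.sum_le_sum fun e _ => this e) ?_
  rw [Finset.sum_const, Finset.card_univ, Fintype.card_fun, nsmul_eq_mul]
  simp only [Fintype.card_fin]
  push_cast
  linarith

set_option maxHeartbeats 1600000 in
lemma sampling (s : ℕ) (hs : 1 ≤ s) (δ ε : ℝ) (hδ1 : (s:ℝ) / (s + 2) ≤ δ) (hδ2 : δ ≤ (s:ℝ) / (s + 1))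
    (hε : 0 < ε) : ∃ η : ℝ, 0 < η ∧ η ≤ 1 ∧ ∀ {V : Type u} [Fintype V] [Nonempty V] (G : SimpleGraph V),
      (∀ v, δ * Fintype.card V ≤ cnt (G.Adj v)) →
      2 * ((δ * (1 - δ) + (1 - δ) ^ 2 / 4 + ((s:ℝ) - 1) * δ ^ 2 / (2 * s)) + ε) * (Fintype.card V : ℝ) ^ 2
        ≤ ∑ v, cnt (G.Adj v) →
      ∀ x y, G.Adj x y →
        η * (Fintype.card V : ℝ) ^ (s+3) ≤ cnt (Cliq G (s+3)) ∨
        η * (Fintype.card V : ℝ) ^ (s+2) ≤ cnt (CliqTy G (s+2) (fun _ => false) x y) ∨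
        η * (Fintype.card V : ℝ) ^ (s+1) ≤ cnt (CliqTy G (s+1) (fun i => decide (i.1 < s)) x y) := by
  classical
  have hs' : (1:ℝ) ≤ s := by exact_mod_cast hs
  obtain ⟨m0, hm0⟩ := exists_nat_gt (1 / ε)
  set m := m0 + 1 with hm
  have hmε : 1 < m * ε := by
    rw [div_lt_iff₀ hε] at hm0
    rw [hm]; push_cast; nlinarith
  have hm1 : (1:ℝ) ≤ m := by rw [hm]; push_cast; linarith [Nat.cast_nonneg (α := ℝ) m0]
  set η := min 1 (ε / (12 * m ^ (s+3))) with hη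
  have hη0 : 0 < η := lt_min one_pos (by positivity)
  refine ⟨η, hη0, min_le_left _ _, ?_⟩
  intro V _ _ G hdeg hedge x y hxy
  by_contra hcon
  push Not at hcon
  obtain ⟨hc1, hc2, hc3⟩ := hcon
  set f2 := δ * (1 - δ) + (1 - δ) ^ 2 / 4 + ((s:ℝ) - 1) * δ ^ 2 / (2 * s) with hf2
  set μ := δ / s - (1 - δ) / 2 with hμd
  rw [div_le_iff₀ (by linarith)] at hδ1
  rw [le_div_iff₀ (by linarith)] at hδ2
  have hsp : (0:ℝ) < s := by linarith
  have hμs' : μ * s = δ - s * (1 - δ) / 2 := by rw [hμd]; field_simp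
  have hμ0 : 0 ≤ μ := by
    by_contra hneg
    push Not at hneg
    nlinarith
  have hμ1 : μ ≤ 1/2 := by
    by_contra hneg
    push Not at hneg
    nlinarith
  have hμs : μ * s ≤ 1 := by rw [hμs']; nlinarith
  have hB : 1/2 - (1 - μ * s)^2 / (2 * ((s:ℝ) + 2)) + μ^2 * s / 2 = f2 + μ * δ := by
    rw [hf2, hμd]; field_simp; ring
  set n : ℝ := (Fintype.card V : ℝ) with hn
  have hn0 : 0 < n := by rw [hn]; exact_mod_cast Fintype.card_pos
  set w : V → ℝ := fun v => (ind (G.Adj x v) + ind (G.Adj y v)) / 2 with hw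
  have hw0 : ∀ v, 0 ≤ w v := fun v => by
    simp only [hw]; linarith [ind_nonneg (G.Adj x v), ind_nonneg (G.Adj y v)]
  have hw1 : ∀ v, w v ≤ 1 := fun v => by
    simp only [hw]; linarith [ind_le_one (G.Adj x v), ind_le_one (G.Adj y v)]
  set L : (Fin m → V) → ℝ := fun φ => LagF (fun a b => G.Adj (φ a) (φ b)) (fun a => μ * w (φ a))
    (fun _ => (1:ℝ) / m) with hL
  have hmp : (0:ℝ) < m := by linarith
  have hsum1 : ∑ _a : Fin m, (1:ℝ) / m = 1 := by
    rw [Finset.sum_const, Finset.card_univ, Fintype.card_fin, nsmul_eq_mul]; field_simp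
  have hL1 : ∀ φ, L φ ≤ 1 := by
    intro φ
    have h1 : ∑ a : Fin m, ∑ b : Fin m, (1:ℝ) / m * (1 / m) * ind (G.Adj (φ a) (φ b)) ≤
        ∑ _a : Fin m, (1:ℝ) / m := by
      refine Finset.sum_le_sum fun a _ => ?_
      refine le_trans (Finset.sum_le_sum (g := fun _ => (1:ℝ) / m * (1 / m)) fun b _ => ?_) ?_
      · have := ind_le_one (G.Adj (φ a) (φ b))
        have h2 : (0:ℝ) ≤ (1:ℝ) / m * (1 / m) := by positivity
        exact mul_le_of_le_one_right h2 this
      · rw [← Finset.mul_sum, hsum1, mul_one]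
    have h2 : ∑ a : Fin m, (1:ℝ) / m * (μ * w (φ a)) ≤ ∑ _a : Fin m, (1:ℝ) / m * (1/2) := by
      refine Finset.sum_le_sum fun a _ => ?_
      refine mul_le_mul_of_nonneg_left ?_ (by positivity)
      have q1 : μ * w (φ a) ≤ μ * 1 := mul_le_mul_of_nonneg_left (hw1 _) hμ0
      linarith
    rw [← Finset.sum_mul, hsum1] at h2
    rw [hsum1] at h1
    simp only [hL, LagF]
    linarith
  -- the large samples
  have hbig : ∀ φ : Fin m → V, f2 + μ * δ < L φ →
      ((∃ e : Fin (s+3) → Fin m, Function.Injective e ∧ Cliq G (s+3) (φ ∘ e)) ∨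
      (∃ e : Fin (s+2) → Fin m, Function.Injective e ∧ CliqTy G (s+2) (fun _ => false) x y (φ ∘ e))) ∨
      (∃ e : Fin (s+1) → Fin m, Function.Injective e ∧
        CliqTy G (s+1) (fun i => decide (i.1 < s)) x y (φ ∘ e)) := by
    intro φ hφ
    rw [← hB] at hφ
    obtain ⟨Q, hQ, hQ2⟩ := lag_clique (fun a b => G.Adj (φ a) (φ b)) (fun a b h => h.symm)
      (fun a => G.irrefl) (fun a => w (φ a)) (fun a => hw0 _) (fun a => hw1 _) μ s hμ0 hsp.le hμs
      (fun _ => (1:ℝ) / m) (fun _ => by positivity) hsum1 hφ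
    rw [or_assoc]
    exact pick G s x y φ Q hQ hQ2
  have hcb : cnt (fun φ : Fin m → V => f2 + μ * δ < L φ) ≤ 3 * ((m:ℝ) ^ (s+3) * η * n ^ m) := by
    refine le_trans (cnt_mono hbig) ?_
    refine le_trans (cnt_or_le _ _) ?_
    have a0 := cnt_or_le (fun φ : Fin m → V => ∃ e : Fin (s+3) → Fin m, Function.Injective e ∧ Cliq G (s+3) (φ ∘ e))
      (fun φ => ∃ e : Fin (s+2) → Fin m, Function.Injective e ∧ CliqTy G (s+2) (fun _ => false) x y (φ ∘ e))
    have a1 := cnt_all_emb m (s+3) (Cliq G (s+3)) η hη0.le hc1.le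
    have a2 := cnt_all_emb m (s+2) (CliqTy G (s+2) (fun _ => false) x y) η hη0.le hc2.le
    have a3 := cnt_all_emb m (s+1) (CliqTy G (s+1) (fun i => decide (i.1 < s)) x y) η hη0.le hc3.le
    rw [← hn] at a1 a2 a3
    have b2 : (m:ℝ) ^ (s+2) * η * n ^ m ≤ (m:ℝ) ^ (s+3) * η * n ^ m := by gcongr <;> first | exact hm1 | omega
    have b3 : (m:ℝ) ^ (s+1) * η * n ^ m ≤ (m:ℝ) ^ (s+3) * η * n ^ m := by gcongr <;> first | exact hm1 | omega
    linarith
  have hup : ∑ φ, L φ ≤ (f2 + μ * δ) * n ^ m + cnt (fun φ : Fin m → V => f2 + μ * δ < L φ) := by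
    have hcard : ∑ _φ : Fin m → V, (f2 + μ * δ) = (f2 + μ * δ) * n ^ m := by
      rw [Finset.sum_const, Finset.card_univ, Fintype.card_fun, nsmul_eq_mul, Fintype.card_fin]
      push_cast; rw [mul_comm]
    have hf20 : 0 ≤ f2 + μ * δ := by
      have : 0 ≤ δ := by by_contra h; push Not at h; nlinarith
      have : δ ≤ 1 := by by_contra h; push Not at h; nlinarith
      have h1 : 0 ≤ ((s:ℝ) - 1) * δ ^ 2 / (2 * s) := by
        apply div_nonneg _ (by linarith)
        exact mul_nonneg (by linarith) (sq_nonneg _)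
      rw [hf2]
      nlinarith [mul_nonneg hμ0 ‹0 ≤ δ›, sq_nonneg (1 - δ)]
    rw [← hcard]
    unfold cnt
    rw [← Finset.sum_add_distrib]
    refine Finset.sum_le_sum fun φ _ => ?_
    by_cases hφ : f2 + μ * δ < L φ
    · rw [ind_of hφ]; linarith [hL1 φ]
    · rw [ind_of_not hφ]; linarith
  -- expectation
  set Sd := ∑ v, cnt (G.Adj v) with hSd
  have hE1 : ∀ i j : Fin m, (if i = j then 0 else Sd / n ^ 2 * n ^ m) = cnt (fun φ : Fin m → V => G.Adj (φ i) (φ j)) := by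
    intro i j
    split_ifs with hij
    · subst hij
      unfold cnt
      symm
      exact Finset.sum_eq_zero fun φ _ => ind_of_not G.irrefl
    · have := cnt_pair (V := V) m i j hij G.Adj
      rw [← hn] at this
      field_simp
      linarith
  have hE2 : ∀ i : Fin m, ∑ φ : Fin m → V, w (φ i) = (cnt (G.Adj x) + cnt (G.Adj y)) / 2 / n * n ^ m := by
    intro i
    have h1 := cnt_coord (V := V) m i (G.Adj x)
    have h2 := cnt_coord (V := V) m i (G.Adj y)
    have h3 : ∑ φ : Fin m → V, w (φ i) = (cnt (fun φ : Fin m → V => G.Adj x (φ i)) +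
        cnt (fun φ : Fin m → V => G.Adj y (φ i))) / 2 := by
      unfold cnt
      rw [← Finset.sum_add_distrib, Finset.sum_div]
    rw [h3]
    rw [← hn] at h1 h2
    field_simp
    linarith
  have hEL : ∑ φ, L φ = (1/2) * (1 / m * (1 / m)) * (m * (m - 1) * (Sd / n ^ 2 * n ^ m)) +
      1 / m * μ * (m * ((cnt (G.Adj x) + cnt (G.Adj y)) / 2 / n * n ^ m)) := by
    simp only [hL, LagF]
    rw [Finset.sum_add_distrib, ← Finset.mul_sum]
    congr 1
    · rw [Finset.sum_comm, mul_assoc]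
      congr 1
      have : ∀ a : Fin m, ∑ φ : Fin m → V, ∑ b : Fin m, (1:ℝ) / m * (1 / m) * ind (G.Adj (φ a) (φ b)) =
          1 / m * (1 / m) * ∑ b : Fin m, (if a = b then 0 else Sd / n ^ 2 * n ^ m) := by
        intro a
        rw [Finset.sum_comm, Finset.mul_sum]
        refine Finset.sum_congr rfl fun b _ => ?_
        rw [hE1 a b, ← Finset.mul_sum]; rfl
      simp only [this]
      rw [← Finset.mul_sum]
      congr 1
      have : ∀ a : Fin m, ∑ b : Fin m, (if a = b then 0 else Sd / n ^ 2 * n ^ m) = (m - 1) * (Sd / n ^ 2 * n ^ m) := by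
        intro a
        have : ∀ b : Fin m, (if a = b then 0 else Sd / n ^ 2 * n ^ m) = Sd / n ^ 2 * n ^ m - (if a = b then Sd / n ^ 2 * n ^ m else 0) := by
          intro b; split_ifs <;> ring
        simp only [this]
        rw [Finset.sum_sub_distrib]
        simp
        ring
      simp only [this]
      rw [Finset.sum_const, Finset.card_univ, Fintype.card_fin, nsmul_eq_mul]
      ring
    · rw [Finset.sum_comm]
      have : ∀ a : Fin m, ∑ φ : Fin m → V, (1:ℝ) / m * (μ * w (φ a)) = 1 / m * μ * ((cnt (G.Adj x) + cnt (G.Adj y)) / 2 / n * n ^ m) := by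
        intro a
        rw [← hE2 a, Finset.mul_sum]
        exact Finset.sum_congr rfl fun φ _ => by ring
      simp only [this]
      rw [Finset.sum_const, Finset.card_univ, Fintype.card_fin, nsmul_eq_mul]
      ring
  set N := n ^ m with hN
  have hN0 : 0 < N := by positivity
  have hg1 : 2 * (f2 + ε) ≤ Sd / n ^ 2 := by rw [le_div_iff₀ (by positivity)]; exact hedge
  have hg2 : Sd / n ^ 2 ≤ 1 := by
    rw [div_le_one (by positivity), hSd]
    refine le_trans (Finset.sum_le_sum fun v _ => cnt_le_card _) ?_
    rw [Finset.sum_const, Finset.card_univ, nsmul_eq_mul, ← hn]; nlinarith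
  have hg3 : δ ≤ (cnt (G.Adj x) + cnt (G.Adj y)) / 2 / n := by
    rw [le_div_iff₀ hn0]
    linarith [hdeg x, hdeg y]
  set σ := Sd / n ^ 2 with hσ
  set ω := (cnt (G.Adj x) + cnt (G.Adj y)) / 2 / n with hω
  have hEL2 : ∑ φ, L φ = ((1/2) * (1 - 1 / m) * σ + μ * ω) * N := by
    rw [hEL]; field_simp
  have hfin : ((1/2) * (1 - 1 / m) * σ + μ * ω) * N ≤ (f2 + μ * δ + 3 * ((m:ℝ) ^ (s+3) * η)) * N := by
    rw [← hEL2]; linarith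
  have hfin2 := le_of_mul_le_mul_right hfin hN0
  have hη2 : 3 * ((m:ℝ) ^ (s+3) * η) ≤ ε / 4 := by
    have : η ≤ ε / (12 * m ^ (s+3)) := min_le_right _ _
    have h2 : (m:ℝ) ^ (s+3) * η ≤ m ^ (s+3) * (ε / (12 * m ^ (s+3))) := by gcongr
    have h3 : (m:ℝ) ^ (s+3) * (ε / (12 * m ^ (s+3))) = ε / 12 := by field_simp
    linarith
  have hmi : (1:ℝ) / m ≤ ε := by rw [div_le_iff₀ hmp]; linarith
  have hmi0 : (0:ℝ) ≤ 1 / m := by positivity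
  have hx : μ * δ ≤ μ * ω := mul_le_mul_of_nonneg_left hg3 hμ0
  have hy : 1 / (m:ℝ) * σ ≤ 1 / m * 1 := mul_le_mul_of_nonneg_left hg2 hmi0
  nlinarith

end P6b


section P7a

lemma list_shift (t : ℕ) : ∀ (κ : Type) [Fintype κ], ∃ M : ℕ, ∀ c : List ℕ → κ,
    ∃ (x : ℕ) (l : List ℕ) (y : ℕ), l.length = t ∧ (x :: (l ++ [y])).Pairwise (· < ·) ∧
      (∀ z ∈ x :: (l ++ [y]), z < M) ∧ c (x :: l) = c (l ++ [y]) := by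
  classical
  induction t with
  | zero =>
    intro κ _
    refine ⟨Fintype.card κ + 1, fun c => ?_⟩
    obtain ⟨x, y, hxy, hc⟩ := Fintype.exists_ne_map_eq_of_card_lt
      (fun i : Fin (Fintype.card κ + 1) => c [i.1]) (by simp)
    rcases lt_or_gt_of_ne hxy with h | h
    · exact ⟨x.1, [], y.1, rfl, by simpa using h, by simp; exact ⟨by omega, by omega⟩, hc⟩
    · exact ⟨y.1, [], x.1, rfl, by simpa using h, by simp; exact ⟨by omega, by omega⟩, hc.symm⟩
  | succ t ih =>
    intro κ _
    obtain ⟨M, hM⟩ := ih (Finset κ)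
    refine ⟨M, fun c => ?_⟩
    obtain ⟨x, l, y, hl, hs, hb, hc⟩ := hM (fun l => Finset.univ.filter fun a =>
      ∃ z, (z :: l).Pairwise (· < ·) ∧ (∀ w ∈ z :: l, w < M) ∧ c (z :: l) = a)
    have h1 : c (x :: (l ++ [y])) ∈ (Finset.univ.filter fun a =>
      ∃ z, (z :: (l ++ [y])).Pairwise (· < ·) ∧ (∀ w ∈ z :: (l ++ [y]), w < M) ∧ c (z :: (l ++ [y])) = a) := by
      simp only [Finset.mem_filter, Finset.mem_univ, true_and]
      exact ⟨x, hs, hb, rfl⟩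
    rw [← hc] at h1
    simp only [Finset.mem_filter, Finset.mem_univ, true_and] at h1
    obtain ⟨z, hz1, hz2, hz3⟩ := h1
    refine ⟨z, x :: l, y, by simp [hl], ?_, ?_, ?_⟩
    · have e : z :: (x :: l ++ [y]) = z :: (x :: (l ++ [y])) := by simp
      rw [e, List.pairwise_cons]
      refine ⟨?_, hs⟩
      rw [List.pairwise_cons] at hz1
      have hzx : z < x := hz1.1 x (by simp)
      rw [List.pairwise_cons] at hs
      intro w hw
      rcases List.mem_cons.mp hw with h | h
      · rw [h]; exact hzx
      · exact lt_trans hzx (hs.1 w h)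
    · intro w hw
      rcases List.mem_cons.mp hw with h | h
      · exact hz2 w (by simp [h])
      · exact hb w (by simpa using h)
    · rw [hz3]; simp

/-- increasing tuples -/
abbrev Tup (t M : ℕ) : Type := {a : Fin t → Fin M // StrictMono a}

/-- `b` is the shift of `a` -/
def IsShift {t M : ℕ} (a b : Fin t → Fin M) : Prop := ∀ (i : Fin t) (h : i.1 + 1 < t), b i = a ⟨i.1 + 1, h⟩

def shiftG (t M : ℕ) : SimpleGraph (Tup t M) where
  Adj a b := a ≠ b ∧ (IsShift a.1 b.1 ∨ IsShift b.1 a.1)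
  symm := ⟨fun _ _ h => ⟨h.1.symm, h.2.symm⟩⟩
  loopless := ⟨fun _ h => h.1 rfl⟩

lemma shift_not_colorable (t k : ℕ) : ∃ M, ¬ (shiftG (t+1) M).Colorable k ∧ t + 1 ≤ M := by
  classical
  obtain ⟨M, hM⟩ := list_shift t (Option (Fin k))
  refine ⟨M, ?_, ?_⟩
  · rintro ⟨C⟩
    obtain ⟨x, l, y, hl, hs, hb, hc⟩ := hM (fun l =>
      if h : l.length = t + 1 ∧ l.Pairwise (· < ·) ∧ ∀ z ∈ l, z < M then
        some (C ⟨fun i => ⟨l[i.1]'(by omega), h.2.2 _ (List.getElem_mem _)⟩, by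
          intro i j hij
          exact List.pairwise_iff_getElem.mp h.2.1 i.1 j.1 _ _ hij⟩) else none)
    have hs1 : (x :: l).Pairwise (· < ·) := by
      have : (x :: l).Sublist (x :: (l ++ [y])) := by simp
      exact hs.sublist this
    have hs2 : (l ++ [y]).Pairwise (· < ·) := (List.pairwise_cons.mp hs).2
    rw [dif_pos ⟨by simp [hl], hs1, fun z hz => hb z (by simp at hz ⊢; tauto)⟩,
      dif_pos ⟨by simp [hl], hs2, fun z hz => hb z (by simp at hz ⊢; tauto)⟩] at hc
    rw [Option.some.injEq] at hc
    refine C.valid ?_ hc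
    refine ⟨?_, Or.inl ?_⟩
    · intro he
      have h0 := congrFun (congrArg Subtype.val he) ⟨0, by omega⟩
      simp only [Fin.mk.injEq] at h0
      have : x < (l ++ [y])[0]'(by simp) := (List.pairwise_cons.mp hs).1 _ (List.getElem_mem _)
      simp only [List.getElem_cons_zero] at h0
      omega
    · intro i hi
      simp only [Fin.mk.injEq, List.getElem_cons_succ]
      rw [List.getElem_append_left]
  · obtain ⟨x, l, y, hl, hs, hb, hc⟩ := hM (fun _ => none)
    have h1 : (l ++ [y]).Nodup := by
      refine ((List.pairwise_cons.mp hs).2).imp ?_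
      intro a b h; exact Nat.ne_of_lt h
    have h2 : (l ++ [y]).toFinset ⊆ Finset.range M := by
      intro z hz
      simp only [List.mem_toFinset] at hz
      exact Finset.mem_range.mpr (hb z (List.mem_cons_of_mem _ hz))
    have := Finset.card_le_card h2
    rw [List.toFinset_card_of_nodup h1] at this
    simpa [hl] using this

/-- entries of `b` at index `i` occur in `a` at distance at most `ℓ`, parity shifted by `ℓ` -/
def Sh {t M : ℕ} (ℓ : ℕ) (a b : Fin t → Fin M) : Prop :=
  ∀ i : Fin t, ℓ ≤ i.1 → i.1 + ℓ < t →
    ∃ j : Fin t, j.1 % 2 = (i.1 + ℓ) % 2 ∧ i.1 ≤ j.1 + ℓ ∧ j.1 ≤ i.1 + ℓ ∧ b i = a j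

lemma Sh.refl {t M : ℕ} (a : Fin t → Fin M) : Sh 0 a a := by
  intro i _ _
  exact ⟨i, by simp, by omega, by omega, rfl⟩

lemma Sh.comp {t M ℓ ℓ' : ℕ} {a b c : Fin t → Fin M} (h : Sh ℓ a b) (h' : Sh ℓ' b c) : Sh (ℓ + ℓ') a c := by
  intro i h1 h2
  obtain ⟨j, j1, j2, j3, j4⟩ := h' i (by omega) (by omega)
  obtain ⟨k, k1, k2, k3, k4⟩ := h j (by omega) (by omega)
  exact ⟨k, by omega, by omega, by omega, by rw [j4, k4]⟩

lemma Sh.of_adj {t M : ℕ} {a b : Tup t M} (h : (shiftG t M).Adj a b) : Sh 1 a.1 b.1 := by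
  intro i h1 h2
  rcases h.2 with h | h
  · exact ⟨⟨i.1 + 1, h2⟩, rfl, by simp; omega, by simp, h i h2⟩
  · refine ⟨⟨i.1 - 1, by omega⟩, by simp; omega, by simp; omega, by simp; omega, ?_⟩
    have := h ⟨i.1 - 1, by omega⟩ (by simp; omega)
    rw [this]
    have e : i = ⟨i.1 - 1 + 1, by omega⟩ := Fin.ext (by simp only; omega)
    exact congrArg b.1 e

/-- `c` reads the parity pattern along `a` -/
def Okc {t M : ℕ} (a : Fin t → Fin M) (c : Fin M → Bool) : Prop := ∀ i, c (a i) = decide (i.1 % 2 = 0)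

lemma Sh.no_common {t M ℓ : ℕ} {a b : Fin t → Fin M} (h : Sh ℓ a b) (hℓ : ℓ % 2 = 1) (ht : 2 * ℓ < t)
    (c : Fin M → Bool) (ha : Okc a c) (hb : Okc b c) : False := by
  obtain ⟨j, j1, -, -, j4⟩ := h ⟨ℓ, by omega⟩ (by simp) (by simp; omega)
  have h1 := hb ⟨ℓ, by omega⟩
  rw [j4, ha j] at h1
  simp only [decide_eq_decide] at h1
  simp only at j1
  omega

lemma okc_count {t M : ℕ} (a : Tup t M) : cnt (Okc a.1) * 2 ^ t = 2 ^ M := by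
  have h := cnt_comp_inj (V := Bool) a.1 a.2.injective (fun f => ∀ i, f i = decide (i.1 % 2 = 0))
  simp only [Fintype.card_bool, Fintype.card_fin] at h
  have h2 : cnt (fun f : Fin t → Bool => ∀ i, f i = decide (i.1 % 2 = 0)) = 1 := by
    unfold cnt
    rw [Finset.sum_eq_single (fun i : Fin t => decide (i.1 % 2 = 0))]
    · exact ind_of (fun i => rfl)
    · intro f _ hf
      exact ind_of_not (fun h => hf (funext h))
    · simp
  rw [h2, one_mul] at h
  push_cast at h
  exact h

end P7a


section P7b

lemma cnt_eq_one {X : Type*} [Fintype X] (x : X) : cnt (fun v : X => v = x) = 1 := by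
  unfold cnt
  rw [Finset.sum_eq_single x]
  · exact ind_of rfl
  · intro b _ hb; exact ind_of_not hb
  · simp

lemma cnt_pi {ι V : Type*} [Fintype ι] [DecidableEq ι] [Fintype V] (p : V → Prop) :
    cnt (fun f : ι → V => ∀ i, p (f i)) = cnt p ^ Fintype.card ι := by
  classical
  have h := Finset.prod_univ_sum (fun _ : ι => (Finset.univ : Finset V)) (fun _ v => ind (p v))
  have h2 : ∀ f : ι → V, ind (∀ i, p (f i)) = ∏ i, ind (p (f i)) := by
    intro f
    by_cases hf : ∀ i, p (f i)
    · rw [ind_of hf]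
      symm
      exact Finset.prod_eq_one fun i _ => ind_of (hf i)
    · rw [ind_of_not hf]
      push Not at hf
      obtain ⟨i, hi⟩ := hf
      symm
      exact Finset.prod_eq_zero (Finset.mem_univ i) (ind_of_not hi)
  unfold cnt
  simp only [h2]
  rw [Finset.prod_const, Finset.card_univ, Fintype.piFinset_univ] at h
  exact h.symm

lemma pow_half (L : ℕ) (hL : 1 ≤ L) (x : ℕ) : (1 - 1 / (L:ℝ)) ^ (L * x) ≤ (1 / 2) ^ x := by
  have hL' : (1:ℝ) ≤ L := by exact_mod_cast hL
  have h0 : 0 ≤ 1 - 1 / (L:ℝ) := by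
    rw [sub_nonneg, div_le_one (by linarith)]; exact hL'
  rw [pow_mul]
  refine pow_le_pow_left₀ (by positivity) ?_ x
  have h1 : 1 - 1 / (L:ℝ) ≤ Real.exp (-(1 / (L:ℝ))) := by
    have := Real.add_one_le_exp (-(1 / (L:ℝ))); linarith
  have h2 : (1 - 1 / (L:ℝ)) ^ L ≤ Real.exp (-(1 / (L:ℝ))) ^ L := pow_le_pow_left₀ h0 h1 L
  rw [← Real.exp_nat_mul] at h2
  have h3 : (L:ℝ) * -(1 / (L:ℝ)) = -1 := by field_simp
  rw [h3, Real.exp_neg] at h2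
  refine le_trans h2 ?_
  have := Real.add_one_le_exp (1:ℝ)
  rw [one_div]
  exact inv_anti₀ (by norm_num) (by linarith)

/-- bad vertex: in a small set spanning many active edges -/
def BadV {W : Type*} {L : ℕ} [NeZero L] (h : ℕ) (ω : Sym2 W → Fin L) (v : W) : Prop :=
  ∃ (j : Fin (h+1)) (φ : Fin j.1 → W) (e : Fin j.1 → Sym2 (Fin j.1)) (i : Fin j.1),
    (Function.Injective φ ∧ Function.Injective e) ∧ φ i = v ∧ ∀ i, ω (Sym2.map φ (e i)) = 0

lemma bad_expect {W : Type*} [Fintype W] [DecidableEq W] (L h : ℕ) [NeZero L] :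
    ∑ ω : Sym2 W → Fin L, cnt (BadV h ω) ≤
      (∑ j : Fin (h+1), (j.1 : ℝ) * ((Fintype.card W : ℝ) / L) ^ j.1 * (Fintype.card (Sym2 (Fin j.1)) : ℝ) ^ j.1) *
        (L:ℝ) ^ Fintype.card (Sym2 W) := by
  classical
  have hL : (0:ℝ) < L := by exact_mod_cast Nat.pos_of_ne_zero (NeZero.ne L)
  set Tt := (L:ℝ) ^ Fintype.card (Sym2 W) with hTt
  have hTt0 : 0 < Tt := by positivity
  -- per structure
  have hone : ∀ (j : ℕ) (φ : Fin j → W) (e : Fin j → Sym2 (Fin j)),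
      cnt (fun ω : Sym2 W → Fin L => (Function.Injective φ ∧ Function.Injective e) ∧
        ∀ i, ω (Sym2.map φ (e i)) = 0) ≤ Tt / (L:ℝ) ^ j := by
    intro j φ e
    rw [cnt_const_and]
    by_cases hi : Function.Injective φ ∧ Function.Injective e
    · rw [ind_of hi, one_mul]
      have h1 := cnt_comp_inj (V := Fin L) (fun i => Sym2.map φ (e i))
        ((Sym2.map.injective hi.1).comp hi.2) (fun f => ∀ i, f i = 0)
      have h2 := cnt_pi (ι := Fin j) (V := Fin L) (fun v => v = 0)
      have h3 : cnt (fun v : Fin L => v = 0) = 1 := by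
        exact cnt_eq_one 0
      rw [h3, one_pow] at h2
      rw [h2, one_mul] at h1
      simp only [Fintype.card_fin] at h1
      rw [le_div_iff₀ (by positivity)]
      exact h1.le
    · rw [ind_of_not hi, zero_mul]; positivity
  have h1 : ∀ ω : Sym2 W → Fin L, cnt (BadV h ω) ≤ ∑ j : Fin (h+1), ∑ φ : Fin j.1 → W,
      ∑ e : Fin j.1 → Sym2 (Fin j.1), (j.1:ℝ) * ind ((Function.Injective φ ∧ Function.Injective e) ∧
        ∀ i, ω (Sym2.map φ (e i)) = 0) := by
    intro ω
    unfold BadV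
    refine le_trans (cnt_exists_le _) (Finset.sum_le_sum fun j _ => ?_)
    refine le_trans (cnt_exists_le _) (Finset.sum_le_sum fun φ _ => ?_)
    refine le_trans (cnt_exists_le _) (Finset.sum_le_sum fun e _ => ?_)
    refine le_trans (cnt_exists_le _) ?_
    refine le_trans (Finset.sum_le_sum (g := fun _ => ind ((Function.Injective φ ∧ Function.Injective e) ∧
        ∀ i, ω (Sym2.map φ (e i)) = 0)) fun i _ => ?_) ?_
    · unfold cnt
      rw [Finset.sum_eq_single (φ i)]
      · exact ind_mono (fun h => ⟨h.1, h.2.2⟩)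
      · intro v _ hv
        exact ind_of_not (fun h => hv h.2.1.symm)
      · simp
    · simp
  refine le_trans (Finset.sum_le_sum fun ω _ => h1 ω) ?_
  rw [Finset.sum_comm, Finset.sum_mul]
  refine Finset.sum_le_sum fun j _ => ?_
  rw [Finset.sum_comm]
  have h2 : ∀ φ : Fin j.1 → W, ∑ ω : Sym2 W → Fin L, ∑ e : Fin j.1 → Sym2 (Fin j.1),
      (j.1:ℝ) * ind ((Function.Injective φ ∧ Function.Injective e) ∧
        ∀ i, ω (Sym2.map φ (e i)) = 0) ≤
      (Fintype.card (Sym2 (Fin j.1)) : ℝ) ^ j.1 * ((j.1:ℝ) * (Tt / (L:ℝ) ^ j.1)) := by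
    intro φ
    rw [Finset.sum_comm]
    refine le_trans (Finset.sum_le_sum (g := fun _ => (j.1:ℝ) * (Tt / (L:ℝ) ^ j.1)) fun e _ => ?_) ?_
    · rw [← Finset.mul_sum]
      exact mul_le_mul_of_nonneg_left (hone j.1 φ e) (by positivity)
    · rw [Finset.sum_const, Finset.card_univ, Fintype.card_fun, nsmul_eq_mul, Fintype.card_fin]
      push_cast; rfl
  refine le_trans (Finset.sum_le_sum fun φ _ => h2 φ) ?_
  rw [Finset.sum_const, Finset.card_univ, Fintype.card_fun, nsmul_eq_mul, Fintype.card_fin]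
  push_cast
  rw [div_pow]
  apply le_of_eq
  field_simp

/-- no active edges between two large sets in adjacent fibres -/
def BadPair {β : Type*} {N L : ℕ} [NeZero L] (a : ℕ) (ω : Sym2 (β × Fin N) → Fin L) : Prop :=
  ∃ (p p' : β) (A B : Finset (Fin N)), (p ≠ p' ∧ a ≤ A.card ∧ a ≤ B.card) ∧
    ∀ i ∈ A, ∀ j ∈ B, ω s((p, i), (p', j)) ≠ 0

lemma badpair_count {β : Type*} [Fintype β] [DecidableEq β] (N L a : ℕ) [NeZero L] :
    cnt (BadPair (β := β) (N := N) (L := L) a) ≤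
      ((Fintype.card β : ℝ) ^ 2 * 4 ^ N * (1 - 1 / (L:ℝ)) ^ (a * a)) *
        (L:ℝ) ^ Fintype.card (Sym2 (β × Fin N)) := by
  classical
  have hL1 : 1 ≤ L := Nat.pos_of_ne_zero (NeZero.ne L)
  have hL : (0:ℝ) < L := by exact_mod_cast hL1
  set Tt := (L:ℝ) ^ Fintype.card (Sym2 (β × Fin N)) with hTt
  have hTt0 : 0 < Tt := by positivity
  have h0 : 0 ≤ 1 - 1 / (L:ℝ) := by
    rw [sub_nonneg, div_le_one hL]; exact_mod_cast hL1
  have hone : ∀ (p p' : β) (A B : Finset (Fin N)),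
      cnt (fun ω : Sym2 (β × Fin N) → Fin L => (p ≠ p' ∧ a ≤ A.card ∧ a ≤ B.card) ∧
        ∀ i ∈ A, ∀ j ∈ B, ω s((p, i), (p', j)) ≠ 0) ≤ (1 - 1 / (L:ℝ)) ^ (a * a) * Tt := by
    intro p p' A B
    rw [cnt_const_and]
    by_cases hi : p ≠ p' ∧ a ≤ A.card ∧ a ≤ B.card
    · rw [ind_of hi, one_mul]
      obtain ⟨hp, hA, hB⟩ := hi
      obtain ⟨eA, heA, heA'⟩ := emb_of_card A a hA
      obtain ⟨eB, heB, heB'⟩ := emb_of_card B a hB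
      have hinj : Function.Injective (fun z : Fin a × Fin a => s((p, eA z.1), (p', eB z.2))) := by
        rintro ⟨i, j⟩ ⟨i', j'⟩ hz
        simp only [Sym2.eq_iff, Prod.mk.injEq, true_and] at hz
        rcases hz with ⟨h1, h2⟩ | ⟨h1, h2⟩
        · rw [heA h1, heB h2]
        · exact (hp h1.1).elim
      have h1 := cnt_comp_inj (V := Fin L) _ hinj (fun f => ∀ i, f i ≠ 0)
      have h2 := cnt_pi (ι := Fin a × Fin a) (V := Fin L) (fun v => v ≠ 0)
      have h3 : cnt (fun v : Fin L => v ≠ 0) = L - 1 := by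
        have := cnt_not (fun v : Fin L => v = 0)
        have h4 : cnt (fun v : Fin L => v = 0) = 1 := cnt_eq_one 0
        rw [h4, Fintype.card_fin] at this
        exact this
      rw [h3] at h2
      rw [h2] at h1
      simp only [Fintype.card_fin, Fintype.card_prod] at h1
      have h5 : cnt (fun ω : Sym2 (β × Fin N) → Fin L => ∀ i ∈ A, ∀ j ∈ B, ω s((p, i), (p', j)) ≠ 0) ≤
          cnt (fun φ : Sym2 (β × Fin N) → Fin L =>
            ∀ i, (φ ∘ fun z : Fin a × Fin a => s((p, eA z.1), (p', eB z.2))) i ≠ 0) :=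
        cnt_mono fun ω hω z => hω _ (heA' _) _ (heB' _)
      refine le_trans h5 ?_
      have h6 : (1 - 1 / (L:ℝ)) ^ (a * a) = ((L:ℝ) - 1) ^ (a * a) / (L:ℝ) ^ (a * a) := by
        rw [← div_pow]; congr 1; field_simp
      rw [h6, div_mul_eq_mul_div, le_div_iff₀ (by positivity)]
      exact h1.le
    · rw [ind_of_not hi, zero_mul]; positivity
  unfold BadPair
  refine le_trans (cnt_exists_le _) ?_
  refine le_trans (Finset.sum_le_sum (g := fun _ => (Fintype.card β : ℝ) * (4 ^ N * ((1 - 1 / (L:ℝ)) ^ (a * a) * Tt)))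
    fun p _ => ?_) ?_
  · refine le_trans (cnt_exists_le _) ?_
    refine le_trans (Finset.sum_le_sum (g := fun _ => (4 ^ N * ((1 - 1 / (L:ℝ)) ^ (a * a) * Tt)))
      fun p' _ => ?_) ?_
    · refine le_trans (cnt_exists_le _) ?_
      refine le_trans (Finset.sum_le_sum (g := fun _ => (2 ^ N * ((1 - 1 / (L:ℝ)) ^ (a * a) * Tt)))
        fun A _ => ?_) ?_
      · refine le_trans (cnt_exists_le _) ?_
        refine le_trans (Finset.sum_le_sum fun B _ => hone p p' A B) ?_
        rw [Finset.sum_const, Finset.card_univ, nsmul_eq_mul, Fintype.card_finset, Fintype.card_fin]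
        push_cast; rfl
      · rw [Finset.sum_const, Finset.card_univ, nsmul_eq_mul, Fintype.card_finset, Fintype.card_fin]
        push_cast
        rw [← mul_assoc, ← mul_pow]; norm_num
    · rw [Finset.sum_const, Finset.card_univ, nsmul_eq_mul]
  · rw [Finset.sum_const, Finset.card_univ, nsmul_eq_mul]
    apply le_of_eq; ring

end P7b


section P7b2

lemma lift_graph {β : Type*} [Fintype β] [DecidableEq β] (K : SimpleGraph β) (k h : ℕ) (hk : 1 ≤ k)
    (hK : ¬ K.Colorable k) :
    ∃ (N : ℕ) (U : SimpleGraph (β × Fin N)), (∀ p q, U.Adj p q → K.Adj p.1 q.1) ∧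
      ¬ U.Colorable k ∧ ∀ Q : Finset (β × Fin N), Q.Nonempty → Q.card ≤ h →
        ∃ v ∈ Q, cnt (fun w => w ∈ Q ∧ U.Adj v w) ≤ 1 := by
  classical
  set b : ℝ := (Fintype.card β : ℝ) with hb
  have hb0 : 0 ≤ b := by positivity
  set C1 : ℝ := ∑ j : Fin (h+1), (j.1 : ℝ) * (b * (16 * (k:ℝ)^2)) ^ j.1 *
    (Fintype.card (Sym2 (Fin j.1)) : ℝ) ^ j.1 with hC1
  have hC10 : 0 ≤ C1 := Finset.sum_nonneg fun j _ => by positivity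
  obtain ⟨L, hL⟩ := exists_nat_gt (2 * b ^ 2 + 2 * C1 + 1)
  have hL1 : 1 ≤ L := by
    have : (1:ℝ) ≤ L := by nlinarith
    exact_mod_cast this
  have : NeZero L := ⟨by omega⟩
  have hLpos : (0:ℝ) < L := by exact_mod_cast hL1
  have hk' : (1:ℝ) ≤ k := by exact_mod_cast hk
  set N := 16 * k ^ 2 * L with hN
  set a := 8 * k * L with ha
  have haa : a * a = L * (4 * N) := by rw [ha, hN]; ring
  have hka : k * (2 * a) = N := by rw [ha, hN]; ring
  have haL : (L:ℝ) ≤ a := by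
    rw [ha]; push_cast; nlinarith
  have ha0 : (0:ℝ) < a := by linarith
  have hNL : (L:ℝ) ≤ N := by
    rw [hN]; push_cast; nlinarith [mul_pos hLpos hLpos, mul_nonneg hLpos.le (sub_nonneg.2 hk'), mul_nonneg (mul_nonneg hLpos.le (sub_nonneg.2 hk')) (sub_nonneg.2 hk')]
  set Tt := (L:ℝ) ^ Fintype.card (Sym2 (β × Fin N)) with hTt
  have hTt0 : 0 < Tt := by positivity
  have e1 : ∑ ω : Sym2 (β × Fin N) → Fin L, cnt (BadV h ω) ≤ C1 * Tt := by
    have := bad_expect (W := β × Fin N) L h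
    have h2 : ((Fintype.card (β × Fin N) : ℕ) : ℝ) / L = b * (16 * (k:ℝ)^2) := by
      rw [Fintype.card_prod, Fintype.card_fin, hN]; push_cast
      field_simp
      rw [hb]
    rw [h2] at this
    exact this
  have e2 : cnt (BadPair (β := β) (N := N) (L := L) a) ≤ (1/2) * Tt := by
    refine le_trans (badpair_count N L a) ?_
    refine mul_le_mul_of_nonneg_right ?_ hTt0.le
    have h1 := pow_half L hL1 (4 * N)
    rw [← haa] at h1
    have h2 : (4:ℝ)^N * (1/2)^(4*N) = (1/4)^N := by
      rw [pow_mul (1/2:ℝ) 4 N, ← mul_pow]; norm_num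
    have h3 : (N:ℝ) < 4 ^ N := by exact_mod_cast Nat.lt_pow_self (by norm_num)
    have h4 : b^2 * (4:ℝ)^N * (1 - 1 / (L:ℝ)) ^ (a * a) ≤ b^2 * (1/4)^N := by
      rw [mul_assoc, ← h2]
      gcongr
    refine le_trans h4 ?_
    rw [one_div_pow, mul_one_div, div_le_iff₀ (by positivity)]
    linarith
  have hex : ∃ ω : Sym2 (β × Fin N) → Fin L, ¬ BadPair a ω ∧ cnt (BadV h ω) ≤ a := by
    by_contra hc
    push Not at hc
    have h1 : ∀ ω : Sym2 (β × Fin N) → Fin L, 1 ≤ ind (BadPair a ω) + cnt (BadV h ω) / a := by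
      intro ω
      by_cases hω : BadPair a ω
      · rw [ind_of hω]
        have : 0 ≤ cnt (BadV h ω) / a := div_nonneg (cnt_nonneg _) ha0.le
        linarith
      · rw [ind_of_not hω, zero_add, le_div_iff₀ ha0, one_mul]
        exact (hc ω hω).le
    have h2 := Finset.sum_le_sum (s := Finset.univ) fun ω (_ : ω ∈ Finset.univ) => h1 ω
    rw [Finset.sum_const, Finset.card_univ, Fintype.card_fun, Fintype.card_fin, nsmul_eq_mul, mul_one,
      Finset.sum_add_distrib, ← Finset.sum_div] at h2
    push_cast at h2
    change Tt ≤ cnt (BadPair (β := β) (N := N) (L := L) a) + _ at h2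
    have h3 : (∑ ω : Sym2 (β × Fin N) → Fin L, cnt (BadV h ω)) / a ≤ C1 * Tt / a := by gcongr
    have h4 : C1 * Tt / a < (1/2) * Tt := by
      rw [div_lt_iff₀ ha0]
      nlinarith
    linarith
  obtain ⟨ω, hω1, hω2⟩ := hex
  refine ⟨N, ⟨fun p q => ω s(p, q) = 0 ∧ K.Adj p.1 q.1 ∧ ¬ BadV h ω p ∧ ¬ BadV h ω q,
    ⟨fun p q hpq => ?_⟩, ⟨fun p hp => ?_⟩⟩, ?_, ?_, ?_⟩
  · rw [Sym2.eq_swap]; exact ⟨hpq.1, hpq.2.1.symm, hpq.2.2.2, hpq.2.2.1⟩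
  · exact K.loopless.irrefl _ hp.2.1
  · intro p q hpq; exact hpq.2.1
  · rintro ⟨c⟩
    have : Nonempty (Fin k) := ⟨⟨0, hk⟩⟩
    have hm : ∀ p : β, ∃ i : Fin k, 2 * a ≤ (Finset.univ.filter fun x : Fin N => c (p, x) = i).card := by
      intro p
      exact Fintype.exists_le_card_fiber_of_mul_le_card (fun x : Fin N => c (p, x)) (by simp [hka])
    choose m hm using hm
    have hgood : ∀ p, a ≤ (Finset.univ.filter fun x : Fin N => c (p, x) = m p ∧ ¬ BadV h ω (p, x)).card := by
      intro p
      have h1 := cnt_and_ge (fun x : Fin N => c (p, x) = m p) (fun x => ¬ BadV h ω (p, x))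
      have h2 : cnt (fun x : Fin N => ¬ ¬ BadV h ω (p, x)) ≤ cnt (BadV h ω) := by
        refine cnt_inj_le (fun x => (p, x)) (fun x x' _ _ hx => by simpa using hx) (fun x hx => not_not.1 hx)
      have h3 := hm p
      rw [cnt_eq_card, cnt_eq_card (fun x : Fin N => c (p, x) = m p ∧ ¬ BadV h ω (p, x))] at h1
      have h3' : (2:ℝ) * a ≤ ((Finset.univ.filter fun x : Fin N => c (p, x) = m p).card : ℝ) := by exact_mod_cast h3
      have : (a:ℝ) ≤ ((Finset.univ.filter fun x : Fin N => c (p, x) = m p ∧ ¬ BadV h ω (p, x)).card : ℝ) := by linarith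
      exact_mod_cast this
    apply hK
    refine ⟨SimpleGraph.Coloring.mk m ?_⟩
    intro p q hpq hmm
    apply hω1
    refine ⟨p, q, _, _, ⟨hpq.ne, hgood p, hgood q⟩, ?_⟩
    intro i hi j hj h0
    simp only [Finset.mem_filter, Finset.mem_univ, true_and] at hi hj
    exact c.valid (v := (p, i)) (w := (q, j)) ⟨h0, hpq, hi.2, hj.2⟩ (by rw [hi.1, hj.1, hmm])
  · intro Q hQ hQh
    by_contra hc
    push Not at hc
    let φ : Fin Q.card ≃ Q := Q.equivFin.symm
    let U : SimpleGraph (β × Fin N) := ⟨fun p q => ω s(p, q) = 0 ∧ K.Adj p.1 q.1 ∧ ¬ BadV h ω p ∧ ¬ BadV h ω q,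
      ⟨fun p q hpq => by rw [Sym2.eq_swap]; exact ⟨hpq.1, hpq.2.1.symm, hpq.2.2.2, hpq.2.2.1⟩⟩,
      ⟨fun p hp => K.loopless.irrefl _ hp.2.1⟩⟩
    let ψ : Fin Q.card → β × Fin N := fun i => (φ i).1
    have hψ : Function.Injective ψ := Subtype.val_injective.comp φ.injective
    let J : SimpleGraph (Fin Q.card) := U.comap ψ
    have hdeg : ∀ i, 2 ≤ J.degree i := by
      intro i
      have h1 := hc (ψ i) (φ i).2
      have h2 : cnt (fun w => w ∈ Q ∧ U.Adj (ψ i) w) ≤ cnt (fun j => J.Adj i j) := by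
        have hh : cnt (fun w => w ∈ Q ∧ U.Adj (ψ i) w) ≤ cnt (fun w => ∃ j, ψ j = w ∧ J.Adj i j) := by
          refine cnt_mono fun w hw => ⟨φ.symm ⟨w, hw.1⟩, ?_, ?_⟩
          · simp [ψ]
          · simp only [J, SimpleGraph.comap_adj, ψ, Equiv.apply_symm_apply]; exact hw.2
        refine le_trans hh (le_trans (cnt_exists_le _) ?_)
        unfold cnt
        refine Finset.sum_le_sum fun j _ => ?_
        rw [Finset.sum_eq_single (ψ j)]
        · exact ind_mono fun h => h.2
        · intro w _ hw; exact ind_of_not fun h => hw h.1.symm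
        · simp
      rw [cnt_eq_card (fun j => J.Adj i j)] at h2
      have h3 : (1:ℝ) < ((Finset.univ.filter fun j => J.Adj i j).card : ℝ) := lt_of_lt_of_le h1 h2
      have h4 : 1 < (Finset.univ.filter fun j => J.Adj i j).card := by exact_mod_cast h3
      rw [← SimpleGraph.card_neighborFinset_eq_degree, SimpleGraph.neighborFinset_eq_filter]
      omega
    have hedge : Q.card ≤ J.edgeFinset.card := by
      have h1 := J.sum_degrees_eq_twice_card_edges
      have h2 : ∑ i : Fin Q.card, 2 ≤ ∑ i, J.degree i := Finset.sum_le_sum fun i _ => hdeg i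
      simp at h2
      omega
    obtain ⟨e, he, he'⟩ := emb_of_card J.edgeFinset Q.card hedge
    have hbad : ∀ i, BadV h ω (ψ i) := by
      intro i
      refine ⟨⟨Q.card, by omega⟩, ψ, e, i, ⟨hψ, he⟩, rfl, ?_⟩
      intro i'
      have h1 := he' i'
      generalize e i' = z at h1
      induction z with
      | _ x y =>
        rw [SimpleGraph.mem_edgeFinset, SimpleGraph.mem_edgeSet] at h1
        exact h1.1
    obtain ⟨v, hv⟩ := hQ
    have h1 := hc v hv
    obtain ⟨w, hw, hvw⟩ := cnt_exists_pos (lt_trans zero_lt_one h1)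
    apply hvw.2.2.1
    have := hbad (φ.symm ⟨v, hv⟩)
    simpa [ψ] using this

end P7b2


section P7c

lemma ncard_nbr {V : Type*} [Fintype V] (G : SimpleGraph V) (v : V) :
    ((G.neighborSet v).ncard : ℝ) = cnt (G.Adj v) := by
  classical
  rw [cnt_eq_card, Set.ncard_eq_toFinset_card']
  congr 2
  ext w
  simp

lemma thr_wrapper {α : Type*} (H : SimpleGraph α) (d0 : ℝ) (h0 : 0 < chromThreshold H)
    (h : chromThreshold H < d0) :
    ∃ C : ℕ, ∀ (V : Type) [Fintype V] (G : SimpleGraph V), ¬ ContainsCopy H G →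
      (∀ v, d0 * (Fintype.card V : ℝ) ≤ cnt (G.Adj v)) → G.Colorable C := by
  unfold chromThreshold at h h0
  set Sd := {d : ℝ | 0 < d ∧ ∃ C : ℕ, ∀ (n : ℕ) (G : SimpleGraph (Fin n)),
    ¬ ContainsCopy H G → (∀ v, d * n ≤ ((G.neighborSet v).ncard : ℝ)) →
    G.chromaticNumber ≤ (C : ℕ∞) } with hSd
  have hne : Sd.Nonempty := by
    by_contra hc
    rw [Set.not_nonempty_iff_eq_empty] at hc
    rw [hc, Real.sInf_empty] at h0
    exact lt_irrefl _ h0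
  obtain ⟨d, ⟨hd0, C, hC⟩, hd⟩ := exists_lt_of_csInf_lt hne h
  refine ⟨C, fun V _ G hG hdeg => ?_⟩
  let e := Fintype.equivFin V
  let G' : SimpleGraph (Fin (Fintype.card V)) := G.comap e.symm
  have h1 : G'.chromaticNumber ≤ (C : ℕ∞) := by
    apply hC
    · rintro ⟨f, hf, hf'⟩
      exact hG ⟨fun a => e.symm (f a), e.symm.injective.comp hf, fun a b hab => hf' hab⟩
    · intro v
      rw [ncard_nbr]
      have h2 : cnt (G'.Adj v) = cnt (G.Adj (e.symm v)) := by
        rw [← cnt_equiv e.symm (G.Adj (e.symm v))]; rfl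
      rw [h2]
      refine le_trans ?_ (hdeg _)
      gcongr
  rw [SimpleGraph.chromaticNumber_le_iff_colorable] at h1
  obtain ⟨c⟩ := h1
  refine ⟨SimpleGraph.Coloring.mk (fun v => c (e v)) ?_⟩
  intro v w hvw
  apply c.valid
  simpa [G'] using hvw

lemma cnt_sum {X Y : Type*} [Fintype X] [Fintype Y] (p : X ⊕ Y → Prop) :
    cnt p = cnt (fun x => p (Sum.inl x)) + cnt (fun y => p (Sum.inr y)) := by
  unfold cnt; rw [Fintype.sum_sum_type]

abbrev BV (s y M m z t N : ℕ) : Type :=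
  (Fin s × Fin y) ⊕ (((Fin M → Bool) × Fin m) ⊕ (Fin z ⊕ (Tup t M × Fin N)))

def bigAdj {s y M m z t N : ℕ} (U : SimpleGraph (Tup t M × Fin N)) : BV s y M m z t N → BV s y M m z t N → Prop
  | Sum.inl p, Sum.inl p' => p.1 ≠ p'.1
  | Sum.inl _, Sum.inr _ => True
  | Sum.inr _, Sum.inl _ => True
  | Sum.inr (Sum.inl _), Sum.inr (Sum.inl _) => False
  | Sum.inr (Sum.inl _), Sum.inr (Sum.inr (Sum.inl _)) => True
  | Sum.inr (Sum.inr (Sum.inl _)), Sum.inr (Sum.inl _) => True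
  | Sum.inr (Sum.inl c), Sum.inr (Sum.inr (Sum.inr u)) => Okc u.1.1 c.1
  | Sum.inr (Sum.inr (Sum.inr u)), Sum.inr (Sum.inl c) => Okc u.1.1 c.1
  | Sum.inr (Sum.inr (Sum.inl _)), Sum.inr (Sum.inr (Sum.inl _)) => False
  | Sum.inr (Sum.inr (Sum.inl _)), Sum.inr (Sum.inr (Sum.inr _)) => False
  | Sum.inr (Sum.inr (Sum.inr _)), Sum.inr (Sum.inr (Sum.inl _)) => False
  | Sum.inr (Sum.inr (Sum.inr u)), Sum.inr (Sum.inr (Sum.inr u')) => U.Adj u u'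

def bigG {s y M m z t N : ℕ} (U : SimpleGraph (Tup t M × Fin N)) : SimpleGraph (BV s y M m z t N) where
  Adj := bigAdj U
  symm := ⟨by
    rintro (p | p | p | p) (q | q | q | q) h <;> simp only [bigAdj] at h ⊢
    · exact h.symm
    · exact h
    · exact h
    · exact h.symm⟩
  loopless := ⟨by
    rintro (p | p | p | p) h <;> simp only [bigAdj] at h
    · exact h rfl
    · exact U.loopless.irrefl _ h⟩

lemma big_nondeg {s M t N q0 w y m z T : ℕ} (U : SimpleGraph (Tup t M × Fin N)) (hT : T = 2 ^ t)
    (hw : Fintype.card (Tup t M × Fin N) + 1 = w) (hq0 : q0 = 2 ^ M * w)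
    (hy : y = (8 * T - 1) * q0) (hm : m = 4 * T * w) (hz : z = 4 * T * q0) (v : BV s y M m z t N) :
    cnt (fun x => ¬ (bigG U).Adj v x) ≤ (8 * (T:ℝ) - 1) * q0 := by
  classical
  have hT1 : 1 ≤ T := hT ▸ Nat.one_le_two_pow
  have hyR : (y:ℝ) = (8 * (T:ℝ) - 1) * q0 := by
    rw [hy, Nat.cast_mul, Nat.cast_sub (by omega)]; push_cast; ring
  have hmR : (m:ℝ) = 4 * T * w := by rw [hm]; push_cast; ring
  have hzR : (z:ℝ) = 4 * T * q0 := by rw [hz]; push_cast; ring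
  have hqR : (q0:ℝ) = 2 ^ M * w := by rw [hq0]; push_cast; ring
  have hTR : (T:ℝ) = 2 ^ t := by rw [hT]; push_cast; ring
  have hT1R : (1:ℝ) ≤ T := by exact_mod_cast hT1
  have hwq : (w:ℝ) ≤ q0 := by
    have : (1:ℝ) ≤ 2 ^ M := one_le_pow₀ (by norm_num)
    have hw0 : (0:ℝ) ≤ w := by positivity
    rw [hqR]; nlinarith
  have hU : (Fintype.card (Tup t M × Fin N) : ℝ) ≤ w := by rw [← hw]; push_cast; linarith
  have hq00 : (0:ℝ) ≤ q0 := by positivity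
  have hTq : (q0:ℝ) ≤ T * q0 := by nlinarith
  have cF : ∀ (X : Type) [Fintype X], cnt (fun _ : X => ¬ True) = 0 := by
    intro X _; unfold cnt; simp [ind]
  have cF2 : ∀ (X : Type) [Fintype X], cnt (fun _ : X => ¬ False) = (Fintype.card X : ℝ) := by
    intro X _; unfold cnt; simp [ind]
  have hS : (Fintype.card ((Fin M → Bool) × Fin m) : ℝ) = 4 * T * q0 := by
    rw [Fintype.card_prod, Fintype.card_fun]; simp only [Fintype.card_bool, Fintype.card_fin]
    push_cast; rw [hmR, hqR]; ring
  rw [cnt_sum, cnt_sum, cnt_sum]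
  rcases v with p | p | p | p <;> simp only [bigG, bigAdj, cF, cF2, Fintype.card_fin, hS]
  · have : cnt (fun x : Fin s × Fin y => ¬ p.1 ≠ x.1) ≤ y := by
      have h1 := cnt_inj_le (p := fun x : Fin s × Fin y => ¬ p.1 ≠ x.1) (q := fun _ : Fin y => True) (fun x => x.2)
        (fun x x' hx hx' hxx => Prod.ext ((not_not.1 hx).symm.trans (not_not.1 hx')) hxx) (fun _ _ => trivial)
      rw [cnt_true, Fintype.card_fin] at h1
      exact h1
    rw [← hyR]; linarith
  · have := cnt_le_card (fun y : Tup t M × Fin N => ¬ Okc y.1.1 p.1)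
    linarith
  · linarith
  · have h1 := cnt_le_card (fun y : Tup t M × Fin N => ¬ U.Adj p y)
    have h2 : cnt (fun y : (Fin M → Bool) × Fin m => ¬ Okc p.1.1 y.1) = 4 * T * q0 - 4 * q0 := by
      rw [cnt_not, hS, cnt_prod_right]
      simp only [Finset.sum_const, Finset.card_univ, Fintype.card_fin, nsmul_eq_mul]
      have := okc_count p.1
      have h3 : (m:ℝ) * cnt (Okc p.1.1) = 4 * q0 := by
        rw [hmR, hTR, hqR, ← this]; ring
      rw [h3]
    rw [h2, hzR]
    linarith

end P7c


section P7d

lemma big_exists {α : Type*} [Fintype α] (H : SimpleGraph α) (s h : ℕ) (hs : 1 ≤ s)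
    (hthr : chromThreshold H = (s:ℝ) / (s + 1)) :
    ∃ (y M m z N : ℕ) (U : SimpleGraph (Tup (4*h+1) M × Fin N)),
      (∀ p q, U.Adj p q → (shiftG (4*h+1) M).Adj p.1 q.1) ∧
      (∀ Q : Finset (Tup (4*h+1) M × Fin N), Q.Nonempty → Q.card ≤ h →
        ∃ v ∈ Q, cnt (fun w => w ∈ Q ∧ U.Adj v w) ≤ 1) ∧
      ContainsCopy H (bigG U : SimpleGraph (BV s y M m z (4*h+1) N)) := by
  classical
  have hsR : (1:ℝ) ≤ s := by exact_mod_cast hs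
  set T := 2 ^ (4*h+1) with hT
  have hT1 : 1 ≤ T := Nat.one_le_two_pow
  have hT1R : (1:ℝ) ≤ T := by exact_mod_cast hT1
  set A : ℝ := 8 * (T:ℝ) - 1 with hA
  have hA0 : 0 < A := by linarith
  have hden : 0 < ((s:ℝ) + 1) * A + 1 := by positivity
  set d0 : ℝ := 1 - A / (((s:ℝ) + 1) * A + 1) with hd0
  have hd0' : (s:ℝ) / (s + 1) < d0 := by
    have h1 : A / (((s:ℝ) + 1) * A + 1) < 1 / (s + 1) := by
      rw [div_lt_div_iff₀ hden (by positivity)]; linarith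
    have h2 : (s:ℝ) / (s + 1) = 1 - 1 / (s + 1) := by field_simp; ring
    rw [h2, hd0]; linarith
  obtain ⟨C, hC⟩ := thr_wrapper H d0 (by rw [hthr]; positivity) (by rw [hthr]; exact hd0')
  obtain ⟨M, hM, -⟩ := shift_not_colorable (4*h) (max C 1)
  obtain ⟨N, U, hU1, hU2, hU3⟩ := lift_graph (shiftG (4*h+1) M) (max C 1) h (le_max_right _ _) hM
  obtain ⟨w, hw⟩ : ∃ w, Fintype.card (Tup (4*h+1) M × Fin N) + 1 = w := ⟨_, rfl⟩
  obtain ⟨q0, hq0⟩ : ∃ q0, q0 = 2 ^ M * w := ⟨_, rfl⟩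
  obtain ⟨y, hy⟩ : ∃ y, y = (8 * T - 1) * q0 := ⟨_, rfl⟩
  obtain ⟨m, hm⟩ : ∃ m, m = 4 * T * w := ⟨_, rfl⟩
  obtain ⟨z, hz⟩ : ∃ z, z = 4 * T * q0 := ⟨_, rfl⟩
  refine ⟨y, M, m, z, N, U, hU1, hU3, ?_⟩
  by_contra hno
  have hcol : (bigG U : SimpleGraph (BV s y M m z (4*h+1) N)).Colorable C := by
    refine hC _ _ hno ?_
    intro v
    have h1 := big_nondeg U hT hw hq0 hy hm hz v
    rw [cnt_not, ← hA] at h1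
    have h2 : (((s:ℝ) + 1) * A + 1) * q0 ≤ (Fintype.card (BV s y M m z (4*h+1) N) : ℝ) := by
      have hyR : (y:ℝ) = A * q0 := by
        rw [hy, Nat.cast_mul, Nat.cast_sub (by omega), hA]; push_cast; ring
      rw [Fintype.card_sum, Fintype.card_sum, Fintype.card_sum, Fintype.card_prod, Fintype.card_prod,
        Fintype.card_fun]
      simp only [Fintype.card_bool, Fintype.card_fin]
      push_cast
      rw [hyR, hm, hz]
      push_cast
      have hqR : (q0:ℝ) = 2 ^ M * w := by rw [hq0]; push_cast; ring
      have h3 : (2:ℝ) ^ M * (4 * T * w) = 4 * T * q0 := by rw [hqR]; ring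
      rw [h3]
      have h4 : (0:ℝ) ≤ (Fintype.card (Tup (4*h+1) M × Fin N) : ℝ) := by positivity
      rw [Fintype.card_prod, Fintype.card_fin] at h4
      push_cast at h4
      have h5 : (8:ℝ) * T = A + 1 := by rw [hA]; ring
      have h6 : 4 * (T:ℝ) * q0 + 4 * T * q0 = (A + 1) * q0 := by rw [← h5]; ring
      nlinarith
    have h3 : A * q0 ≤ A / (((s:ℝ) + 1) * A + 1) * (Fintype.card (BV s y M m z (4*h+1) N) : ℝ) := by
      rw [div_mul_eq_mul_div, le_div_iff₀ hden]
      nlinarith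
    rw [hd0]
    linarith
  apply hU2
  obtain ⟨c⟩ := hcol
  have : U.Colorable C := ⟨SimpleGraph.Coloring.mk (fun u => c (Sum.inr (Sum.inr (Sum.inr u)))) (by
    intro u v huv
    exact c.valid (v := Sum.inr (Sum.inr (Sum.inr u))) (w := Sum.inr (Sum.inr (Sum.inr v))) huv)⟩
  exact this.mono (le_max_left _ _)

lemma forest_exists {α : Type*} [Fintype α] (H : SimpleGraph α) : ∀ (n : ℕ) (F : Finset α), F.card = n →
    (∀ Q ⊆ F, Q.Nonempty → ∃ v ∈ Q, cnt (fun w => w ∈ Q ∧ H.Adj v w) ≤ 1) →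
    ∃ (par comp : α → α) (dep : α → ℕ), ForestOn H (fun t => t ∈ F) par comp dep ∧
      (∀ t ∈ F, dep t ≠ 0 → H.Adj t (par t)) ∧ ∀ t ∈ F, dep t < n := by
  classical
  intro n
  induction n with
  | zero =>
    intro F hF _
    rw [Finset.card_eq_zero] at hF
    subst hF
    exact ⟨id, id, fun _ => 0, ⟨by simp, by simp, by simp, by simp⟩, by simp, by simp⟩
  | succ n ih =>
    intro F hF hQ
    have hne : F.Nonempty := by rw [← Finset.card_pos]; omega
    obtain ⟨v, hvF, hv⟩ := hQ F (Finset.Subset.refl _) hne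
    have hcard : (F.erase v).card = n := by rw [Finset.card_erase_of_mem hvF]; omega
    obtain ⟨par, comp, dep, hFo, hadj, hdep⟩ := ih (F.erase v) hcard
      (fun Q hQ' hne => hQ Q (hQ'.trans (Finset.erase_subset _ _)) hne)
    have huniq : ∀ w w', w ∈ F → w' ∈ F → H.Adj v w → H.Adj v w' → w = w' := by
      intro w w' hw hw' hvw hvw'
      rw [cnt_eq_card] at hv
      have hv' : (Finset.univ.filter fun w => w ∈ F ∧ H.Adj v w).card ≤ 1 := by exact_mod_cast hv
      exact Finset.card_le_one.1 hv' w (by simp [hw, hvw]) w' (by simp [hw', hvw'])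
    have hmem : ∀ t, t ∈ F.erase v ↔ t ≠ v ∧ t ∈ F := fun t => Finset.mem_erase
    obtain ⟨hroot, hzero, hstep, hedge⟩ := hFo
    by_cases hw : ∃ w ∈ F, H.Adj v w
    · obtain ⟨w, hwF, hvw⟩ := hw
      have hwv : w ≠ v := hvw.ne'
      have hwE : w ∈ F.erase v := (hmem w).2 ⟨hwv, hwF⟩
      refine ⟨Function.update par v w, Function.update comp v (comp w), Function.update dep v (dep w + 1),
        ⟨?_, ?_, ?_, ?_⟩, ?_, ?_⟩
      · intro t ht
        by_cases htv : t = v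
        · subst htv
          obtain ⟨a1, a2, a3⟩ := hroot w hwE
          have := (hmem _).1 a1
          simp only [Function.update_self, Function.update_of_ne this.1]
          exact ⟨this.2, a2, a3⟩
        · obtain ⟨a1, a2, a3⟩ := hroot t ((hmem t).2 ⟨htv, ht⟩)
          have := (hmem _).1 a1
          simp only [Function.update_of_ne htv, Function.update_of_ne this.1]
          exact ⟨this.2, a2, a3⟩
      · intro t ht h0
        by_cases htv : t = v
        · subst htv; simp at h0
        · simp only [Function.update_of_ne htv] at h0 ⊢
          exact hzero t ((hmem t).2 ⟨htv, ht⟩) h0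
      · intro t ht h0
        by_cases htv : t = v
        · subst htv
          simp only [Function.update_self, Function.update_of_ne hwv]
          exact ⟨hwF, trivial, trivial⟩
        · simp only [Function.update_of_ne htv] at h0 ⊢
          obtain ⟨a1, a2, a3⟩ := hstep t ((hmem t).2 ⟨htv, ht⟩) h0
          have := (hmem _).1 a1
          simp only [Function.update_of_ne this.1]
          exact ⟨this.2, a2, a3⟩
      · intro t t' ht ht' hadj'
        by_cases htv : t = v
        · subst htv
          left
          simp only [Function.update_self]
          exact ⟨by omega, huniq _ _ hwF ht' hvw hadj'⟩
        · by_cases htv' : t' = v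
          · subst htv'
            right
            simp only [Function.update_self]
            exact ⟨by omega, huniq _ _ hwF ht hvw hadj'.symm⟩
          · simp only [Function.update_of_ne htv, Function.update_of_ne htv']
            exact hedge t t' ((hmem t).2 ⟨htv, ht⟩) ((hmem t').2 ⟨htv', ht'⟩) hadj'
      · intro t ht h0
        by_cases htv : t = v
        · subst htv; simpa using hvw
        · simp only [Function.update_of_ne htv] at h0 ⊢
          exact hadj t ((hmem t).2 ⟨htv, ht⟩) h0
      · intro t ht
        by_cases htv : t = v
        · subst htv; have := hdep w hwE; simp; omega
        · have := hdep t ((hmem t).2 ⟨htv, ht⟩)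
          simp only [Function.update_of_ne htv]; omega
    · push Not at hw
      refine ⟨par, Function.update comp v v, Function.update dep v 0,
        ⟨?_, ?_, ?_, ?_⟩, ?_, ?_⟩
      · intro t ht
        by_cases htv : t = v
        · subst htv
          simp only [Function.update_self]
          exact ⟨ht, trivial, trivial⟩
        · obtain ⟨a1, a2, a3⟩ := hroot t ((hmem t).2 ⟨htv, ht⟩)
          have := (hmem _).1 a1
          simp only [Function.update_of_ne htv, Function.update_of_ne this.1]
          exact ⟨this.2, a2, a3⟩
      · intro t ht h0
        by_cases htv : t = v
        · subst htv; simp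
        · simp only [Function.update_of_ne htv] at h0 ⊢
          exact hzero t ((hmem t).2 ⟨htv, ht⟩) h0
      · intro t ht h0
        by_cases htv : t = v
        · subst htv
          simp at h0
        · simp only [Function.update_of_ne htv] at h0 ⊢
          obtain ⟨a1, a2, a3⟩ := hstep t ((hmem t).2 ⟨htv, ht⟩) h0
          have := (hmem _).1 a1
          simp only [Function.update_of_ne this.1]
          exact ⟨this.2, a2, a3⟩
      · intro t t' ht ht' hadj'
        by_cases htv : t = v
        · subst htv
          exact (hw _ ht' hadj').elim
        · by_cases htv' : t' = v
          · subst htv'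
            exact (hw _ ht hadj'.symm).elim
          · simp only [Function.update_of_ne htv, Function.update_of_ne htv']
            exact hedge t t' ((hmem t).2 ⟨htv, ht⟩) ((hmem t').2 ⟨htv', ht'⟩) hadj'
      · intro t ht h0
        by_cases htv : t = v
        · subst htv; simp at h0
        · simp only [Function.update_of_ne htv] at h0 ⊢
          exact hadj t ((hmem t).2 ⟨htv, ht⟩) h0
      · intro t ht
        by_cases htv : t = v
        · subst htv; simp
        · have := hdep t ((hmem t).2 ⟨htv, ht⟩)
          simp only [Function.update_of_ne htv]; omega

def bigCol {s y M m z t N : ℕ} : BV s y M m z t N → Option (Fin (s+1))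
  | Sum.inl p => some p.1.castSucc
  | Sum.inr (Sum.inl _) => some (Fin.last s)
  | Sum.inr (Sum.inr _) => none

lemma extract {α : Type*} [Fintype α] (H : SimpleGraph α) (s : ℕ) (hs : 1 ≤ s)
    (hthr : chromThreshold H = (s:ℝ) / (s + 1)) :
    ∃ (col : α → Option (Fin (s+1))) (par comp : α → α) (dep : α → ℕ),
      (∀ a a' i j, H.Adj a a' → col a = some i → col a' = some j → i ≠ j) ∧
      ForestOn H (fun t => col t = none) par comp dep ∧
      ∀ b t t' i, H.Adj b t → H.Adj b t' → col b = some i → (decide (i.1 < s)) = false →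
        col t = none → col t' = none → comp t = comp t' → (Even (dep t) ↔ Even (dep t')) := by
  classical
  obtain ⟨h, hh⟩ : ∃ h, h = Fintype.card α := ⟨_, rfl⟩
  obtain ⟨y, M, m, z, N, U, hU1, hU2, f, hf, hf'⟩ := big_exists H s h hs hthr
  let F : Finset α := Finset.univ.filter fun a => bigCol (f a) = none
  have hFcase : ∀ t ∈ F, (∃ x, f t = Sum.inr (Sum.inr (Sum.inl x))) ∨ ∃ u, f t = Sum.inr (Sum.inr (Sum.inr u)) := by
    intro t ht
    have ht' : bigCol (f t) = none := by simpa [F] using ht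
    rcases hft : f t with p | p | p | p
    · rw [hft] at ht'; simp [bigCol] at ht'
    · rw [hft] at ht'; simp [bigCol] at ht'
    · exact Or.inl ⟨p, rfl⟩
    · exact Or.inr ⟨p, rfl⟩
  have hadjU : ∀ t ∈ F, ∀ t' ∈ F, H.Adj t t' → ∃ u u', f t = Sum.inr (Sum.inr (Sum.inr u)) ∧
      f t' = Sum.inr (Sum.inr (Sum.inr u')) ∧ U.Adj u u' := by
    intro t ht t' ht' hadj
    have h1 := hf' hadj
    rcases hFcase t ht with ⟨x, hx⟩ | ⟨u, hu⟩ <;> rcases hFcase t' ht' with ⟨x', hx'⟩ | ⟨u', hu'⟩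
    · rw [hx, hx'] at h1; exact h1.elim
    · rw [hx, hu'] at h1; exact h1.elim
    · rw [hu, hx'] at h1; exact h1.elim
    · rw [hu, hu'] at h1; exact ⟨u, u', hu, hu', h1⟩
  have hsparse : ∀ Q ⊆ F, Q.Nonempty → ∃ v ∈ Q, cnt (fun w => w ∈ Q ∧ H.Adj v w) ≤ 1 := by
    intro Q hQF hQ
    by_cases hz : ∃ v ∈ Q, ∃ x, f v = Sum.inr (Sum.inr (Sum.inl x))
    · obtain ⟨v, hv, x, hx⟩ := hz
      refine ⟨v, hv, ?_⟩
      have : cnt (fun w => w ∈ Q ∧ H.Adj v w) = 0 := by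
        unfold cnt
        refine Finset.sum_eq_zero fun w _ => ind_of_not ?_
        rintro ⟨hw, hvw⟩
        obtain ⟨u, u', h1, -, -⟩ := hadjU v (hQF hv) w (hQF hw) hvw
        rw [hx] at h1
        simp at h1
      rw [this]; norm_num
    · push Not at hz
      have hall : ∀ v : Q, ∃ u, f v.1 = Sum.inr (Sum.inr (Sum.inr u)) := by
        intro v
        rcases hFcase v.1 (hQF v.2) with ⟨x, hx⟩ | h2
        · exact (hz v.1 v.2 x hx).elim
        · exact h2
      choose g hg using hall
      obtain ⟨v', hv', hle⟩ := hU2 (Finset.univ.image g) (by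
          obtain ⟨a, ha⟩ := hQ
          exact ⟨g ⟨a, ha⟩, by simp⟩) (by
          refine le_trans Finset.card_image_le ?_
          rw [Finset.card_univ, Fintype.card_coe]
          rw [hh]
          exact Finset.card_le_univ _)
      simp only [Finset.mem_image, Finset.mem_univ, true_and] at hv'
      obtain ⟨v, rfl⟩ := hv'
      refine ⟨v.1, v.2, le_trans ?_ hle⟩
      have hgi : Function.Injective g := by
        intro a b hab
        apply Subtype.ext
        apply hf
        rw [hg, hg, hab]
      refine cnt_inj_le (fun w => if hw : w ∈ Q then g ⟨w, hw⟩ else g v) ?_ ?_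
      · intro x x' hx hx' hxx
        simp only [hx.1, hx'.1, dif_pos] at hxx
        simpa using hgi hxx
      · intro x hx
        simp only [hx.1, dif_pos]
        refine ⟨by simp, ?_⟩
        have := hf' hx.2
        rw [hg v, hg ⟨x, hx.1⟩] at this
        exact this
  obtain ⟨par, comp, dep, hFo, hpar, hdep⟩ := forest_exists H F.card F rfl hsparse
  have hFh : F.card ≤ h := hh ▸ Finset.card_le_univ _
  have hFiff : ∀ t, t ∈ F ↔ bigCol (f t) = none := fun t => by simp [F]
  have hFo' := hFo
  simp only [hFiff] at hFo'
  refine ⟨fun a => bigCol (f a), par, comp, dep, ?_, hFo', ?_⟩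
  · intro a a' i j haa hi hj hij
    have h1 := hf' haa
    rcases hfa : f a with p | p | p <;> rcases hfa' : f a' with p' | p' | p' <;>
      simp only [hfa, hfa', bigCol, Option.some.injEq, reduceCtorEq] at hi hj h1
    · rw [← hij, ← hi] at hj
      exact h1 (Fin.castSucc_injective _ hj).symm
    · rw [← hij, ← hi] at hj
      exact (Fin.castSucc_lt_last p.1).ne hj.symm
    · rw [← hij, ← hi] at hj
      exact (Fin.castSucc_lt_last p'.1).ne hj
    · exact h1
  · have hchain : ∀ n t, t ∈ F → dep t = n → ∀ u, f t = Sum.inr (Sum.inr (Sum.inr u)) →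
        ∃ u0, f (comp t) = Sum.inr (Sum.inr (Sum.inr u0)) ∧ Sh n u.1.1 u0.1.1 ∧ Sh n u0.1.1 u.1.1 := by
      intro n
      induction n with
      | zero =>
        intro t ht h0 u hu
        rw [hFo.zero t ht h0]
        exact ⟨u, hu, Sh.refl _, Sh.refl _⟩
      | succ n ih =>
        intro t ht h0 u hu
        obtain ⟨a1, a2, a3⟩ := hFo.step t ht (by omega)
        obtain ⟨u1, u', h1, h2, h3⟩ := hadjU t ht (par t) a1 (hpar t ht (by omega))
        have hu1 : u1 = u := by
          rw [hu] at h1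
          simpa using h1.symm
        subst hu1
        obtain ⟨u0, b1, b2, b3⟩ := ih (par t) a1 (by omega) u' h2
        rw [a3] at b1
        have c1 := Sh.of_adj (hU1 _ _ h3)
        have c2 := Sh.of_adj (hU1 _ _ h3.symm)
        refine ⟨u0, b1, ?_, b3.comp c2⟩
        rw [add_comm n 1]
        exact c1.comp b2
    have hU : ∀ t ∈ F, dep t ≠ 0 → ∃ u, f t = Sum.inr (Sum.inr (Sum.inr u)) := by
      intro t ht h0
      obtain ⟨u, u', h1, -, -⟩ := hadjU t ht (par t) (hFo.step t ht h0).1 (hpar t ht h0)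
      exact ⟨u, h1⟩
    have key : ∀ b t t' i, H.Adj b t → H.Adj b t' → bigCol (f b) = some i → (decide (i.1 < s)) = false →
        t ∈ F → t' ∈ F → comp t = comp t' → dep t ≠ 0 → (Even (dep t) ↔ Even (dep t')) := by
      intro b t t' i hbt hbt' hb hi ht ht' hcomp h0
      by_contra hne
      obtain ⟨u, hu⟩ := hU t ht h0
      obtain ⟨u0, b1, b2, b3⟩ := hchain _ t ht rfl u hu
      have hu' : ∃ u', f t' = Sum.inr (Sum.inr (Sum.inr u')) := by
        by_cases h0' : dep t' = 0
        · refine ⟨u0, ?_⟩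
          rw [← b1, hcomp, hFo.zero t' ht' h0']
        · exact hU t' ht' h0'
      obtain ⟨u', hu'⟩ := hu'
      obtain ⟨u0', c1, c2, c3⟩ := hchain _ t' ht' rfl u' hu'
      have he : u0' = u0 := by
        rw [← hcomp, b1] at c1
        simpa using c1.symm
      subst he
      have hsh := b2.comp c3
      have d1 := hdep t ht
      have d2 := hdep t' ht'
      have e1 := hf' hbt
      have e2 := hf' hbt'
      have hodd : (dep t + dep t') % 2 = 1 := by
        rw [Nat.even_iff, Nat.even_iff] at hne
        omega
      rcases hfb : f b with p | p | p
      · rw [hfb] at hb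
        simp only [bigCol, Option.some.injEq] at hb
        rw [← hb] at hi
        simp at hi
      · rw [hfb, hu] at e1
        rw [hfb, hu'] at e2
        exact hsh.no_common hodd (by omega) p.1 e1 e2
      · rw [hfb] at hb
        simp [bigCol] at hb
    intro b t t' i hbt hbt' hb hi ht ht' hcomp
    by_cases h0 : dep t = 0
    · by_cases h0' : dep t' = 0
      · rw [h0, h0']
      · exact (key b t' t i hbt' hbt hb hi ((hFiff _).2 ht') ((hFiff _).2 ht) hcomp.symm h0').symm
    · exact key b t t' i hbt hbt' hb hi ((hFiff _).2 ht) ((hFiff _).2 ht') hcomp h0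

end P7d


section P8

universe u8

lemma edge_sum {V : Type*} [Fintype V] (G : SimpleGraph V) :
    ∑ v, cnt (G.Adj v) = 2 * (G.edgeSet.ncard : ℝ) := by
  classical
  have h1 := G.sum_degrees_eq_twice_card_edges
  have h2 : ∀ v, cnt (G.Adj v) = (G.degree v : ℝ) := by
    intro v
    rw [← ncard_nbr, Set.ncard_eq_toFinset_card', SimpleGraph.degree, SimpleGraph.neighborFinset]
  simp only [h2]
  rw [Set.ncard_eq_toFinset_card']
  have h3 : ((∑ v, G.degree v : ℕ) : ℝ) = ((2 * G.edgeFinset.card : ℕ) : ℝ) := by rw [h1]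
  push_cast at h3
  rw [h3, SimpleGraph.edgeFinset]

lemma rich_data {α : Type*} (H : SimpleGraph α) (q : ℕ) (hH : H.Colorable (q+1)) :
    ∃ col : α → Option (Fin q), (∀ a a' i j, H.Adj a a' → col a = some i → col a' = some j → i ≠ j) ∧
      ForestOn H (fun t => col t = none) id id (fun _ => 0) := by
  obtain ⟨c⟩ := hH
  refine ⟨fun a => if h : (c a).1 < q then some ⟨(c a).1, h⟩ else none, ?_, ⟨?_, ?_, ?_, ?_⟩⟩
  · intro a a' i j hadj hi hj hij
    have h1 := c.valid hadj
    simp only [Option.dite_none_right_eq_some, Option.some.injEq] at hi hj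
    obtain ⟨h2, h3⟩ := hi
    obtain ⟨h4, h5⟩ := hj
    apply h1
    apply Fin.ext
    rw [hij, ← h5] at h3
    simpa using h3
  · intro t ht; exact ⟨ht, rfl, rfl⟩
  · intro t _ _; rfl
  · intro t _ h; exact (h rfl).elim
  · intro t t' ht ht' hadj
    have h1 := c.valid hadj
    simp only [dite_eq_right_iff, reduceCtorEq, imp_false, not_lt] at ht ht'
    exfalso
    apply h1
    apply Fin.ext
    have := (c t).2
    have := (c t').2
    omega

lemma kr_copy {α : Type*} [Fintype α] (H : SimpleGraph α) (q : ℕ) (hH : H.Colorable (q+1)) (η : ℝ) (hη : 0 < η) :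
    ∃ n0 : ℕ, ∀ {V : Type u8} [Fintype V] (G : SimpleGraph V), n0 ≤ Fintype.card V →
      η * (Fintype.card V : ℝ) ^ (q+1) ≤ cnt (Cliq G (q+1)) → ContainsCopy H G := by
  classical
  obtain ⟨c⟩ := hH
  set e := η ^ (Fintype.card α ^ (q+1)) with he
  have he0 : 0 < e := by positivity
  obtain ⟨n0, hn0⟩ := exists_nat_gt ((Fintype.card α : ℝ) ^ 2 / e)
  refine ⟨n0, fun {V} _ G hn hc => ?_⟩
  have hn' : (n0:ℝ) ≤ (Fintype.card V : ℝ) := by exact_mod_cast hn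
  have h1 := blowup_col G (q+1) (fun a : α => some (c a)) (fun _ _ => True) η hη.le (by
    refine le_trans hc (cnt_mono fun κ hκ => ⟨hκ, fun _ => trivial⟩))
  obtain ⟨ω, hω, hi, -⟩ := inj_avoid _ e ∅ h1 (by
    rw [div_lt_iff₀ he0] at hn0
    simp only [Finset.card_empty, Nat.cast_zero, mul_zero, add_zero]
    nlinarith)
  exact ⟨ω, hi, fun a b hab => hω.1 a b _ _ rfl rfl (c.valid hab)⟩

end P8

theorem stmt_2 {α : Type*} [Fintype α] (H : SimpleGraph α) (r : ℕ) (hr : 4 ≤ r)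
    (hchi : H.chromaticNumber = (r : ℕ∞))
    (hthr : chromThreshold H = ((r : ℝ) - 3) / ((r : ℝ) - 2))
    (δ : ℝ) (hδl : ((r : ℝ) - 3) / ((r : ℝ) - 1) ≤ δ)
    (hδu : δ ≤ ((r : ℝ) - 3) / ((r : ℝ) - 2))
    (ε : ℝ) (hε : 0 < ε) :
    ∃ (C : ℕ) (n₀ : ℕ), ∀ n : ℕ, n₀ ≤ n → ∀ G : SimpleGraph (Fin n),
      ¬ ContainsCopy H G →
      (∀ v, δ * n ≤ ((G.neighborSet v).ncard : ℝ)) →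
      ((δ * (1 - δ) + (1 - δ) ^ 2 / 4 + ((r : ℝ) - 4) * δ ^ 2 / (2 * ((r : ℝ) - 3))) + ε) * n ^ 2
        < (G.edgeSet.ncard : ℝ) →
      G.chromaticNumber ≤ (C : ℕ∞) := by
  classical
  obtain ⟨s, rfl⟩ : ∃ s, r = s + 3 := ⟨r - 3, by omega⟩
  have hs : 1 ≤ s := by omega
  have hcast : ((s + 3 : ℕ) : ℝ) = (s:ℝ) + 3 := by push_cast; ring
  rw [hcast] at hthr hδl hδu
  simp only [hcast]
  have r1 : (s:ℝ) + 3 - 3 = s := by ring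
  have r2 : (s:ℝ) + 3 - 2 = s + 1 := by ring
  have r3 : (s:ℝ) + 3 - 1 = s + 2 := by ring
  have r4 : (s:ℝ) + 3 - 4 = s - 1 := by ring
  rw [r1, r2] at hthr hδu
  rw [r1, r3] at hδl
  simp only [r1, r4]
  have hHcol : H.Colorable (s + 2 + 1) := by
    rw [← SimpleGraph.chromaticNumber_le_iff_colorable, hchi]
  obtain ⟨η, hη, hη1, hsamp⟩ := sampling.{0} s hs δ ε hδl hδu hε
  obtain ⟨n1, hn1⟩ := kr_copy.{0} H (s+2) hHcol η hη
  obtain ⟨colR, hR1, hR2⟩ := rich_data H (s+2) hHcol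
  obtain ⟨K2, n2, hn2⟩ := embed H (s+2) colR (fun _ => false) hR1 id id (fun _ => 0) hR2
    (fun _ _ _ _ _ _ _ _ _ _ _ => Iff.rfl) η hη hη1
  obtain ⟨colG, par, comp, dep, hG1, hG2, hG3⟩ := extract H s hs hthr
  obtain ⟨K3, n3, hn3⟩ := embed H (s+1) colG (fun i => decide (i.1 < s)) hG1 par comp dep hG2 hG3 η hη hη1
  refine ⟨K2 * K3, n1 + n2 + n3 + 1, fun n hn G hfree hdeg hedges => ?_⟩
  have : Nonempty (Fin n) := ⟨⟨0, by omega⟩⟩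
  have hs2 := hsamp G (by
      intro v
      rw [Fintype.card_fin, ← ncard_nbr]
      exact hdeg v) (by
      rw [edge_sum, Fintype.card_fin]
      linarith)
  rw [SimpleGraph.chromaticNumber_le_iff_colorable]
  let D2 : SimpleGraph (Fin n) := SimpleGraph.fromRel fun x y => G.Adj x y ∧
    η * (Fintype.card (Fin n) : ℝ) ^ (s+2) ≤ cnt (CliqTy G (s+2) (fun _ => false) x y)
  let D3 : SimpleGraph (Fin n) := SimpleGraph.fromRel fun x y => G.Adj x y ∧
    η * (Fintype.card (Fin n) : ℝ) ^ (s+1) ≤ cnt (CliqTy G (s+1) (fun i => decide (i.1 < s)) x y)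
  have hsymm : ∀ q (τ : Fin q → Bool) (x y : Fin n), cnt (CliqTy G q τ x y) = cnt (CliqTy G q τ y x) := by
    intro q τ x y
    refine cnt_congr fun κ => ?_
    unfold CliqTy
    refine and_congr_right fun _ => forall_congr' fun i => ?_
    tauto
  have hD2 : D2.Colorable K2 := by
    by_contra hc
    obtain ⟨f, hf, hf'⟩ := hn2 G D2 (by rw [Fintype.card_fin]; omega) (by
      intro x y hxy
      rw [SimpleGraph.fromRel_adj] at hxy
      rcases hxy.2 with h | h
      · exact h.1
      · exact h.1.symm) (by
      intro x y hxy
      rw [SimpleGraph.fromRel_adj] at hxy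
      rcases hxy.2 with h | h
      · exact h.2
      · rw [hsymm]; exact h.2) hc
    exact hfree ⟨f, hf, fun a b hab => hf' a b hab⟩
  have hD3 : D3.Colorable K3 := by
    by_contra hc
    obtain ⟨f, hf, hf'⟩ := hn3 G D3 (by rw [Fintype.card_fin]; omega) (by
      intro x y hxy
      rw [SimpleGraph.fromRel_adj] at hxy
      rcases hxy.2 with h | h
      · exact h.1
      · exact h.1.symm) (by
      intro x y hxy
      rw [SimpleGraph.fromRel_adj] at hxy
      rcases hxy.2 with h | h
      · exact h.2
      · rw [hsymm]; exact h.2) hc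
    exact hfree ⟨f, hf, fun a b hab => hf' a b hab⟩
  refine colorable_cover G D2 D3 K2 K3 hD2 hD3 ?_
  intro x y hxy
  rcases hs2 x y hxy with h | h | h
  · exact (hfree (hn1 G (by rw [Fintype.card_fin]; omega) h)).elim
  · left
    rw [SimpleGraph.fromRel_adj]
    exact ⟨hxy.ne, Or.inl ⟨hxy, h⟩⟩
  · right
    rw [SimpleGraph.fromRel_adj]
    exact ⟨hxy.ne, Or.inl ⟨hxy, h⟩⟩
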